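/- arXiv:2408.09745 — 10 statements merged into one kernel-verified Lean document; each statement's English description precedes it below -/
import Mathlib

section
/- There is an absolute constant C > 0 such that for all real H > 0, all real numbers λ₀ < λ₁, every positive integer Q, and every subset S_Q ⊆ (ℤ/Qℤ)², the number of pairs (a,b) ∈ ℤ² with |a| < H^{1/3}, |b| < H^{1/2}, (a mod Q, b mod Q) ∈ S_Q, and λ₀ < −16(4a³ + 27b²)/H < λ₁ equals 4·H^{5/6}·(#S_Q/Q²)·(F_Δ(λ₁) − F_Δ(λ₀)) up to an error of absolute value at most C·(H^{1/2}·#S_Q/Q + #S_Q). -/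
/-- `F_Δ(λ) = (1/4)·∫_{−1}^{1}∫_{−1}^{1} 1[−16(4α³ + 27β²) < λ] dα dβ`. -/
noncomputable def FDelta (lam : ℝ) : ℝ :=
  (1/4) * ∫ α in (-1:ℝ)..1, ∫ β in (-1:ℝ)..1,
    (if -16 * (4 * α^3 + 27 * β^2) < lam then (1:ℝ) else 0)

open MeasureTheory intervalIntegral

lemma aux_sum_Ioo (h : ℝ → ℝ) (hh : Antitone h) (h0 : ∀ x, 0 ≤ h x) (h1 : ∀ x, h x ≤ 1)
    (u v : ℝ) (huv : u ≤ v) :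
    |∑ k ∈ Finset.Ico (⌊u⌋ + 1) ⌈v⌉, h (k : ℝ) - ∫ x in u..v, h x| ≤ 2 := by
  have hint : ∀ a b : ℝ, IntervalIntegrable h volume a b := fun a b => hh.intervalIntegrable
  have hle : ∀ a b : ℝ, a ≤ b → ∫ x in a..b, h x ≤ b - a := by
    intro a b hab
    have := intervalIntegral.integral_mono_on hab (hint a b)
      (intervalIntegrable_const (c := (1:ℝ))) (fun x _ => h1 x)
    simpa using this
  have hge : ∀ a b : ℝ, a ≤ b → 0 ≤ ∫ x in a..b, h x := fun a b hab =>
    intervalIntegral.integral_nonneg hab (fun x _ => h0 x)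
  have hu1 := Int.floor_le u
  have hu2 := Int.lt_floor_add_one u
  have hv1 := Int.le_ceil v
  have hv2 := Int.ceil_lt_add_one v
  rcases le_or_gt ⌈v⌉ (⌊u⌋ + 1) with hc | hc
  · rw [Finset.Ico_eq_empty (by omega)]
    have hc' : (⌈v⌉ : ℝ) ≤ ⌊u⌋ + 1 := by exact_mod_cast hc
    have := hle u v huv
    have := hge u v huv
    rw [abs_le]; simp; constructor <;> linarith
  · obtain ⟨n, hn⟩ : ∃ n : ℕ, ⌈v⌉ = ⌊u⌋ + 1 + ((n + 1 : ℕ) : ℤ) := by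
      refine ⟨(⌈v⌉ - (⌊u⌋ + 1) - 1).toNat, ?_⟩
      push_cast
      omega
    have hn' : (⌈v⌉ : ℝ) = ⌊u⌋ + 1 + (n + 1) := by rw [hn]; push_cast; ring
    have hsum : ∑ k ∈ Finset.Ico (⌊u⌋ + 1) ⌈v⌉, h (k : ℝ)
        = ∑ i ∈ Finset.range (n + 1), h ((⌊u⌋ + 1 : ℝ) + i) := by
      symm
      refine Finset.sum_bij (fun i _ => ⌊u⌋ + 1 + (i : ℤ)) ?_ ?_ ?_ ?_
      · intro i hi
        simp only [Finset.mem_range] at hi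
        simp only [Finset.mem_Ico]
        omega
      · intro i _ j _ hij
        simpa using hij
      · intro k hk
        simp only [Finset.mem_Ico] at hk
        refine ⟨(k - (⌊u⌋ + 1)).toNat, ?_, ?_⟩
        · simp only [Finset.mem_range]; omega
        · omega
      · intro i _
        push_cast
        rfl
    have e1 := AntitoneOn.integral_le_sum (x₀ := (⌊u⌋ + 1 : ℝ)) (a := n + 1) (f := h)
      (hh.antitoneOn _)
    have e2 := AntitoneOn.sum_le_integral (x₀ := (⌊u⌋ + 1 : ℝ)) (a := n) (f := h)
      (hh.antitoneOn _)
    rw [← hsum] at e1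
    rw [Finset.sum_range_succ'] at hsum
    push_cast at e1 e2 hsum
    rw [← hn'] at e1
    have i1 := intervalIntegral.integral_add_adjacent_intervals
      (hint u (⌊u⌋ + 1)) (hint (⌊u⌋ + 1) v)
    have i2 := intervalIntegral.integral_add_adjacent_intervals
      (hint (⌊u⌋ + 1) v) (hint v ⌈v⌉)
    have i3 := intervalIntegral.integral_add_adjacent_intervals
      (hint (⌊u⌋ + 1) (⌊u⌋ + 1 + n)) (hint (⌊u⌋ + 1 + n) v)
    have j1 := hle u (⌊u⌋ + 1) hu2.le
    have j2 := hge u (⌊u⌋ + 1) hu2.le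
    have j3 := hge v ⌈v⌉ hv1
    have j4 := hge (⌊u⌋ + 1 + n) v (by linarith)
    have j5 := h1 (⌊u⌋ + 1 + 0)
    rw [abs_le]
    constructor <;> linarith

lemma aux_sum_class (Q : ℕ) (hQ : 0 < Q) (r : ZMod Q) (A : ℝ) (hA : 0 ≤ A) (g : ℝ → ℝ)
    (hg : Antitone g) (g0 : ∀ x, 0 ≤ g x) (g1 : ∀ x, g x ≤ 1) (T : Finset ℤ)
    (hT : ∀ n : ℤ, n ∈ T ↔ |(n : ℝ)| < A ∧ (n : ZMod Q) = r) :
    |∑ n ∈ T, g (n : ℝ) - (∫ x in (-A)..A, g x) / Q| ≤ 2 := by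
  obtain ⟨r0, rfl⟩ := ZMod.intCast_surjective r
  have hQ' : (0 : ℝ) < Q := by exact_mod_cast hQ
  have key := aux_sum_Ioo (fun x => g (r0 + Q * x))
    (fun x y hxy => hg (by have := mul_le_mul_of_nonneg_left hxy hQ'.le; linarith))
    (fun x => g0 _) (fun x => g1 _) ((-A - r0) / Q) ((A - r0) / Q)
    (by gcongr; linarith)
  rw [intervalIntegral.integral_comp_add_mul _ hQ'.ne'] at key
  have e1 : (r0 : ℝ) + Q * ((-A - r0) / Q) = -A := by field_simp; ring
  have e2 : (r0 : ℝ) + Q * ((A - r0) / Q) = A := by field_simp; ring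
  rw [e1, e2] at key
  have hsum : ∑ n ∈ T, g (n : ℝ)
      = ∑ k ∈ Finset.Ico (⌊(-A - r0) / (Q : ℝ)⌋ + 1) ⌈(A - r0) / (Q : ℝ)⌉, g (r0 + Q * (k : ℝ)) := by
    symm
    have hmem : ∀ k : ℤ, k ∈ Finset.Ico (⌊(-A - r0) / (Q : ℝ)⌋ + 1) ⌈(A - r0) / (Q : ℝ)⌉ ↔
        |((r0 + Q * k : ℤ) : ℝ)| < A := by
      intro k
      rw [Finset.mem_Ico, Int.add_one_le_iff, Int.floor_lt, Int.lt_ceil, div_lt_iff₀ hQ',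
        lt_div_iff₀ hQ', abs_lt]
      push_cast
      constructor <;> rintro ⟨h1, h2⟩ <;> constructor <;> linarith
    refine Finset.sum_bij (fun k _ => r0 + Q * k) ?_ ?_ ?_ ?_
    · intro k hk
      rw [hT]
      exact ⟨(hmem k).1 hk, by simp⟩
    · intro i _ j _ hij
      have : (Q : ℤ) ≠ 0 := by exact_mod_cast hQ.ne'
      simpa [this, hQ.ne'] using hij
    · intro n hn
      rw [hT] at hn
      obtain ⟨h1, h2⟩ := hn
      rw [eq_comm, ZMod.intCast_eq_intCast_iff_dvd_sub] at h2
      obtain ⟨k, hk⟩ := h2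
      have hk' : r0 + Q * k = n := by linarith
      refine ⟨k, ?_, hk'⟩
      rw [hmem, hk']; exact h1
    · intro k _
      push_cast
      rfl
  rw [hsum]
  simpa [smul_eq_mul, div_eq_inv_mul] using key

lemma aux_finset (Q : ℕ) (r : ZMod Q) (A : ℝ) :
    ∃ T : Finset ℤ, ∀ n : ℤ, n ∈ T ↔ |(n : ℝ)| < A ∧ (n : ZMod Q) = r := by
  refine ⟨(Finset.Icc (-⌈A⌉) ⌈A⌉).filter (fun n : ℤ => |(n : ℝ)| < A ∧ (n : ZMod Q) = r), ?_⟩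
  intro n
  simp only [Finset.mem_filter, Finset.mem_Icc, and_iff_right_iff_imp]
  rintro ⟨h, -⟩
  rw [abs_lt] at h
  have := Int.le_ceil A
  constructor
  · have : (-⌈A⌉ : ℝ) ≤ n := by linarith
    exact_mod_cast this
  · have : (n : ℝ) ≤ ⌈A⌉ := by linarith
    exact_mod_cast this

lemma aux_count_open (Q : ℕ) (hQ : 0 < Q) (r : ZMod Q) (A : ℝ) (hA : 0 ≤ A) (T : Finset ℤ)
    (hT : ∀ n : ℤ, n ∈ T ↔ |(n : ℝ)| < A ∧ (n : ZMod Q) = r) :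
    |(T.card : ℝ) - 2 * A / Q| ≤ 2 := by
  have := aux_sum_class Q hQ r A hA (fun _ => 1) antitone_const (by simp) (by simp) T hT
  simp at this
  rwa [← two_mul] at this

lemma aux_count (Q : ℕ) (hQ : 0 < Q) (r : ZMod Q) (t : ℝ) (ht : 0 ≤ t) (T : Finset ℤ)
    (hT1 : ∀ n ∈ T, |(n : ℝ)| ≤ t ∧ (n : ZMod Q) = r)
    (hT2 : ∀ n : ℤ, |(n : ℝ)| < t → (n : ZMod Q) = r → n ∈ T) :
    |(T.card : ℝ) - 2 * t / Q| ≤ 4 := by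
  have hQ' : (0 : ℝ) < Q := by exact_mod_cast hQ
  obtain ⟨T1, h1⟩ := aux_finset Q r t
  obtain ⟨T2, h2⟩ := aux_finset Q r (t + Q)
  have c1 := aux_count_open Q hQ r t ht T1 h1
  have c2 := aux_count_open Q hQ r (t + Q) (by linarith) T2 h2
  have s1 : T1.card ≤ T.card := Finset.card_le_card fun n hn =>
    hT2 n ((h1 n).1 hn).1 ((h1 n).1 hn).2
  have s2 : T.card ≤ T2.card := Finset.card_le_card fun n hn =>
    (h2 n).2 ⟨by linarith [(hT1 n hn).1], (hT1 n hn).2⟩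
  have s1' : (T1.card : ℝ) ≤ T.card := by exact_mod_cast s1
  have s2' : (T.card : ℝ) ≤ T2.card := by exact_mod_cast s2
  have e : 2 * (t + Q) / (Q : ℝ) = 2 * t / Q + 2 := by field_simp
  rw [e] at c2
  rw [abs_le] at *
  constructor <;> linarith

noncomputable def auxMu (lam x : ℝ) : ℝ := min 1 (√((-64 * x ^ 3 - lam) / 432))

lemma auxMu_nonneg (lam x : ℝ) : 0 ≤ auxMu lam x := le_min zero_le_one (Real.sqrt_nonneg _)
lemma auxMu_le (lam x : ℝ) : auxMu lam x ≤ 1 := min_le_left _ _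
lemma auxMu_anti (lam : ℝ) : Antitone (auxMu lam) := by
  intro x y hxy
  have h3 : x ^ 3 ≤ y ^ 3 := (Odd.strictMono_pow (by decide)).monotone hxy
  unfold auxMu
  refine min_le_min le_rfl (Real.sqrt_le_sqrt ?_)
  linarith

lemma aux_lt_mu (lam x y : ℝ) :
    |y| < auxMu lam x ↔ |y| < 1 ∧ lam < -16 * (4 * x ^ 3 + 27 * y ^ 2) := by
  unfold auxMu
  rw [lt_min_iff, Real.lt_sqrt (abs_nonneg _), sq_abs, lt_div_iff₀ (by norm_num)]
  constructor <;> rintro ⟨h1, h2⟩ <;> refine ⟨h1, ?_⟩ <;> linarith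

lemma aux_le_mu (lam x y : ℝ) (h1 : |y| ≤ 1) (h2 : lam ≤ -16 * (4 * x ^ 3 + 27 * y ^ 2)) :
    |y| ≤ auxMu lam x := by
  unfold auxMu
  refine le_min h1 (Real.le_sqrt_of_sq_le ?_)
  rw [sq_abs, le_div_iff₀ (by norm_num)]
  linarith

lemma aux_inner (lam x : ℝ) :
    ∫ β in (-1:ℝ)..1, (if -16 * (4 * x^3 + 27 * β^2) < lam then (1:ℝ) else 0)
      = 2 - 2 * auxMu lam x := by
  have m0 := auxMu_nonneg lam x
  have m1 := auxMu_le lam x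
  set m := auxMu lam x with hm
  set f : ℝ → ℝ := fun β => (if -16 * (4 * x^3 + 27 * β^2) < lam then (1:ℝ) else 0) with hf
  have out : ∀ y : ℝ, |y| ≤ 1 → m < |y| → f y = 1 := by
    intro y h1 h2
    simp only [hf]
    rw [if_pos]
    by_contra hc
    exact absurd (aux_le_mu lam x y h1 (not_lt.1 hc)) (not_le.2 h2)
  have inn : ∀ y : ℝ, |y| < m → f y = 0 := by
    intro y h1
    simp only [hf]
    rw [if_neg]
    exact not_lt.2 ((aux_lt_mu lam x y).1 h1).2.le
  have hi : ∀ a b c : ℝ, a ≤ b → (∀ y ∈ Set.Ioo a b, f y = c) →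
      IntervalIntegrable f volume a b ∧ ∫ y in a..b, f y = (b - a) * c := by
    intro a b c hab h
    have hae : ∀ᵐ y ∂volume, y ∈ Set.uIoc a b → (fun _ => c) y = f y := by
      have : ∀ᵐ y : ℝ ∂volume, y ≠ b := by simp [ae_iff]
      filter_upwards [this] with y hy hmem
      rw [Set.uIoc_of_le hab] at hmem
      exact (h y ⟨hmem.1, lt_of_le_of_ne hmem.2 hy⟩).symm
    constructor
    · refine (intervalIntegrable_const (c := c)).congr_ae ?_
      rw [Filter.EventuallyEq, ae_restrict_iff' measurableSet_uIoc]
      exact hae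
    · rw [← intervalIntegral.integral_congr_ae hae]; simp
  obtain ⟨a1, b1⟩ := hi (-1) (-m) 1 (by linarith) (fun y hy => by
    have : |y| = -y := abs_of_neg (by linarith [hy.2])
    exact out y (by rw [this]; linarith [hy.1]) (by rw [this]; linarith [hy.2]))
  obtain ⟨a2, b2⟩ := hi (-m) m 0 (by linarith) (fun y hy => inn y (abs_lt.2 hy))
  obtain ⟨a3, b3⟩ := hi m 1 1 (by linarith) (fun y hy => by
    have : |y| = y := abs_of_pos (by linarith [hy.1])
    exact out y (by rw [this]; linarith [hy.2]) (by rw [this]; linarith [hy.1]))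
  rw [← intervalIntegral.integral_add_adjacent_intervals (a1.trans a2) a3,
    ← intervalIntegral.integral_add_adjacent_intervals a1 a2, b1, b2, b3]
  ring

lemma aux_FDelta (lam : ℝ) : FDelta lam = 1 - (∫ x in (-1:ℝ)..1, auxMu lam x) / 2 := by
  unfold FDelta
  simp_rw [aux_inner]
  have : IntervalIntegrable (auxMu lam) volume (-1) 1 := (auxMu_anti lam).intervalIntegrable
  rw [intervalIntegral.integral_sub intervalIntegrable_const (this.const_mul 2),
    intervalIntegral.integral_const_mul]
  simp
  ring

/-- The count for a single residue class. -/
lemma aux_class (A B H : ℝ) (hA : 0 < A) (hB : 0 < B) (hA3 : A ^ 3 = H) (hB2 : B ^ 2 = H)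
    (hAB : A ≤ B + 1)
    (lam0 lam1 : ℝ) (hl : lam0 < lam1) (Q : ℕ) (hQ : 0 < Q) (r s : ZMod Q) (T : Finset (ℤ × ℤ))
    (hT : ∀ p : ℤ × ℤ, p ∈ T ↔ (|(p.1 : ℝ)| < A ∧ |(p.2 : ℝ)| < B ∧
      lam0 < -16 * (4 * (p.1 : ℝ)^3 + 27 * (p.2 : ℝ)^2) / H ∧
      -16 * (4 * (p.1 : ℝ)^3 + 27 * (p.2 : ℝ)^2) / H < lam1) ∧
      (p.1 : ZMod Q) = r ∧ (p.2 : ZMod Q) = s) :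
    |(T.card : ℝ) - 4 * (A * B) / (Q : ℝ) ^ 2 * (FDelta lam1 - FDelta lam0)|
      ≤ 100 * (B / Q + 1) := by
  have hQ' : (1 : ℝ) ≤ Q := by exact_mod_cast hQ
  obtain ⟨TA, hTA⟩ := aux_finset Q r A
  obtain ⟨TB, hTB⟩ := aux_finset Q s B
  have hH : 0 < H := by rw [← hA3]; positivity
  have hf : ∀ a b : ℤ, -16 * (4 * (a : ℝ)^3 + 27 * (b : ℝ)^2) / H
      = -16 * (4 * (a / A : ℝ)^3 + 27 * (b / B : ℝ)^2) := by
    intro a b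
    rw [div_pow, div_pow, hA3, hB2]; ring
  have habs : ∀ b : ℤ, |(b / B : ℝ)| = |(b : ℝ)| / B := by
    intro b; rw [abs_div, abs_of_pos hB]
  -- fibre counts
  have hfib : ∀ a ∈ TA, |((T.filter (fun p => p.1 = a)).card : ℝ)
      - 2 * B * (auxMu lam0 (a / A) - auxMu lam1 (a / A)) / Q| ≤ 8 := by
    intro a ha
    rw [hTA] at ha
    set f : ℤ → ℝ := fun b => -16 * (4 * (a / A : ℝ)^3 + 27 * (b / B : ℝ)^2) with hfdef
    set T0 := TB.filter (fun b => lam0 < f b)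
    set T1 := TB.filter (fun b => lam1 ≤ f b)
    have hsub : T1 ⊆ T0 := by
      intro b hb
      simp only [T0, T1, Finset.mem_filter] at hb ⊢
      exact ⟨hb.1, lt_of_lt_of_le hl hb.2⟩
    have hcard : (T.filter (fun p => p.1 = a)).card = (T0 \ T1).card := by
      refine Finset.card_bij (fun p _ => p.2) ?_ ?_ ?_
      · rintro ⟨a', b⟩ hp
        simp only [Finset.mem_filter, hT] at hp
        obtain ⟨⟨⟨h1, h2, h3, h4⟩, h5, h6⟩, rfl⟩ := hp
        rw [hf] at h3 h4
        simp only [T0, T1, Finset.mem_sdiff, Finset.mem_filter, hTB, not_and, not_le]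
        exact ⟨⟨⟨h2, h6⟩, h3⟩, fun _ => h4⟩
      · rintro ⟨a1, b1⟩ h1 ⟨a2, b2⟩ h2 h
        simp only [Finset.mem_filter] at h1 h2
        ext
        · exact h1.2.trans h2.2.symm
        · exact h
      · intro b hb
        simp only [T0, T1, Finset.mem_sdiff, Finset.mem_filter, hTB, not_and, not_le] at hb
        refine ⟨(a, b), ?_, rfl⟩
        simp only [Finset.mem_filter, hT, and_true]
        rw [hf]
        exact ⟨⟨ha.1, hb.1.1.1, hb.1.2, hb.2 hb.1.1⟩, ha.2, hb.1.1.2⟩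
    have hcard' : ((T.filter (fun p => p.1 = a)).card : ℝ) = T0.card - T1.card := by
      rw [hcard, Finset.cast_card_sdiff hsub]
    have c0 := aux_count Q hQ s (B * auxMu lam0 (a / A))
      (mul_nonneg hB.le (auxMu_nonneg _ _)) T0
      (by
        intro b hb
        simp only [T0, Finset.mem_filter, hTB] at hb
        refine ⟨?_, hb.1.2⟩
        have := aux_le_mu lam0 (a / A) (b / B) (by rw [habs, div_le_one hB]; exact hb.1.1.le)
          hb.2.le
        rw [habs, div_le_iff₀ hB] at this
        linarith)
      (by
        intro b hb hs
        have : |(b / B : ℝ)| < auxMu lam0 (a / A) := by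
          rw [habs, div_lt_iff₀ hB]; linarith
        rw [aux_lt_mu, habs, div_lt_one hB] at this
        simp only [T0, Finset.mem_filter, hTB]
        exact ⟨⟨this.1, hs⟩, this.2⟩)
    have c1 := aux_count Q hQ s (B * auxMu lam1 (a / A))
      (mul_nonneg hB.le (auxMu_nonneg _ _)) T1
      (by
        intro b hb
        simp only [T1, Finset.mem_filter, hTB] at hb
        refine ⟨?_, hb.1.2⟩
        have := aux_le_mu lam1 (a / A) (b / B) (by rw [habs, div_le_one hB]; exact hb.1.1.le)
          hb.2
        rw [habs, div_le_iff₀ hB] at this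
        linarith)
      (by
        intro b hb hs
        have : |(b / B : ℝ)| < auxMu lam1 (a / A) := by
          rw [habs, div_lt_iff₀ hB]; linarith
        rw [aux_lt_mu, habs, div_lt_one hB] at this
        simp only [T1, Finset.mem_filter, hTB]
        exact ⟨⟨this.1, hs⟩, this.2.le⟩)
    rw [hcard']
    have e : 2 * B * (auxMu lam0 (a / A) - auxMu lam1 (a / A)) / Q
      = 2 * (B * auxMu lam0 (a / A)) / Q - 2 * (B * auxMu lam1 (a / A)) / Q := by ring
    rw [e]
    rw [abs_le] at *
    constructor <;> linarith
  have htot : (T.card : ℝ) = ∑ a ∈ TA, ((T.filter (fun p => p.1 = a)).card : ℝ) := by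
    rw [Finset.card_eq_sum_card_fiberwise (f := fun p : ℤ × ℤ => p.1) (t := TA)]
    · push_cast; rfl
    · intro p hp
      have := (hT p).1 hp
      exact (hTA _).2 ⟨this.1.1, this.2.1⟩
  have hscale : ∀ lam, ∫ x in (-A)..A, auxMu lam (x / A) = A * ∫ x in (-1:ℝ)..1, auxMu lam x := by
    intro lam
    rw [intervalIntegral.integral_comp_div _ hA.ne', neg_div, div_self hA.ne', smul_eq_mul]
  have hanti : ∀ lam, Antitone (fun x => auxMu lam (x / A)) := fun lam x y hxy =>
    auxMu_anti lam (by gcongr)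
  have s0 := aux_sum_class Q hQ r A hA.le (fun x => auxMu lam0 (x / A)) (hanti _)
    (fun _ => auxMu_nonneg _ _) (fun _ => auxMu_le _ _) TA hTA
  have s1 := aux_sum_class Q hQ r A hA.le (fun x => auxMu lam1 (x / A)) (hanti _)
    (fun _ => auxMu_nonneg _ _) (fun _ => auxMu_le _ _) TA hTA
  have sA := aux_count_open Q hQ r A hA.le TA hTA
  simp only [hscale] at s0 s1
  rw [aux_FDelta, aux_FDelta]
  set I0 := ∫ x in (-1:ℝ)..1, auxMu lam0 x
  set I1 := ∫ x in (-1:ℝ)..1, auxMu lam1 x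
  set M0 := ∑ n ∈ TA, auxMu lam0 (n / A)
  set M1 := ∑ n ∈ TA, auxMu lam1 (n / A)
  have step1 : |(T.card : ℝ) - 2 * B * (M0 - M1) / Q| ≤ TA.card * 8 := by
    have e : (2 * B * (M0 - M1) / Q : ℝ)
        = ∑ a ∈ TA, 2 * B * (auxMu lam0 (a / A) - auxMu lam1 (a / A)) / Q := by
      rw [← Finset.sum_div, ← Finset.mul_sum, Finset.sum_sub_distrib]
    rw [htot, e, ← Finset.sum_sub_distrib]
    refine (Finset.abs_sum_le_sum_abs _ _).trans ((Finset.sum_le_sum hfib).trans ?_)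
    simp
  have step2 : |2 * B * (M0 - M1) / Q
      - 4 * (A * B) / (Q : ℝ) ^ 2 * (1 - I1 / 2 - (1 - I0 / 2))| ≤ 8 * (B / Q) := by
    have e : 2 * B * (M0 - M1) / Q
      - 4 * (A * B) / (Q : ℝ) ^ 2 * (1 - I1 / 2 - (1 - I0 / 2))
      = 2 * (B / Q) * ((M0 - A * I0 / Q) - (M1 - A * I1 / Q)) := by
      field_simp; ring
    have hBQ : 0 ≤ B / Q := by positivity
    rw [e, abs_mul, abs_of_nonneg (by positivity : 0 ≤ 2 * (B / Q))]
    have : |(M0 - A * I0 / Q) - (M1 - A * I1 / Q)| ≤ 4 := by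
      rw [abs_le] at *
      constructor <;> linarith
    nlinarith
  have hAQ : A / Q ≤ B / Q + 1 := by
    have h1 : A / Q ≤ (B + 1) / Q := by gcongr
    have h2 : (1 : ℝ) / Q ≤ 1 := by rw [div_le_one (by linarith)]; exact hQ'
    rw [add_div] at h1
    linarith
  have hBQ : 0 ≤ B / Q := by positivity
  rw [mul_div_assoc] at sA
  rw [abs_le] at *
  constructor <;> linarith

theorem stmt0 :
    ∃ C : ℝ, 0 < C ∧ ∀ (H : ℝ), 0 < H → ∀ (lam0 lam1 : ℝ), lam0 < lam1 →
      ∀ (Q : ℕ), 0 < Q → ∀ (S : Finset (ZMod Q × ZMod Q)),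
      |(Nat.card {ab : ℤ × ℤ |
            (|ab.1| : ℝ) < H ^ ((1:ℝ)/3) ∧ (|ab.2| : ℝ) < H ^ ((1:ℝ)/2) ∧
            ((ab.1 : ZMod Q), (ab.2 : ZMod Q)) ∈ S ∧
            lam0 < -16 * (4 * (ab.1 : ℝ)^3 + 27 * (ab.2 : ℝ)^2) / H ∧
            -16 * (4 * (ab.1 : ℝ)^3 + 27 * (ab.2 : ℝ)^2) / H < lam1} : ℝ)
          - 4 * H ^ ((5:ℝ)/6) * ((S.card : ℝ) / (Q : ℝ)^2) * (FDelta lam1 - FDelta lam0)|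
        ≤ C * (H ^ ((1:ℝ)/2) * (S.card : ℝ) / (Q : ℝ) + (S.card : ℝ)) := by
  refine ⟨100, by norm_num, ?_⟩
  intro H hH lam0 lam1 hl Q hQ S
  have hQ' : (1 : ℝ) ≤ Q := by exact_mod_cast hQ
  set A := H ^ ((1:ℝ)/3) with hAdef
  set B := H ^ ((1:ℝ)/2) with hBdef
  have hA : 0 < A := Real.rpow_pos_of_pos hH _
  have hB : 0 < B := Real.rpow_pos_of_pos hH _
  have hA3 : A ^ 3 = H := by
    rw [hAdef, ← Real.rpow_natCast, ← Real.rpow_mul hH.le]; norm_num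
  have hB2 : B ^ 2 = H := by
    rw [hBdef, ← Real.rpow_natCast, ← Real.rpow_mul hH.le]; norm_num
  have hAB5 : H ^ ((5:ℝ)/6) = A * B := by
    rw [hAdef, hBdef, ← Real.rpow_add hH]; norm_num
  have hAB : A ≤ B + 1 := by
    rcases le_or_gt 1 H with h | h
    · have : A ≤ B := Real.rpow_le_rpow_of_exponent_le h (by norm_num)
      linarith
    · have : A ≤ 1 := Real.rpow_le_one hH.le h.le (by norm_num)
      linarith
  rw [hAB5]
  clear_value A B
  set P : ℤ × ℤ → Prop := fun p => |(p.1 : ℝ)| < A ∧ |(p.2 : ℝ)| < B ∧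
      lam0 < -16 * (4 * (p.1 : ℝ)^3 + 27 * (p.2 : ℝ)^2) / H ∧
      -16 * (4 * (p.1 : ℝ)^3 + 27 * (p.2 : ℝ)^2) / H < lam1 with hP
  classical
  obtain ⟨TA, hTA⟩ := aux_finset 1 0 A
  obtain ⟨TB, hTB⟩ := aux_finset 1 0 B
  set cl : ℤ × ℤ → ZMod Q × ZMod Q := fun p => ((p.1 : ZMod Q), (p.2 : ZMod Q)) with hcl
  set W := (TA ×ˢ TB).filter (fun p => P p ∧ cl p ∈ S) with hW
  have hWmem : ∀ p, p ∈ W ↔ P p ∧ cl p ∈ S := by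
    intro p
    simp only [hW, Finset.mem_filter, Finset.mem_product, hTA, hTB, and_iff_right_iff_imp]
    rintro ⟨⟨h1, h2, -⟩, -⟩
    exact ⟨⟨h1, Subsingleton.elim _ _⟩, ⟨h2, Subsingleton.elim _ _⟩⟩
  have hset : {ab : ℤ × ℤ |
            (|ab.1| : ℝ) < A ∧ (|ab.2| : ℝ) < B ∧
            ((ab.1 : ZMod Q), (ab.2 : ZMod Q)) ∈ S ∧
            lam0 < -16 * (4 * (ab.1 : ℝ)^3 + 27 * (ab.2 : ℝ)^2) / H ∧
            -16 * (4 * (ab.1 : ℝ)^3 + 27 * (ab.2 : ℝ)^2) / H < lam1} = (W : Set (ℤ × ℤ)) := by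
    ext p
    simp only [Set.mem_ofPred_eq, Finset.mem_coe, hWmem, hP, hcl]
    push_cast
    tauto
  rw [hset]
  have hcard : Nat.card (W : Set (ℤ × ℤ)) = W.card := by simp
  rw [hcard, Finset.card_eq_sum_card_fiberwise (f := cl) (t := S)
    (fun p hp => ((hWmem p).1 hp).2)]
  have e : 4 * (A * B) * ((S.card : ℝ) / (Q : ℝ)^2) * (FDelta lam1 - FDelta lam0)
      = ∑ c ∈ S, 4 * (A * B) / (Q : ℝ) ^ 2 * (FDelta lam1 - FDelta lam0) := by
    rw [Finset.sum_const, nsmul_eq_mul]; ring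
  push_cast
  rw [e, ← Finset.sum_sub_distrib]
  have hb : ∀ c ∈ S, |((W.filter (fun p => cl p = c)).card : ℝ)
      - 4 * (A * B) / (Q : ℝ) ^ 2 * (FDelta lam1 - FDelta lam0)| ≤ 100 * (B / Q + 1) := by
    rintro ⟨r, s⟩ hc
    refine aux_class A B H hA hB hA3 hB2 hAB lam0 lam1 hl Q hQ r s _ ?_
    intro p
    simp only [Finset.mem_filter, hWmem]
    constructor
    · rintro ⟨⟨h1, -⟩, h3⟩
      exact ⟨h1, congrArg Prod.fst h3, congrArg Prod.snd h3⟩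
    · rintro ⟨h1, h2, h3⟩
      have : cl p = (r, s) := Prod.ext h2 h3
      exact ⟨⟨h1, this ▸ hc⟩, this⟩
  refine (Finset.abs_sum_le_sum_abs _ _).trans ((Finset.sum_le_sum hb).trans (le_of_eq ?_))
  rw [Finset.sum_const, nsmul_eq_mul]; ring
end

section
/- There is an absolute constant C > 0 with the following property. Let r, t be fixed integers with 3 ∤ r and 2 ∤ t, let H > 0, let λ₀ < λ₁ be real numbers, let Q be a positive integer with 6 ∣ Q, and let S_Q ⊆ (ℤ/Qℤ)² be such that every (a,b) ∈ S_Q satisfies a ≡ r (mod 6) and b ≡ t (mod 6), and such that for every (a,b) ∈ S_Q there is no integer d with gcd(d,Q) > 1, gcd(d⁴,Q) ∣ gcd(a,Q), and gcd(d⁶,Q) ∣ gcd(b,Q) (where gcd(a,Q) is computed from any lift of a to ℤ). Then the number of pairs (a,b) ∈ F(H) with (a mod Q, b mod Q) ∈ S_Q and λ₀ < Δ_{a,b}/H < λ₁ equals (4·H^{5/6}/ζ^{(Q)}(10))·(#S_Q/Q²)·(F_Δ(λ₁) − F_Δ(λ₀)) up to an error of absolute value at most C·(H^{1/2}·#S_Q/Q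 + #S_Q). -/
/-- The family `F(H)` of pairs `(a,b)` with `a ≡ r (mod 6)`, `b ≡ t (mod 6)`,
`|a| ≤ H^{1/3}`, `|b| ≤ H^{1/2}`, and `p⁴ ∣ a → p⁶ ∤ b` for all primes `p`. -/
def Family (r t : ℤ) (H : ℝ) : Set (ℤ × ℤ) :=
  {ab | ab.1 ≡ r [ZMOD 6] ∧ ab.2 ≡ t [ZMOD 6] ∧
    (|ab.1| : ℝ) ≤ H ^ ((1:ℝ)/3) ∧ (|ab.2| : ℝ) ≤ H ^ ((1:ℝ)/2) ∧
    ∀ p : ℕ, p.Prime → (p : ℤ)^4 ∣ ab.1 → ¬((p : ℤ)^6 ∣ ab.2)}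

/-- `ζ^{(m)}(s) = ζ(s)·∏_{p ∣ m} (1 − p^{−s})` for real `s > 1`. -/
noncomputable def zetaRemoved (m : ℕ) (s : ℝ) : ℝ :=
  (∑' n : ℕ, 1 / ((n : ℝ) + 1) ^ s) * ∏ p ∈ m.primeFactors, (1 - (p : ℝ) ^ (-s))

open Finset in
lemma aux_sum_Icc (g : ℝ → ℝ) (Y : ℝ) (hg : Antitone g) (h0 : ∀ x, 0 ≤ g x) (hY : ∀ x, g x ≤ Y)
    (p q : ℝ) (hpq : p ≤ q) :
    |∑ k ∈ Icc ⌈p⌉ ⌊q⌋, g (k : ℝ) - ∫ x in p..q, g x| ≤ 2 * Y := by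
  have hY0 : 0 ≤ Y := (h0 0).trans (hY 0)
  have hint : ∀ a b : ℝ, IntervalIntegrable g MeasureTheory.volume a b := fun a b =>
    hg.intervalIntegrable
  have hlow : ∀ a b : ℝ, a ≤ b → 0 ≤ ∫ x in a..b, g x := fun a b hab =>
    intervalIntegral.integral_nonneg hab (fun x _ => h0 x)
  have hup : ∀ a b : ℝ, a ≤ b → b ≤ a + 1 → ∫ x in a..b, g x ≤ Y := by
    intro a b hab hb
    have h1 : ∫ x in a..b, g x ≤ ∫ x in a..b, Y :=
      intervalIntegral.integral_mono_on hab (hint a b) (by simp) (fun x _ => hY x)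
    rw [intervalIntegral.integral_const, smul_eq_mul] at h1
    nlinarith
  have c1 := Int.le_ceil p
  have c2 := Int.ceil_lt_add_one p
  have f1 := Int.floor_le q
  have f2 := Int.lt_floor_add_one q
  rcases lt_or_ge ⌊q⌋ ⌈p⌉ with h | h
  · rw [Finset.Icc_eq_empty (by omega), Finset.sum_empty, zero_sub, abs_neg]
    have h' : (⌊q⌋ : ℝ) + 1 ≤ ⌈p⌉ := by exact_mod_cast h
    rw [abs_of_nonneg (hlow p q hpq)]
    linarith [hup p q hpq (by linarith)]
  · obtain ⟨n, hn⟩ := Int.le.dest h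
    have hn' : (⌊q⌋ : ℝ) = ⌈p⌉ + n := by rw [← hn]; push_cast; ring
    have hsum : ∑ k ∈ Icc ⌈p⌉ ⌊q⌋, g (k : ℝ) = ∑ i ∈ range (n + 1), g ((⌈p⌉ : ℝ) + i) := by
      symm
      refine Finset.sum_bij (fun i _ => ⌈p⌉ + (i : ℤ)) ?_ ?_ ?_ ?_
      · intro i hi
        simp only [Finset.mem_range] at hi
        rw [Finset.mem_Icc]; omega
      · intro i _ j _ hij
        simpa using hij
      · intro k hk
        rw [Finset.mem_Icc] at hk
        refine ⟨(k - ⌈p⌉).toNat, ?_, ?_⟩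
        · rw [Finset.mem_range]; omega
        · omega
      · intro i _; push_cast; rfl
    have e1 : ∫ x in p..q, g x = (∫ x in p..(⌈p⌉:ℝ), g x) + (∫ x in (⌈p⌉:ℝ)..(⌈p⌉:ℝ) + n, g x)
        + ∫ x in (⌈p⌉:ℝ) + n..q, g x := by
      rw [intervalIntegral.integral_add_adjacent_intervals (hint _ _) (hint _ _),
        intervalIntegral.integral_add_adjacent_intervals (hint _ _) (hint _ _)]
    have i1 := AntitoneOn.integral_le_sum (x₀ := (⌈p⌉:ℝ)) (a := n) (hg.antitoneOn _)
    have i2 := AntitoneOn.sum_le_integral (x₀ := (⌈p⌉:ℝ)) (a := n) (hg.antitoneOn _)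
    have s1 := Finset.sum_range_succ (fun i : ℕ => g ((⌈p⌉ : ℝ) + i)) n
    have s2 := Finset.sum_range_succ' (fun i : ℕ => g ((⌈p⌉ : ℝ) + i)) n
    have a1 := hlow p ⌈p⌉ c1
    have a2 := hup p ⌈p⌉ c1 c2.le
    have a3 := hlow ((⌈p⌉:ℝ) + n) q (by linarith)
    have a4 := hup ((⌈p⌉:ℝ) + n) q (by linarith) (by linarith)
    have b1 := h0 ((⌈p⌉:ℝ) + n)
    have b2 := hY ((⌈p⌉:ℝ) + (0:ℕ))
    rw [hsum, e1, abs_le]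
    constructor <;> linarith

lemma aux_prog_sum (f : ℝ → ℝ) (Y : ℝ) (hf : Antitone f) (h0 : ∀ x, 0 ≤ f x) (hY : ∀ x, f x ≤ Y)
    (X : ℝ) (hX : 0 ≤ X) (M : ℕ) (hM : 0 < M) (a0 : ℤ) (s : Finset ℤ)
    (hs : ∀ a : ℤ, a ∈ s ↔ |(a : ℝ)| ≤ X ∧ a ≡ a0 [ZMOD M]) :
    |∑ a ∈ s, f (a : ℝ) - (∫ x in (-X)..X, f x) / M| ≤ 2 * Y := by
  have hM' : (0:ℝ) < M := by exact_mod_cast hM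
  have key := aux_sum_Icc (fun x => f (a0 + M * x)) Y
    (fun x y hxy => hf (by gcongr)) (fun x => h0 _) (fun x => hY _)
    ((-X - a0) / M) ((X - a0) / M) (by gcongr; linarith)
  have e2 : ∫ x in ((-X - a0) / M)..((X - a0) / M), f (a0 + M * x) = (∫ x in (-X)..X, f x) / M := by
    rw [intervalIntegral.integral_comp_add_mul f hM'.ne']
    rw [mul_div_cancel₀ _ hM'.ne', mul_div_cancel₀ _ hM'.ne', smul_eq_mul]
    simp only [add_sub_cancel]
    field_simp
  have e1 : ∑ a ∈ s, f (a : ℝ) =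
      ∑ k ∈ Finset.Icc ⌈(-X - a0) / M⌉ ⌊(X - a0) / M⌋, f (a0 + M * (k : ℝ)) := by
    symm
    refine Finset.sum_bij (fun k _ => a0 + M * k) ?_ ?_ ?_ ?_
    · intro k hk
      rw [Finset.mem_Icc, Int.ceil_le, Int.le_floor, div_le_iff₀ hM', le_div_iff₀ hM'] at hk
      rw [hs, abs_le]
      push_cast
      refine ⟨⟨by linarith, by linarith⟩, ?_⟩
      exact (Int.modEq_iff_dvd.2 ⟨-k, by ring⟩)
    · intro i _ j _ hij

      simpa [hM.ne'] using hij
    · intro a ha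
      rw [hs, abs_le] at ha
      obtain ⟨⟨h1, h2⟩, h3⟩ := ha
      obtain ⟨k, hk⟩ := (Int.modEq_iff_dvd.1 h3.symm)
      have hk' : (a : ℝ) - a0 = M * k := by exact_mod_cast hk
      refine ⟨k, ?_, by linarith⟩
      rw [Finset.mem_Icc, Int.ceil_le, Int.le_floor, div_le_iff₀ hM', le_div_iff₀ hM']
      constructor <;> linarith
    · intro k _; push_cast; rfl
  rw [e1, ← e2]
  exact key

lemma aux_prog_card (X : ℝ) (hX : 0 ≤ X) (M : ℕ) (hM : 0 < M) (a0 : ℤ) (s : Finset ℤ)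
    (hs : ∀ a : ℤ, a ∈ s ↔ |(a : ℝ)| ≤ X ∧ a ≡ a0 [ZMOD M]) :
    |(s.card : ℝ) - 2 * X / M| ≤ 2 := by
  have := aux_prog_sum (fun _ => 1) 1 antitone_const (by simp) (by simp) X hX M hM a0 s hs
  simp only [Finset.sum_const, nsmul_eq_mul, mul_one, intervalIntegral.integral_const,
    smul_eq_mul] at this
  convert this using 4
  ring

open Classical in
/-- the integers of absolute value at most `X` that are congruent to `a0` -/
noncomputable def progSet (X : ℝ) (M : ℕ) (a0 : ℤ) : Finset ℤ :=
  (Finset.Icc (-⌊X⌋) ⌊X⌋).filter (fun a => a ≡ a0 [ZMOD M])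

lemma mem_progSet (X : ℝ) (M : ℕ) (a0 a : ℤ) :
    a ∈ progSet X M a0 ↔ |(a : ℝ)| ≤ X ∧ a ≡ a0 [ZMOD M] := by
  have : |(a:ℝ)| ≤ X ↔ -⌊X⌋ ≤ a ∧ a ≤ ⌊X⌋ := by
    rw [← abs_le, Int.le_floor]; push_cast; rfl
  rw [progSet, Finset.mem_filter, Finset.mem_Icc, this]

lemma aux_between (u : ℝ) (hu : 0 ≤ u) (N : ℕ) (hN : 0 < N) (b0 : ℤ) (B : Finset ℤ)
    (h1 : ∀ b ∈ B, |(b : ℝ)| ≤ u ∧ b ≡ b0 [ZMOD N])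
    (h2 : ∀ b : ℤ, |(b : ℝ)| < u → b ≡ b0 [ZMOD N] → b ∈ B) :
    |(B.card : ℝ) - 2 * u / N| ≤ 4 := by
  have k1 := aux_prog_card u hu N hN b0 (progSet u N b0) (mem_progSet u N b0)
  have s1 : B ⊆ progSet u N b0 := fun b hb => (mem_progSet _ _ _ _).2 (h1 b hb)
  have s2 : progSet u N b0 ⊆ B ∪ {⌊u⌋, -⌊u⌋} := by
    intro b hb
    rw [mem_progSet] at hb
    rcases lt_or_eq_of_le hb.1 with h | h
    · exact Finset.mem_union_left _ (h2 b h hb.2)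
    · apply Finset.mem_union_right
      have : ⌊u⌋ = |b| := by rw [← h, ← Int.cast_abs, Int.floor_intCast]
      rw [this]
      rcases abs_choice b with h' | h' <;> simp [h']
  have c1 := Finset.card_le_card s1
  have c2 := (Finset.card_le_card s2).trans (Finset.card_union_le _ _)
  have c3 : ({⌊u⌋, -⌊u⌋} : Finset ℤ).card ≤ 2 := Finset.card_le_two
  have c4 : (progSet u N b0).card ≤ B.card + 2 := by omega
  have c1' : (B.card : ℝ) ≤ (progSet u N b0).card := by exact_mod_cast c1
  have c4' : ((progSet u N b0).card : ℝ) ≤ B.card + 2 := by exact_mod_cast c4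
  rw [abs_le] at k1 ⊢
  constructor <;> linarith
/-- half-length of the slice of the complement of the discriminant region -/
noncomputable def vfun (lam α : ℝ) : ℝ := min 1 (√((-lam / 16 - 4 * α ^ 3) / 27))

lemma vfun_nonneg (lam α : ℝ) : 0 ≤ vfun lam α := le_min zero_le_one (Real.sqrt_nonneg _)

lemma vfun_le_one (lam α : ℝ) : vfun lam α ≤ 1 := min_le_left _ _

lemma vfun_antitone (lam : ℝ) : Antitone (vfun lam) := by
  intro x y hxy
  unfold vfun
  have : x ^ 3 ≤ y ^ 3 := (Odd.strictMono_pow (by decide : Odd 3)).monotone hxy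
  gcongr

lemma vfun_low (lam α β : ℝ) (h : |β| < vfun lam α) :
    β ^ 2 < (-lam / 16 - 4 * α ^ 3) / 27 := by
  have h1 := (lt_min_iff.1 h).2
  rw [Real.lt_sqrt (abs_nonneg _), sq_abs] at h1
  exact h1

lemma vfun_high (lam α β : ℝ) (h1 : |β| ≤ 1) (h : vfun lam α < |β|) :
    (-lam / 16 - 4 * α ^ 3) / 27 < β ^ 2 := by
  rcases min_lt_iff.1 h with h2 | h2
  · linarith
  · have := Real.lt_sq_of_sqrt_lt h2
    rwa [sq_abs] at this

lemma inner_integral (lam α : ℝ) :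
    ∫ β in (-1:ℝ)..1, (if -16 * (4 * α^3 + 27 * β^2) < lam then (1:ℝ) else 0)
      = 2 - 2 * vfun lam α := by
  set w := vfun lam α with hw
  have w0 := vfun_nonneg lam α
  have w1 := vfun_le_one lam α
  rw [← hw] at w0 w1
  set g : ℝ → ℝ := fun β => if -16 * (4 * α^3 + 27 * β^2) < lam then (1:ℝ) else 0 with hg
  have hmeas : Measurable g := by
    apply Measurable.ite _ measurable_const measurable_const
    exact measurableSet_lt (by fun_prop) measurable_const
  have hint : ∀ a b : ℝ, IntervalIntegrable g MeasureTheory.volume a b := by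
    intro a b
    apply (intervalIntegrable_const (c := (1:ℝ))).mono_fun hmeas.aestronglyMeasurable
    filter_upwards with x
    simp only [hg]; split_ifs <;> simp
  have e1 : ∫ β in (-1:ℝ)..(-w), g β = ∫ β in (-1:ℝ)..(-w), (1:ℝ) := by
    apply intervalIntegral.integral_congr_Ioo_of_le (by linarith)
    intro x hx
    have hx1 : |x| = -x := abs_of_nonpos (by linarith [hx.2])
    have := vfun_high lam α x (by rw [hx1]; linarith [hx.1]) (by rw [hx1]; linarith [hx.2])
    simp only [hg]; rw [if_pos (by linarith)]
  have e3 : ∫ β in w..1, g β = ∫ β in w..1, (1:ℝ) := by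
    apply intervalIntegral.integral_congr_Ioo_of_le (by linarith)
    intro x hx
    have hx1 : |x| = x := abs_of_nonneg (by linarith [hx.1])
    have := vfun_high lam α x (by rw [hx1]; linarith [hx.2]) (by rw [hx1]; linarith [hx.1])
    simp only [hg]; rw [if_pos (by linarith)]
  have e2 : ∫ β in (-w)..w, g β = ∫ β in (-w)..w, (0:ℝ) := by
    apply intervalIntegral.integral_congr_Ioo_of_le (by linarith)
    intro x hx
    have := vfun_low lam α x (abs_lt.2 ⟨hx.1, hx.2⟩)
    simp only [hg]; rw [if_neg (by linarith)]
  rw [← intervalIntegral.integral_add_adjacent_intervals (hint (-1) (-w)) (hint _ _),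
    ← intervalIntegral.integral_add_adjacent_intervals (hint (-w) w) (hint _ _), e1, e2, e3]
  simp
  ring

lemma FDelta_eq (lam : ℝ) : FDelta lam = 1 - (∫ α in (-1:ℝ)..1, vfun lam α) / 2 := by
  unfold FDelta
  simp_rw [inner_integral]
  rw [intervalIntegral.integral_sub (by simp) ((vfun_antitone lam).intervalIntegrable.const_mul 2)]
  rw [intervalIntegral.integral_const_mul]
  simp
  ring

lemma FDelta_mem (lam : ℝ) : 0 ≤ FDelta lam ∧ FDelta lam ≤ 1 := by
  rw [FDelta_eq]
  have h1 : 0 ≤ ∫ α in (-1:ℝ)..1, vfun lam α :=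
    intervalIntegral.integral_nonneg (by norm_num) (fun x _ => vfun_nonneg _ _)
  have h2 : ∫ α in (-1:ℝ)..1, vfun lam α ≤ ∫ α in (-1:ℝ)..1, (1:ℝ) :=
    intervalIntegral.integral_mono_on (by norm_num) (vfun_antitone lam).intervalIntegrable (by simp)
      (fun x _ => vfun_le_one _ _)
  simp at h2
  constructor <;> linarith

lemma integral_scaled (lam X Y : ℝ) (hX : 0 < X) :
    ∫ x in (-X)..X, Y * vfun lam (x / X) = 2 * X * Y * (1 - FDelta lam) := by
  rw [intervalIntegral.integral_const_mul, intervalIntegral.integral_comp_div _ hX.ne', FDelta_eq,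
    neg_div, div_self hX.ne', smul_eq_mul]
  ring
/-- normalized discriminant -/
noncomputable def nd (H : ℝ) (a b : ℤ) : ℝ := -16 * (4 * (a : ℝ)^3 + 27 * (b : ℝ)^2) / H

lemma nd_lt_iff (X Y H lam : ℝ) (hXH : X ^ 3 = H) (hYH : Y ^ 2 = H)
    (a b : ℤ) : nd H a b < lam ↔ (-lam / 16 - 4 * ((a : ℝ) / X) ^ 3) / 27 < ((b : ℝ) / Y) ^ 2 := by
  have : nd H a b = -16 * (4 * ((a : ℝ) / X) ^ 3 + 27 * ((b : ℝ) / Y) ^ 2) := by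
    rw [nd, div_pow, div_pow, hXH, hYH]; ring
  rw [this]
  constructor <;> intro h <;> linarith

lemma lt_nd_iff (X Y H lam : ℝ) (hXH : X ^ 3 = H) (hYH : Y ^ 2 = H)
    (a b : ℤ) : lam < nd H a b ↔ ((b : ℝ) / Y) ^ 2 < (-lam / 16 - 4 * ((a : ℝ) / X) ^ 3) / 27 := by
  have : nd H a b = -16 * (4 * ((a : ℝ) / X) ^ 3 + 27 * ((b : ℝ) / Y) ^ 2) := by
    rw [nd, div_pow, div_pow, hXH, hYH]; ring
  rw [this]
  constructor <;> intro h <;> linarith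

open Classical in
lemma slice_count (X Y H lam0 lam1 : ℝ) (hY : 0 < Y) (hXH : X ^ 3 = H)
    (hYH : Y ^ 2 = H) (hlam : lam0 < lam1) (N : ℕ) (hN : 0 < N) (a b1 : ℤ) :
    |((((progSet Y N b1).filter (fun b => lam0 < nd H a b ∧ nd H a b < lam1)).card : ℕ) : ℝ)
      - 2 * (Y * vfun lam0 (a / X) - Y * vfun lam1 (a / X)) / N| ≤ 8 := by
  set B0 := (progSet Y N b1).filter (fun b => lam0 < nd H a b) with hB0
  set B1 := (progSet Y N b1).filter (fun b => lam1 ≤ nd H a b) with hB1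
  have hsub : B1 ⊆ B0 := by
    intro b hb
    rw [hB1, Finset.mem_filter] at hb
    rw [hB0, Finset.mem_filter]
    exact ⟨hb.1, hlam.trans_le hb.2⟩
  have hT : (progSet Y N b1).filter (fun b => lam0 < nd H a b ∧ nd H a b < lam1) = B0 \ B1 := by
    ext b
    simp only [hB0, hB1, Finset.mem_sdiff, Finset.mem_filter, ← not_le]
    tauto
  have hYb : ∀ b : ℤ, |(b:ℝ) / Y| = |(b:ℝ)| / Y := fun b => by rw [abs_div, abs_of_pos hY]
  have k0 : |(B0.card : ℝ) - 2 * (Y * vfun lam0 (a / X)) / N| ≤ 4 := by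
    apply aux_between _ (mul_nonneg hY.le (vfun_nonneg _ _)) N hN b1
    · intro b hb
      rw [hB0, Finset.mem_filter, mem_progSet, lt_nd_iff X Y H lam0 hXH hYH] at hb
      refine ⟨?_, hb.1.2⟩
      by_contra! hc
      have := vfun_high lam0 (a / X) (b / Y) (by rw [hYb, div_le_one hY]; exact hb.1.1)
        (by rw [hYb, lt_div_iff₀ hY]; linarith)
      linarith [hb.2]
    · intro b hb hb2
      have h3 : |(b:ℝ)| ≤ Y := by nlinarith [vfun_le_one lam0 (a / X)]
      rw [hB0, Finset.mem_filter, mem_progSet, lt_nd_iff X Y H lam0 hXH hYH]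
      refine ⟨⟨h3, hb2⟩, vfun_low _ _ _ ?_⟩
      rw [hYb, div_lt_iff₀ hY]; linarith
  have k1 : |(B1.card : ℝ) - 2 * (Y * vfun lam1 (a / X)) / N| ≤ 4 := by
    apply aux_between _ (mul_nonneg hY.le (vfun_nonneg _ _)) N hN b1
    · intro b hb
      rw [hB1, Finset.mem_filter, mem_progSet, ← not_lt (a := nd H a b), nd_lt_iff X Y H lam1 hXH hYH] at hb
      refine ⟨?_, hb.1.2⟩
      by_contra! hc
      exact hb.2 (vfun_high lam1 (a / X) (b / Y) (by rw [hYb, div_le_one hY]; exact hb.1.1)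
        (by rw [hYb, lt_div_iff₀ hY]; linarith))
    · intro b hb hb2
      have h3 : |(b:ℝ)| ≤ Y := by nlinarith [vfun_le_one lam1 (a / X)]
      rw [hB1, Finset.mem_filter, mem_progSet, ← not_lt (a := nd H a b), nd_lt_iff X Y H lam1 hXH hYH]
      refine ⟨⟨h3, hb2⟩, ?_⟩
      have := vfun_low lam1 (a / X) (b / Y) (by rw [hYb, div_lt_iff₀ hY]; linarith)
      linarith
  have hc : ((B0 \ B1).card : ℝ) = B0.card - B1.card := by
    rw [Finset.card_sdiff_of_subset hsub, Nat.cast_sub (Finset.card_le_card hsub)]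
  rw [hT, hc]
  have : (B0.card : ℝ) - B1.card - 2 * (Y * vfun lam0 (a / X) - Y * vfun lam1 (a / X)) / N
    = ((B0.card : ℝ) - 2 * (Y * vfun lam0 (a / X)) / N)
      - ((B1.card : ℝ) - 2 * (Y * vfun lam1 (a / X)) / N) := by ring
  rw [this]
  exact (abs_sub _ _).trans (by linarith)

open Classical in
lemma lattice_count (X Y H lam0 lam1 : ℝ) (hX : 0 < X) (hY : 0 < Y) (hXH : X ^ 3 = H)
    (hYH : Y ^ 2 = H) (hlam : lam0 < lam1) (M N : ℕ) (hM : 0 < M) (hN : 0 < N) (a1 b1 : ℤ)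
    (T : Finset (ℤ × ℤ))
    (hT : ∀ ab : ℤ × ℤ, ab ∈ T ↔ (|(ab.1 : ℝ)| ≤ X ∧ ab.1 ≡ a1 [ZMOD M]) ∧
      (|(ab.2 : ℝ)| ≤ Y ∧ ab.2 ≡ b1 [ZMOD N]) ∧ lam0 < nd H ab.1 ab.2 ∧ nd H ab.1 ab.2 < lam1) :
    |(T.card : ℝ) - 4 * X * Y * (FDelta lam1 - FDelta lam0) / (M * N)|
      ≤ 16 * (X / M + 1 + Y / N) := by
  have hM' : (0:ℝ) < M := by exact_mod_cast hM
  have hN' : (0:ℝ) < N := by exact_mod_cast hN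
  have hcard : (T.card : ℝ) = ∑ a ∈ progSet X M a1,
      ((((progSet Y N b1).filter (fun b => lam0 < nd H a b ∧ nd H a b < lam1)).card : ℕ) : ℝ) := by
    rw [Finset.card_eq_sum_card_fiberwise (f := Prod.fst) (t := progSet X M a1)]
    · push_cast
      refine Finset.sum_congr rfl (fun a ha => ?_)
      congr 1
      refine Finset.card_bij (fun ab _ => ab.2) ?_ ?_ ?_
      · intro ab hab
        rw [Finset.mem_filter, hT] at hab
        rw [Finset.mem_filter, mem_progSet]
        rw [← hab.2]
        exact hab.1.2
      · rintro ⟨a', b⟩ h1 ⟨a'', b'⟩ h2 h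
        rw [Finset.mem_filter] at h1 h2
        simp only at h1 h2 h
        rw [h1.2, h2.2, h]
      · intro b hb
        rw [Finset.mem_filter, mem_progSet] at hb
        rw [mem_progSet] at ha
        refine ⟨(a, b), ?_, rfl⟩
        rw [Finset.mem_filter, hT]
        exact ⟨⟨ha, hb⟩, rfl⟩
    · intro ab hab
      rw [Finset.mem_coe, hT] at hab
      rw [Finset.mem_coe, mem_progSet]
      exact hab.1
  have anti : ∀ lam, Antitone (fun x => Y * vfun lam (x / X)) := by
    intro lam x y hxy
    have : vfun lam (y / X) ≤ vfun lam (x / X) := vfun_antitone lam (by gcongr)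
    exact mul_le_mul_of_nonneg_left this hY.le
  have r : ∀ lam, |∑ a ∈ progSet X M a1, Y * vfun lam ((a:ℝ) / X)
      - 2 * X * Y * (1 - FDelta lam) / M| ≤ 2 * Y := by
    intro lam
    rw [← integral_scaled lam X Y hX]
    exact aux_prog_sum (fun x => Y * vfun lam (x / X)) Y (anti lam)
      (fun x => mul_nonneg hY.le (vfun_nonneg _ _))
      (fun x => by nlinarith [vfun_le_one lam (x / X)]) X hX.le M hM a1 _ (mem_progSet X M a1)
  have c := aux_prog_card X hX.le M hM a1 _ (mem_progSet X M a1)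
  have s : |(T.card : ℝ) - ∑ a ∈ progSet X M a1,
      2 * (Y * vfun lam0 (a / X) - Y * vfun lam1 (a / X)) / N| ≤ (progSet X M a1).card * 8 := by
    rw [hcard, ← Finset.sum_sub_distrib]
    refine (Finset.abs_sum_le_sum_abs _ _).trans ?_
    refine (Finset.sum_le_card_nsmul _ _ 8 (fun a _ =>
      slice_count X Y H lam0 lam1 hY hXH hYH hlam N hN a b1)).trans ?_
    simp
  have e : ∑ a ∈ progSet X M a1, 2 * (Y * vfun lam0 (a / X) - Y * vfun lam1 (a / X)) / N
      = 2 / N * (∑ a ∈ progSet X M a1, Y * vfun lam0 ((a:ℝ) / X)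
        - ∑ a ∈ progSet X M a1, Y * vfun lam1 ((a:ℝ) / X)) := by
    rw [← Finset.sum_sub_distrib, Finset.mul_sum]
    refine Finset.sum_congr rfl (fun a _ => by ring)
  rw [e] at s
  have r0 := r lam0
  have r1 := r lam1
  set S0 := ∑ a ∈ progSet X M a1, Y * vfun lam0 ((a:ℝ) / X)
  set S1 := ∑ a ∈ progSet X M a1, Y * vfun lam1 ((a:ℝ) / X)
  have d : |2 / N * (S0 - S1) - 4 * X * Y * (FDelta lam1 - FDelta lam0) / (M * N)| ≤ 8 * Y / N := by
    have : 2 / N * (S0 - S1) - 4 * X * Y * (FDelta lam1 - FDelta lam0) / (M * N)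
      = 2 / N * ((S0 - 2 * X * Y * (1 - FDelta lam0) / M)
          - (S1 - 2 * X * Y * (1 - FDelta lam1) / M)) := by
      field_simp; ring
    rw [this, abs_mul, abs_of_pos (by positivity)]
    calc _ ≤ 2 / (N:ℝ) * (4 * Y) := by
          gcongr
          exact (abs_sub _ _).trans (by linarith)
      _ = _ := by ring
  have c' := (abs_le.1 c).2
  have t := abs_sub_le (T.card : ℝ) (2 / N * (S0 - S1))
    (4 * X * Y * (FDelta lam1 - FDelta lam0) / (M * N))
  have y0 : 0 ≤ Y / N := by positivity
  have e8 : 8 * Y / N = 8 * (Y / N) := by ring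
  have e2 : 2 * X / M = 2 * (X / M) := by ring
  linarith
open ArithmeticFunction in
lemma zeta_aux (Q : ℕ) (hQ : 0 < Q) :
    HasSum (fun d : ℕ => (if d.Coprime Q then ((moebius d : ℤ) : ℝ) else 0) / (d : ℝ) ^ 10)
      (1 / zetaRemoved Q 10) := by
  have : NeZero Q := ⟨hQ.ne'⟩
  have hs : 1 < (10 : ℂ).re := by norm_num
  set χ : DirichletCharacter ℂ Q := 1
  have h1 := DirichletCharacter.LSeries.mul_mu_eq_one χ hs
  have h2 : LSeries (fun n => χ n) 10 = (zetaRemoved Q 10 : ℂ) := by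
    rw [← DirichletCharacter.LFunction_eq_LSeries χ hs]
    have := DirichletCharacter.LFunctionTrivChar_eq_mul_riemannZeta (N := Q) (s := 10) (by norm_num)
    rw [DirichletCharacter.LFunctionTrivChar] at this
    rw [this, zetaRemoved, zeta_eq_tsum_one_div_nat_add_one_cpow hs]
    rw [mul_comm]
    push_cast
    congr 1
    · congr 1
      ext n
      have := Complex.ofReal_cpow (x := (n:ℝ) + 1) (by positivity) 10
      push_cast at this
      rw [this]
    · refine Finset.prod_congr rfl (fun p _ => ?_)
      have := Complex.ofReal_cpow (x := (p:ℝ)) (by positivity) (-10)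
      push_cast at this
      rw [this]
  rw [h2] at h1
  have hsum : LSeriesSummable ((fun n : ℕ => χ n) * fun n : ℕ => ((moebius n : ℤ) : ℂ)) 10 :=
    DirichletCharacter.LSeriesSummable_mul χ (ArithmeticFunction.LSeriesSummable_moebius_iff.2 hs)
  have h3 := hsum.hasSum
  change HasSum _ (LSeries _ 10) at h3
  rw [eq_one_div_of_mul_eq_one_right h1] at h3
  rw [← Complex.hasSum_ofReal]
  push_cast
  convert h3 using 2 with d
  rw [LSeries.term_def]
  split_ifs with hd hd0 hd0
  · simp [hd0]
  · have : (χ (d : ZMod Q)) = 1 := MulChar.one_apply ((ZMod.isUnit_iff_coprime d Q).2 hd)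
    simp only [Pi.mul_apply, this, one_mul]
    norm_cast
  · simp
  · have : (χ (d : ZMod Q)) = 0 :=
      MulChar.map_nonunit _ (fun h => hd ((ZMod.isUnit_iff_coprime d Q).1 h))
    simp [this]

open ArithmeticFunction in
open Classical in
lemma moebius_indicator (a b : ℤ) (ha : a ≠ 0) (K : ℕ) (hK : a.natAbs ≤ K) :
    (∑ d ∈ (Finset.Icc 1 K).filter (fun d : ℕ => (d : ℤ) ^ 4 ∣ a ∧ (d : ℤ) ^ 6 ∣ b),
      (moebius d : ℤ)) =
      if (∀ p : ℕ, p.Prime → (p : ℤ) ^ 4 ∣ a → ¬ ((p : ℤ) ^ 6 ∣ b)) then 1 else 0 := by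
  set P : ℕ → Prop := fun d => (d : ℤ) ^ 4 ∣ a ∧ (d : ℤ) ^ 6 ∣ b with hP
  have hP' : ∀ d, P d ↔ d ^ 4 ∣ a.natAbs ∧ d ^ 6 ∣ b.natAbs := by
    intro d
    simp only [hP]
    rw [← Int.natCast_dvd, ← Int.natCast_dvd]
    push_cast; rfl
  have ha' : a.natAbs ≠ 0 := by simpa using ha
  have hle : ∀ d, P d → d ≤ K := by
    intro d hd
    have := Nat.le_of_dvd (Nat.pos_of_ne_zero ha') ((hP' d).1 hd).1
    exact (Nat.le_self_pow (by norm_num) d).trans (this.trans hK)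
  have hpos : ∀ d, P d → 1 ≤ d := by
    intro d hd
    rcases Nat.eq_zero_or_pos d with h | h
    · exfalso
      have := ((hP' d).1 hd).1
      rw [h] at this
      exact ha' (by simpa using this)
    · exact h
  have hlcm : ∀ d e, P d → P e → P (d.lcm e) := by
    intro d e hd he
    rw [hP'] at *
    rw [← Nat.pow_lcm_pow, ← Nat.pow_lcm_pow]
    exact ⟨Nat.lcm_dvd hd.1 he.1, Nat.lcm_dvd hd.2 he.2⟩
  have hdvd : ∀ d e, d ∣ e → P e → P d := by
    intro d e hde he
    rw [hP'] at *
    exact ⟨(pow_dvd_pow_of_dvd hde 4).trans he.1, (pow_dvd_pow_of_dvd hde 6).trans he.2⟩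
  have hone : P 1 := by rw [hP']; simp
  have hg := Nat.findGreatest_spec (P := P) (hle 1 hone) hone
  set g := Nat.findGreatest P K with hgdef
  have hall : ∀ d, P d → d ∣ g := by
    intro d hd
    have h1 := hlcm d g hd hg
    have h2 : d.lcm g ≤ g := Nat.le_findGreatest (hle _ h1) h1
    have h3 : d.lcm g = g := le_antisymm h2 (Nat.le_of_dvd (hpos _ h1) (Nat.dvd_lcm_right d g))
    rw [← h3]; exact Nat.dvd_lcm_left d g
  have hset : (Finset.Icc 1 K).filter P = g.divisors := by
    ext d
    rw [Finset.mem_filter, Nat.mem_divisors, Finset.mem_Icc]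
    constructor
    · rintro ⟨_, hd⟩
      exact ⟨hall d hd, Nat.pos_iff_ne_zero.1 (hpos g hg)⟩
    · rintro ⟨hd, _⟩
      have := hdvd d g hd hg
      exact ⟨⟨hpos d this, hle d this⟩, this⟩
  rw [hset, ← coe_mul_zeta_apply, moebius_mul_coe_zeta, one_apply]
  congr 1
  rw [eq_iff_iff]
  constructor
  · intro h p hp h4 h6
    have := hall p ⟨h4, h6⟩
    rw [h] at this
    exact hp.one_lt.ne' (Nat.dvd_one.1 this)
  · intro h
    by_contra hne
    obtain ⟨p, hp, hpg⟩ := Nat.exists_prime_and_dvd hne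
    have := hdvd p g hpg hg
    exact h p hp this.1 this.2
lemma crt_aux (Q e : ℕ) (h : e.Coprime Q) (a0 : ℤ) :
    ∃ a1 : ℤ, ∀ a : ℤ, a ≡ a1 [ZMOD ((Q * e : ℕ) : ℤ)] ↔ (a ≡ a0 [ZMOD Q] ∧ (e : ℤ) ∣ a) := by
  obtain ⟨v, u, huv⟩ := Nat.isCoprime_iff_coprime.2 h
  refine ⟨a0 * (v * e), fun a => ?_⟩
  have h1 : a0 * (v * e) ≡ a0 [ZMOD Q] := by
    apply Int.modEq_iff_dvd.2
    exact ⟨a0 * u, by linear_combination (-a0) * huv⟩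
  have h2 : a0 * (v * e) ≡ 0 [ZMOD e] := by
    apply Int.modEq_iff_dvd.2
    exact ⟨-a0 * v, by ring⟩
  push_cast
  rw [← Int.modEq_and_modEq_iff_modEq_mul (by simpa using h.symm), ← Int.modEq_zero_iff_dvd]
  constructor
  · rintro ⟨x, y⟩; exact ⟨x.trans h1, y.trans h2⟩
  · rintro ⟨x, y⟩; exact ⟨x.trans h1.symm, y.trans h2.symm⟩

set_option maxHeartbeats 1000000 in
open ArithmeticFunction in
open Classical in
lemma class_count (X Y H lam0 lam1 : ℝ) (hX : 0 < X) (hY : 0 < Y) (hXH : X ^ 3 = H)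
    (hYH : Y ^ 2 = H) (hlam : lam0 < lam1) (Q : ℕ) (hQ : 0 < Q) (a0 b0 : ℤ)
    (hne : ∀ a : ℤ, a ≡ a0 [ZMOD Q] → a ≠ 0)
    (hcop : ∀ (d : ℕ) (a b : ℤ), a ≡ a0 [ZMOD Q] → b ≡ b0 [ZMOD Q] → (d : ℤ) ^ 4 ∣ a →
      (d : ℤ) ^ 6 ∣ b → d.Coprime Q)
    (G : Finset (ℤ × ℤ))
    (hG : ∀ ab : ℤ × ℤ, ab ∈ G ↔ ((|(ab.1 : ℝ)| ≤ X ∧ ab.1 ≡ a0 [ZMOD Q]) ∧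
      (|(ab.2 : ℝ)| ≤ Y ∧ ab.2 ≡ b0 [ZMOD Q]) ∧ lam0 < nd H ab.1 ab.2 ∧ nd H ab.1 ab.2 < lam1) ∧
      ∀ p : ℕ, p.Prime → (p : ℤ) ^ 4 ∣ ab.1 → ¬ ((p : ℤ) ^ 6 ∣ ab.2)) :
    |(G.card : ℝ) - 4 * X * Y * (FDelta lam1 - FDelta lam0) / (Q : ℝ) ^ 2 * (1 / zetaRemoved Q 10)|
      ≤ (8 + 48 * ∑' d : ℕ, 1 / (d : ℝ) ^ 2) * (Y / Q + 1) := by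
  have hQ' : (0:ℝ) < Q := by exact_mod_cast hQ
  have hQ1 : (1:ℝ) ≤ Q := by exact_mod_cast hQ
  set Z := ∑' d : ℕ, 1 / (d : ℝ) ^ 2 with hZ
  have hZsum : HasSum (fun d : ℕ => 1 / (d : ℝ) ^ 2) Z :=
    (Real.summable_one_div_nat_pow.2 (by norm_num)).hasSum
  have hZ0 : 0 ≤ Z := tsum_nonneg (fun d => by positivity)
  have hz := zeta_aux Q hQ
  set mQ : ℕ → ℝ := fun d => if d.Coprime Q then ((moebius d : ℤ) : ℝ) else 0 with hmQ
  have hmQ1 : ∀ d, |mQ d| ≤ 1 := by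
    intro d
    simp only [hmQ]
    split_ifs
    · exact_mod_cast abs_moebius_le_one
    · simp
  have hF : |FDelta lam1 - FDelta lam0| ≤ 1 := by
    have h0 := FDelta_mem lam0
    have h1 := FDelta_mem lam1
    rw [abs_le]; constructor <;> linarith
  have hyQ : 0 < Y / Q := by positivity
  have hV : |4 * X * Y * (FDelta lam1 - FDelta lam0) / (Q : ℝ) ^ 2| ≤ 4 * (X / Q) * (Y / Q) := by
    rw [abs_div, abs_mul, abs_of_pos (show 0 < 4 * X * Y by positivity),
      abs_of_pos (show 0 < (Q:ℝ) ^ 2 by positivity)]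
    calc 4 * X * Y * |FDelta lam1 - FDelta lam0| / (Q : ℝ) ^ 2 ≤ 4 * X * Y * 1 / (Q : ℝ) ^ 2 := by
          gcongr
      _ = _ := by field_simp
  set V := 4 * X * Y * (FDelta lam1 - FDelta lam0) / (Q : ℝ) ^ 2 with hVdef
  rcases lt_or_ge X Q with hXQ | hXQ
  · -- trivial bound
    have hzZ : |1 / zetaRemoved Q 10| ≤ Z := by
      refine hz.norm_le_of_bounded hZsum (fun d => ?_)
      rw [norm_div, Real.norm_eq_abs, Real.norm_eq_abs, abs_of_nonneg (a := (d:ℝ) ^ 10)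
        (by positivity)]
      rcases Nat.eq_zero_or_pos d with h | h
      · simp [h]
      · have : (1:ℝ) ≤ d := by exact_mod_cast h
        exact div_le_div₀ zero_le_one (hmQ1 d) (by positivity)
          (pow_le_pow_right₀ this (by norm_num))
    have hsub : G ⊆ progSet X Q a0 ×ˢ progSet Y Q b0 := by
      intro ab hab
      rw [hG] at hab
      rw [Finset.mem_product, mem_progSet, mem_progSet]
      exact ⟨hab.1.1, hab.1.2.1⟩
    have hc := Finset.card_le_card hsub
    rw [Finset.card_product] at hc
    have hc' : (G.card : ℝ) ≤ (progSet X Q a0).card * (progSet Y Q b0).card := by exact_mod_cast hc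
    have c1 := (abs_le.1 (aux_prog_card X hX.le Q hQ a0 _ (mem_progSet X Q a0))).2
    have c2 := (abs_le.1 (aux_prog_card Y hY.le Q hQ b0 _ (mem_progSet Y Q b0))).2
    have hXQ1 : X / Q ≤ 1 := (div_le_one hQ').2 hXQ.le
    rw [mul_div_assoc] at c1 c2
    have c3 : (G.card : ℝ) ≤ 4 * (2 * (Y / Q) + 2) := by
      refine hc'.trans ?_
      gcongr <;> linarith
    have c4 : |V * (1 / zetaRemoved Q 10)| ≤ 4 * (Y / Q) * Z := by
      rw [abs_mul]
      gcongr
      refine hV.trans ?_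
      nlinarith
    have t := abs_sub (G.card : ℝ) (V * (1 / zetaRemoved Q 10))
    rw [abs_of_nonneg (a := (G.card : ℝ)) (by positivity)] at t
    have : 0 ≤ Z * (Y / Q) := by positivity
    nlinarith
  · have hX1 : 1 ≤ X := hQ1.trans hXQ
    have hXY : X ≤ Y := by
      by_contra! hc
      have : Y ^ 2 < X ^ 2 := by gcongr
      have : X ^ 2 ≤ X ^ 3 := pow_le_pow_right₀ hX1 (by norm_num)
      linarith
    set R := (progSet X Q a0 ×ˢ progSet Y Q b0).filter
      (fun ab => lam0 < nd H ab.1 ab.2 ∧ nd H ab.1 ab.2 < lam1) with hR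
    have hRm : ∀ ab : ℤ × ℤ, ab ∈ R ↔ ((|(ab.1 : ℝ)| ≤ X ∧ ab.1 ≡ a0 [ZMOD Q]) ∧
      (|(ab.2 : ℝ)| ≤ Y ∧ ab.2 ≡ b0 [ZMOD Q]) ∧
        lam0 < nd H ab.1 ab.2 ∧ nd H ab.1 ab.2 < lam1) := by
      intro ab
      rw [hR, Finset.mem_filter, Finset.mem_product, mem_progSet, mem_progSet, and_assoc]
    set A : ℕ → Finset (ℤ × ℤ) := fun d =>
      R.filter (fun ab => (d : ℤ) ^ 4 ∣ ab.1 ∧ (d : ℤ) ^ 6 ∣ ab.2) with hA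
    have hA0 : ∀ d : ℕ, X < (d:ℝ) ^ 4 → (A d).card = 0 := by
      intro d hd
      rw [Finset.card_eq_zero, Finset.eq_empty_iff_forall_notMem]
      intro ab hab
      rw [hA, Finset.mem_filter, hRm] at hab
      obtain ⟨⟨⟨h1, h2⟩, -⟩, h3, -⟩ := hab
      have h5 := Int.le_of_dvd (abs_pos.2 (hne _ h2)) ((dvd_abs _ _).2 h3)
      have h6 : (d:ℝ) ^ 4 ≤ |(ab.1 : ℝ)| := by exact_mod_cast h5
      linarith
    have hAc : ∀ d : ℕ, ¬ d.Coprime Q → (A d).card = 0 := by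
      intro d hd
      rw [Finset.card_eq_zero, Finset.eq_empty_iff_forall_notMem]
      intro ab hab
      rw [hA, Finset.mem_filter, hRm] at hab
      exact hd (hcop d _ _ hab.1.1.2 hab.1.2.1.2 hab.2.1 hab.2.2)
    have hGsum : (G.card : ℝ) = ∑ d ∈ Finset.Icc 1 ⌊X⌋₊, mQ d * (A d).card := by
      have hG' : G = R.filter (fun ab =>
          ∀ p : ℕ, p.Prime → (p : ℤ) ^ 4 ∣ ab.1 → ¬ ((p : ℤ) ^ 6 ∣ ab.2)) := by
        ext ab
        rw [hG, Finset.mem_filter, hRm]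
      have h1 : (G.card : ℤ) = ∑ d ∈ Finset.Icc 1 ⌊X⌋₊, (moebius d : ℤ) * (A d).card := by
        rw [hG', Finset.card_filter]
        push_cast
        have h2 : ∀ ab ∈ R, (if (∀ p : ℕ, p.Prime → (p : ℤ) ^ 4 ∣ ab.1 → ¬ ((p : ℤ) ^ 6 ∣ ab.2))
            then (1:ℤ) else 0) = ∑ d ∈ (Finset.Icc 1 ⌊X⌋₊).filter
              (fun d : ℕ => (d : ℤ) ^ 4 ∣ ab.1 ∧ (d : ℤ) ^ 6 ∣ ab.2), (moebius d : ℤ) := by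
          intro ab hab
          rw [hRm] at hab
          rw [moebius_indicator ab.1 ab.2 (hne _ hab.1.2)]
          apply Nat.le_floor
          rw [Nat.cast_natAbs]
          push_cast
          exact hab.1.1
        rw [Finset.sum_congr rfl h2]
        rw [Finset.sum_comm' (t' := Finset.Icc 1 ⌊X⌋₊) (s' := A)]
        · refine Finset.sum_congr rfl (fun d _ => ?_)
          rw [Finset.sum_const, nsmul_eq_mul, mul_comm]
        · intro ab d
          simp only [hA]
          rw [Finset.mem_filter (s := Finset.Icc 1 ⌊X⌋₊), Finset.mem_filter (s := R)]
          tauto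
      have h1' : (G.card : ℝ) = ∑ d ∈ Finset.Icc 1 ⌊X⌋₊, ((moebius d : ℤ) : ℝ) * (A d).card := by
        exact_mod_cast h1
      rw [h1']
      refine Finset.sum_congr rfl (fun d _ => ?_)
      simp only [hmQ]
      split_ifs with h
      · rfl
      · rw [hAc d h]; simp
    have hsA : HasSum (fun d => mQ d * (A d).card) (G.card : ℝ) := by
      rw [hGsum]
      apply hasSum_sum_of_ne_finset_zero
      intro d hd
      rw [Finset.mem_Icc, not_and_or] at hd
      rcases hd with hd | hd
      · have : d = 0 := by omega
        subst this
        simp [hmQ]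
      · rw [hA0 d]
        · simp
        · have h1 : X < d := (Nat.floor_lt hX.le).1 (by omega)
          have h2 : (1:ℝ) ≤ d := by linarith
          calc X < d := h1
            _ ≤ (d:ℝ) ^ 4 := le_self_pow₀ h2 (by norm_num)
    have hdiff := hsA.sub (hz.mul_left V)
    have hbd : ∀ d : ℕ, ‖mQ d * (A d).card - V * (mQ d / (d:ℝ) ^ 10)‖
        ≤ 48 * (Y / Q) * (1 / (d:ℝ) ^ 2) := by
      intro d
      rcases Nat.eq_zero_or_pos d with h0 | h0
      · subst h0
        simp [hmQ]
      by_cases hd : d.Coprime Q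
      swap
      · have : mQ d = 0 := by simp only [hmQ, if_neg hd]
        rw [this]
        simp only [zero_mul, zero_div, mul_zero, sub_zero, norm_zero]
        positivity
      have hd1 : (1:ℝ) ≤ d := by exact_mod_cast h0
      have hd0 : (0:ℝ) < d := by linarith
      have e : mQ d * (A d).card - V * (mQ d / (d:ℝ) ^ 10)
        = mQ d * ((A d).card - V / (d:ℝ) ^ 10) := by ring
      rw [e, norm_mul, Real.norm_eq_abs, Real.norm_eq_abs]
      have key : |((A d).card : ℝ) - V / (d:ℝ) ^ 10| ≤ 48 * (Y / Q) * (1 / (d:ℝ) ^ 2) := by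
        rcases lt_or_ge X ((d:ℝ) ^ 4) with hdX | hdX
        · rw [hA0 d hdX, Nat.cast_zero, zero_sub, abs_neg, abs_div,
            abs_of_pos (show (0:ℝ) < (d:ℝ) ^ 10 by positivity), div_le_iff₀ (by positivity)]
          refine hV.trans ?_
          have h8 : 1 / (d:ℝ) ^ 2 * (d:ℝ) ^ 10 = (d:ℝ) ^ 8 := by field_simp
          rw [mul_assoc (48 * (Y / Q)), h8]
          have h48 : (d:ℝ) ^ 4 ≤ (d:ℝ) ^ 8 := pow_le_pow_right₀ hd1 (by norm_num)
          have hxq : X / Q ≤ X := div_le_self hX.le hQ1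
          have hx8 : X / Q ≤ (d:ℝ) ^ 8 := by linarith
          calc 4 * (X / Q) * (Y / Q) ≤ 4 * (d:ℝ) ^ 8 * (Y / Q) := by gcongr
            _ ≤ 48 * (d:ℝ) ^ 8 * (Y / Q) := by gcongr; norm_num
            _ = 48 * (Y / Q) * (d:ℝ) ^ 8 := by ring
        · obtain ⟨a1, ha1⟩ := crt_aux Q (d ^ 4) (hd.pow_left 4) a0
          obtain ⟨b1, hb1⟩ := crt_aux Q (d ^ 6) (hd.pow_left 6) b0
          have L := lattice_count X Y H lam0 lam1 hX hY hXH hYH hlam (Q * d ^ 4) (Q * d ^ 6)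
            (by positivity) (by positivity) a1 b1 (A d) (by
              intro ab
              rw [ha1, hb1, hA, Finset.mem_filter, hRm]
              push_cast
              tauto)
          have e1 : 4 * X * Y * (FDelta lam1 - FDelta lam0) /
              (((Q * d ^ 4 : ℕ) : ℝ) * ((Q * d ^ 6 : ℕ) : ℝ)) = V / (d:ℝ) ^ 10 := by
            rw [hVdef]; push_cast; field_simp
          rw [e1] at L
          refine L.trans ?_
          push_cast
          have g1 : X / (Q * (d:ℝ) ^ 4) ≤ Y / Q * (1 / (d:ℝ) ^ 2) := by
            rw [div_mul_div_comm, mul_one]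
            have : (d:ℝ) ^ 2 ≤ (d:ℝ) ^ 4 := pow_le_pow_right₀ hd1 (by norm_num)
            gcongr
          have g2 : Y / (Q * (d:ℝ) ^ 6) ≤ Y / Q * (1 / (d:ℝ) ^ 2) := by
            rw [div_mul_div_comm, mul_one]
            have : (d:ℝ) ^ 2 ≤ (d:ℝ) ^ 6 := pow_le_pow_right₀ hd1 (by norm_num)
            gcongr
          have g3 : 1 ≤ Y / Q * (1 / (d:ℝ) ^ 2) := by
            have w1 : Y / X ≤ Y / Q := by gcongr
            have w2 : (Y / X) ^ 2 = X := by
              rw [div_pow, hYH, ← hXH]; field_simp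
            have w3 : (d:ℝ) ^ 2 ≤ Y / X := by
              apply le_of_sq_le_sq _ (by positivity)
              rw [w2, ← pow_mul]; exact hdX
            rw [mul_one_div, le_div_iff₀ (by positivity)]
            linarith
          linarith
      calc |mQ d| * _ ≤ 1 * _ := by gcongr; exact hmQ1 d
        _ ≤ _ := by rw [one_mul]; exact key
    have fin := hdiff.norm_le_of_bounded (hZsum.mul_left (48 * (Y / Q))) hbd
    rw [Real.norm_eq_abs] at fin
    refine fin.trans ?_
    have : 0 ≤ Z * (Y / Q) := by positivity
    nlinarith
theorem stmt1 :
    ∃ C : ℝ, 0 < C ∧ ∀ (r t : ℤ), ¬(3 ∣ r) → ¬(2 ∣ t) →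
      ∀ (H : ℝ), 0 < H → ∀ (lam0 lam1 : ℝ), lam0 < lam1 →
      ∀ (Q : ℕ), 0 < Q → ∀ (h6 : (6 : ℕ) ∣ Q),
      ∀ (S : Finset (ZMod Q × ZMod Q)),
      (∀ ab ∈ S, ZMod.castHom h6 (ZMod 6) ab.1 = (r : ZMod 6) ∧
                 ZMod.castHom h6 (ZMod 6) ab.2 = (t : ZMod 6)) →
      (∀ ab ∈ S, ¬ ∃ d : ℤ, 1 < Int.gcd d (Q : ℤ) ∧
          Int.gcd (d^4) (Q : ℤ) ∣ Nat.gcd (ZMod.val ab.1) Q ∧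
          Int.gcd (d^6) (Q : ℤ) ∣ Nat.gcd (ZMod.val ab.2) Q) →
      |(Nat.card {ab : ℤ × ℤ | ab ∈ Family r t H ∧
            ((ab.1 : ZMod Q), (ab.2 : ZMod Q)) ∈ S ∧
            lam0 < -16 * (4 * (ab.1 : ℝ)^3 + 27 * (ab.2 : ℝ)^2) / H ∧
            -16 * (4 * (ab.1 : ℝ)^3 + 27 * (ab.2 : ℝ)^2) / H < lam1} : ℝ)
          - 4 * H ^ ((5:ℝ)/6) / zetaRemoved Q 10 * ((S.card : ℝ) / (Q : ℝ)^2) *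
              (FDelta lam1 - FDelta lam0)|
        ≤ C * (H ^ ((1:ℝ)/2) * (S.card : ℝ) / (Q : ℝ) + (S.card : ℝ)) := by
  classical
  refine ⟨8 + 48 * ∑' d : ℕ, 1 / (d : ℝ) ^ 2, ?_, ?_⟩
  · have : 0 ≤ ∑' d : ℕ, 1 / (d : ℝ) ^ 2 := tsum_nonneg (fun d => by positivity)
    linarith
  intro r t hr _ H hH lam0 lam1 hlam Q hQ h6 S hS1 hS2
  have : NeZero Q := ⟨hQ.ne'⟩
  set X := H ^ ((1:ℝ)/3) with hXdef
  set Y := H ^ ((1:ℝ)/2) with hYdef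
  have hX : 0 < X := Real.rpow_pos_of_pos hH _
  have hY : 0 < Y := Real.rpow_pos_of_pos hH _
  have hXH : X ^ 3 = H := by
    rw [hXdef, ← Real.rpow_natCast, ← Real.rpow_mul hH.le]; norm_num
  have hYH : Y ^ 2 = H := by
    rw [hYdef, ← Real.rpow_natCast, ← Real.rpow_mul hH.le]; norm_num
  have hXY : H ^ ((5:ℝ)/6) = X * Y := by
    rw [hXdef, hYdef, ← Real.rpow_add hH]; norm_num
  have hmod : ∀ (a : ℤ) (x : ZMod Q), (a : ZMod Q) = x ↔ a ≡ ((x.val : ℕ) : ℤ) [ZMOD Q] := by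
    intro a x
    rw [← ZMod.intCast_eq_intCast_iff]
    simp
  set E : Set (ℤ × ℤ) := {ab : ℤ × ℤ | ab ∈ Family r t H ∧
            ((ab.1 : ZMod Q), (ab.2 : ZMod Q)) ∈ S ∧
            lam0 < -16 * (4 * (ab.1 : ℝ)^3 + 27 * (ab.2 : ℝ)^2) / H ∧
            -16 * (4 * (ab.1 : ℝ)^3 + 27 * (ab.2 : ℝ)^2) / H < lam1} with hE
  set Tot : Finset (ℤ × ℤ) := (progSet X 1 0 ×ˢ progSet Y 1 0).filter (fun ab => ab ∈ E) with hTot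
  have hTotE : E = (Tot : Set (ℤ × ℤ)) := by
    ext ab
    rw [hTot, Finset.mem_coe, Finset.mem_filter, Finset.mem_product, mem_progSet, mem_progSet]
    constructor
    · intro h
      have h1 := h.1.2.2.1
      have h2 := h.1.2.2.2.1
      refine ⟨⟨⟨?_, ?_⟩, ?_, ?_⟩, h⟩
      · exact h1
      · simpa using Int.modEq_one
      · exact h2
      · simpa using Int.modEq_one
    · exact fun h => h.2
  have hcard : (Nat.card E : ℝ) = ∑ s ∈ S,
      ((Tot.filter (fun ab => ((ab.1 : ZMod Q), (ab.2 : ZMod Q)) = s)).card : ℝ) := by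
    rw [hTotE, Nat.card_coe_set_eq, Set.ncard_coe_finset]
    rw [Finset.card_eq_sum_card_fiberwise (f := fun ab : ℤ × ℤ =>
      ((ab.1 : ZMod Q), (ab.2 : ZMod Q))) (t := S)]
    · push_cast; rfl
    · intro ab hab
      rw [← hTotE] at hab
      exact hab.2.1
  have main : ∀ s ∈ S,
      |((Tot.filter (fun ab => ((ab.1 : ZMod Q), (ab.2 : ZMod Q)) = s)).card : ℝ)
        - 4 * X * Y * (FDelta lam1 - FDelta lam0) / (Q : ℝ) ^ 2 * (1 / zetaRemoved Q 10)|
      ≤ (8 + 48 * ∑' d : ℕ, 1 / (d : ℝ) ^ 2) * (Y / Q + 1) := by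
    intro s hs
    have h6a : ∀ a : ℤ, (a : ZMod Q) = s.1 → a ≡ r [ZMOD 6] := by
      intro a ha
      have h := (hS1 s hs).1
      rw [← ha, map_intCast] at h
      exact (ZMod.intCast_eq_intCast_iff a r 6).1 h
    have h6b : ∀ a : ℤ, (a : ZMod Q) = s.2 → a ≡ t [ZMOD 6] := by
      intro a ha
      have h := (hS1 s hs).2
      rw [← ha, map_intCast] at h
      exact (ZMod.intCast_eq_intCast_iff a t 6).1 h
    have hdv : ∀ (e : ℕ) (a : ℤ) (x : ZMod Q), a ≡ ((x.val : ℕ) : ℤ) [ZMOD Q] → (e : ℤ) ∣ a →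
        Int.gcd (e : ℤ) (Q : ℤ) ∣ Nat.gcd x.val Q := by
      intro e a x hax hea
      rw [Int.gcd_natCast_natCast]
      refine Nat.dvd_gcd ?_ (Nat.gcd_dvd_right _ _)
      have k1 : ((Nat.gcd e Q : ℕ) : ℤ) ∣ a :=
        (Int.natCast_dvd_natCast.2 (Nat.gcd_dvd_left e Q)).trans hea
      have k2 : ((Nat.gcd e Q : ℕ) : ℤ) ∣ ((x.val : ℕ) : ℤ) - a :=
        (Int.natCast_dvd_natCast.2 (Nat.gcd_dvd_right e Q)).trans (Int.modEq_iff_dvd.1 hax)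
      have k3 := dvd_add k2 k1
      rw [sub_add_cancel] at k3
      exact Int.natCast_dvd_natCast.1 k3
    refine class_count X Y H lam0 lam1 hX hY hXH hYH hlam Q hQ ((s.1.val : ℕ) : ℤ)
      ((s.2.val : ℕ) : ℤ) ?_ ?_ _ ?_
    · intro a ha ha0
      have h := h6a a ((hmod a s.1).2 ha)
      rw [ha0] at h
      have := Int.modEq_iff_dvd.1 h
      apply hr
      omega
    · intro d a b ha hb hda hdb
      by_contra hd
      apply hS2 s hs
      refine ⟨d, ?_, ?_, ?_⟩
      · rw [Int.gcd_natCast_natCast]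
        have : 0 < Nat.gcd d Q := Nat.gcd_pos_of_pos_right _ hQ
        have : Nat.gcd d Q ≠ 1 := hd
        omega
      · exact_mod_cast hdv (d ^ 4) a s.1 ha (by exact_mod_cast hda)
      · exact_mod_cast hdv (d ^ 6) b s.2 hb (by exact_mod_cast hdb)
    · intro ab
      rw [Finset.mem_filter, ← Finset.mem_coe, ← hTotE, hE, ← hmod, ← hmod]
      simp only [Set.mem_ofPred_eq, Family, nd]
      constructor
      · rintro ⟨⟨⟨_, _, h1, h2, h3⟩, _, h4, h5⟩, h7⟩
        rw [Prod.ext_iff] at h7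
        exact ⟨⟨⟨h1, h7.1⟩, ⟨h2, h7.2⟩, h4, h5⟩, h3⟩
      · rintro ⟨⟨⟨h1, h7⟩, ⟨h2, h8⟩, h4, h5⟩, h3⟩
        have h9 : ((ab.1 : ZMod Q), (ab.2 : ZMod Q)) = s := Prod.ext h7 h8
        exact ⟨⟨⟨h6a _ h7, h6b _ h8, h1, h2, h3⟩, by rw [h9]; exact hs, h4, h5⟩, h9⟩
  have e1 : 4 * H ^ ((5:ℝ)/6) / zetaRemoved Q 10 * ((S.card : ℝ) / (Q : ℝ)^2) *
      (FDelta lam1 - FDelta lam0) = ∑ s ∈ S,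
        4 * X * Y * (FDelta lam1 - FDelta lam0) / (Q : ℝ) ^ 2 * (1 / zetaRemoved Q 10) := by
    rw [Finset.sum_const, nsmul_eq_mul, hXY]
    ring
  rw [e1, hcard, ← Finset.sum_sub_distrib]
  refine (Finset.abs_sum_le_sum_abs _ _).trans ((Finset.sum_le_card_nsmul _ _ _ main).trans ?_)
  rw [nsmul_eq_mul]
  apply le_of_eq
  ring
end

section
/- There is a constant C > 0 such that for all real H > 1, the cardinality of F(H) equals H^{5/6}/(9·ζ^{(6)}(10)) up to an error of absolute value at most C·H^{1/2}. -/
open ArithmeticFunction in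
/-- The Möbius function restricted to integers coprime to `6`. -/
noncomputable def gMu (d : ℕ) : ℝ := if Nat.Coprime d 6 then ((moebius d : ℤ) : ℝ) else 0

lemma abs_gMu_le (d : ℕ) : |gMu d| ≤ 1 := by
  unfold gMu
  split_ifs
  · exact_mod_cast ArithmeticFunction.abs_moebius_le_one
  · simp

lemma zetaRemoved_cast : ((zetaRemoved 6 10 : ℝ) : ℂ)
    = (∏ p ∈ (6:ℕ).primeFactors, (1 - (p : ℂ) ^ (-(10:ℂ)))) * riemannZeta 10 := by
  unfold zetaRemoved
  rw [zeta_eq_tsum_one_div_nat_add_one_cpow (by norm_num)]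
  push_cast
  rw [mul_comm]
  congr 1
  · refine Finset.prod_congr rfl fun p _ => ?_
    rw [Complex.ofReal_cpow (by positivity)]
    push_cast
    rfl
  · refine tsum_congr fun n => ?_
    rw [Complex.ofReal_cpow (by positivity)]
    push_cast
    rfl

open ArithmeticFunction in
lemma tsum_gMu_cast : (((∑' d : ℕ, gMu d / (d:ℝ) ^ 10 : ℝ)) : ℂ)
    = LSeries ((fun n : ℕ => (1 : DirichletCharacter ℂ 6) n) * (fun n : ℕ => ((moebius n : ℤ) : ℂ))) 10 := by
  rw [Complex.ofReal_tsum]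
  unfold LSeries
  refine tsum_congr fun n => ?_
  rcases eq_or_ne n 0 with rfl | hn
  · simp
  rw [LSeries.term_of_ne_zero hn]
  have h10 : ((n:ℂ) ^ (10:ℂ)) = (n:ℂ)^10 := by
    exact_mod_cast Complex.cpow_natCast (n:ℂ) 10
  rw [h10]
  unfold gMu
  by_cases h : Nat.Coprime n 6
  · have hu : IsUnit ((n : ℕ) : ZMod 6) := (ZMod.isUnit_iff_coprime n 6).2 h
    rw [if_pos h]
    simp [MulChar.one_apply hu]
  · have hu : ¬ IsUnit ((n : ℕ) : ZMod 6) := fun h' => h ((ZMod.isUnit_iff_coprime n 6).1 h')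
    rw [if_neg h]
    simp [MulChar.map_nonunit _ hu]

lemma tsum_gMu : (∑' d : ℕ, gMu d / (d:ℝ) ^ 10) = 1 / zetaRemoved 6 10 := by
  have h1 := DirichletCharacter.LSeries.mul_mu_eq_one (1 : DirichletCharacter ℂ 6) (s := 10) (by norm_num)
  rw [← DirichletCharacter.LFunction_eq_LSeries _ (by norm_num)] at h1
  have h2 := DirichletCharacter.LFunctionTrivChar_eq_mul_riemannZeta (N := 6) (s := 10) (by norm_num)
  unfold DirichletCharacter.LFunctionTrivChar at h2
  rw [h2, ← zetaRemoved_cast, ← tsum_gMu_cast] at h1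
  have h3 : zetaRemoved 6 10 * (∑' d : ℕ, gMu d / (d:ℝ) ^ 10) = 1 := by exact_mod_cast h1
  have h4 : zetaRemoved 6 10 ≠ 0 := by
    intro h; rw [h] at h3; simp at h3
  field_simp
  linarith

lemma count_ap (X : ℝ) (hX : 0 ≤ X) (m : ℕ) (hm : 0 < m) (c : ℤ) :
    |(((Finset.Icc (-⌊X⌋) ⌊X⌋).filter (fun a => a ≡ c [ZMOD m])).card : ℝ) - 2 * X / m| ≤ 2 := by
  have hI : Finset.Icc (-⌊X⌋) ⌊X⌋ = Finset.Ioc (-⌊X⌋ - 1) ⌊X⌋ := by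
    ext a; simp only [Finset.mem_Icc, Finset.mem_Ioc]; omega
  have hf : 0 ≤ ⌊X⌋ := Int.floor_nonneg.2 hX
  have hmq : (0:ℚ) < m := by exact_mod_cast hm
  have h := Int.Ioc_filter_modEq_card (-⌊X⌋ - 1) ⌊X⌋ (r := (m:ℤ)) (by exact_mod_cast hm) c
  rw [← hI] at h
  set n := ((Finset.Icc (-⌊X⌋) ⌊X⌋).filter (fun a => a ≡ c [ZMOD m])).card with hn
  set u : ℚ := ((⌊X⌋:ℤ) - c : ℚ) / ((m:ℤ):ℚ) with hu
  set v : ℚ := (((-⌊X⌋ - 1 : ℤ) : ℚ) - c : ℚ) / ((m:ℤ):ℚ) with hv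
  have huv : v ≤ u := by
    rw [hu, hv]
    have : (0:ℚ) ≤ (⌊X⌋:ℤ) := by exact_mod_cast hf
    push_cast
    gcongr
    linarith
  rw [max_eq_left (by have := Int.floor_mono huv; omega)] at h
  have hd : u - v = (2 * (⌊X⌋:ℚ) + 1) / m := by
    rw [hu, hv]; push_cast; field_simp; ring
  have hq : |(n:ℚ) - (2 * (⌊X⌋:ℚ) + 1) / m| ≤ 1 := by
    rw [← hd]
    have : (n:ℚ) = (⌊u⌋:ℚ) - ⌊v⌋ := by exact_mod_cast h
    rw [this, abs_le]
    have h1 := Int.floor_le u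
    have h2 := Int.floor_le v
    have h3 := Int.lt_floor_add_one u
    have h4 := Int.lt_floor_add_one v
    constructor <;> linarith
  have hr : |(n:ℝ) - (2 * (⌊X⌋:ℝ) + 1) / m| ≤ 1 := by exact_mod_cast hq
  have hmr : (1:ℝ) ≤ m := by exact_mod_cast hm
  have h5 : |(2 * (⌊X⌋:ℝ) + 1) / m - 2 * X / m| ≤ 1 := by
    rw [← sub_div, abs_div, abs_of_pos (by linarith : (0:ℝ) < m), div_le_one (by linarith)]
    refine le_trans ?_ hmr
    rw [abs_le]
    have h1 := Int.floor_le X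
    have h3 := Int.lt_floor_add_one X
    constructor <;> linarith
  calc _ = |((n:ℝ) - (2 * (⌊X⌋:ℝ) + 1) / m) + ((2 * (⌊X⌋:ℝ) + 1) / m - 2 * X / m)| := by ring_nf
    _ ≤ _ := abs_add_le _ _
    _ ≤ 2 := by linarith

/-- Integers in the box, in the class, divisible by `e`. -/
noncomputable def SS (r : ℤ) (X : ℝ) (e : ℕ) : Finset ℤ :=
  (Finset.Icc (-⌊X⌋) ⌊X⌋).filter (fun a => a ≡ r [ZMOD 6] ∧ (e : ℤ) ∣ a)

lemma count_SS (r : ℤ) (X : ℝ) (hX : 0 ≤ X) (e : ℕ) (he : 0 < e) (hc : Nat.Coprime e 6) :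
    |((SS r X e).card : ℝ) - X / (3 * e)| ≤ 2 := by
  obtain ⟨c, hc1, hc2⟩ : ∃ c : ℤ, (e:ℤ) ∣ c ∧ c ≡ r [ZMOD 6] := by
    have hco : IsCoprime (e:ℤ) 6 := by exact_mod_cast Nat.isCoprime_iff_coprime.2 hc
    obtain ⟨x, y, hxy⟩ := hco
    refine ⟨r * x * e, Dvd.intro_left _ rfl, ?_⟩
    rw [Int.modEq_iff_dvd]
    exact ⟨r * y, by linear_combination (-r) * hxy⟩
  have hS : SS r X e = (Finset.Icc (-⌊X⌋) ⌊X⌋).filter (fun a => a ≡ c [ZMOD ((e * 6 : ℕ) : ℤ)]) := by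
    unfold SS
    refine Finset.filter_congr fun a _ => ?_
    push_cast
    have hco : (e:ℤ).natAbs.Coprime (6:ℤ).natAbs := by simpa using hc
    rw [← Int.modEq_and_modEq_iff_modEq_mul hco]
    constructor
    · rintro ⟨h1, h2⟩
      refine ⟨?_, h1.trans hc2.symm⟩
      rw [Int.modEq_iff_dvd]
      exact dvd_sub hc1 h2
    · rintro ⟨h1, h2⟩
      refine ⟨h2.trans hc2, ?_⟩
      have := Int.modEq_iff_dvd.1 h1
      exact (dvd_sub_right hc1).1 this
  have h := count_ap X hX (e * 6) (by positivity) c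
  rw [← hS] at h
  have : 2 * X / ((e * 6 : ℕ):ℝ) = X / (3 * e) := by
    have : (e:ℝ) ≠ 0 := by positivity
    push_cast; field_simp; ring
  rwa [this] at h

open ArithmeticFunction Classical in
lemma moebius_ind (a b : ℤ) (ha : a ≠ 0) (K : ℕ) (hK : a.natAbs ≤ K) :
    (∑ d ∈ (Finset.Icc 1 K).filter (fun d : ℕ => ((d^4 : ℕ):ℤ) ∣ a ∧ ((d^6 : ℕ):ℤ) ∣ b), (moebius d : ℤ))
      = if ∀ p : ℕ, p.Prime → (p : ℤ)^4 ∣ a → ¬((p : ℤ)^6 ∣ b) then 1 else 0 := by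
  classical
  have ha' : a.natAbs ≠ 0 := by simpa using ha
  set S := (Finset.Icc 1 K).filter (fun d : ℕ => ((d^4 : ℕ):ℤ) ∣ a ∧ ((d^6 : ℕ):ℤ) ∣ b) with hS
  have hmem : ∀ d, d ∈ S ↔ d^4 ∣ a.natAbs ∧ d^6 ∣ b.natAbs := by
    intro d
    rw [hS, Finset.mem_filter, Int.natCast_dvd, Int.natCast_dvd, Finset.mem_Icc]
    refine ⟨fun h => h.2, fun h => ⟨⟨?_, ?_⟩, h⟩⟩
    · rcases Nat.eq_zero_or_pos d with rfl | h0
      · simp at h; omega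
      · exact h0
    · exact (Nat.le_self_pow (by norm_num) d).trans ((Nat.le_of_dvd (by omega) h.1).trans hK)
  set D := S.lcm id with hD
  have hDS : D ∈ S := by
    have : ∀ T : Finset ℕ, T ⊆ S → T.lcm id ∈ S := by
      intro T
      induction T using Finset.induction_on with
      | empty => intro _; rw [hmem]; simp
      | insert x T hx ih =>
        intro hT
        have h1 := (hmem _).1 (ih ((Finset.subset_insert _ _).trans hT))
        have h2 := (hmem _).1 (hT (Finset.mem_insert_self x T))
        rw [Finset.lcm_insert, hmem]
        change (Nat.lcm x (T.lcm id))^4 ∣ _ ∧ (Nat.lcm x (T.lcm id))^6 ∣ _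
        rw [← Nat.pow_lcm_pow, ← Nat.pow_lcm_pow]
        exact ⟨Nat.lcm_dvd h2.1 h1.1, Nat.lcm_dvd h2.2 h1.2⟩
    exact this S subset_rfl
  have hD0 : D ≠ 0 := by
    have := (Finset.mem_Icc.1 (Finset.mem_filter.1 hDS).1).1
    omega
  have hSD : S = D.divisors := by
    ext d
    rw [Nat.mem_divisors]
    constructor
    · intro h
      exact ⟨Finset.dvd_lcm (f := id) h, hD0⟩
    · rintro ⟨h, -⟩
      have h1 := (hmem _).1 hDS
      rw [hmem]
      exact ⟨(pow_dvd_pow_of_dvd h 4).trans h1.1, (pow_dvd_pow_of_dvd h 6).trans h1.2⟩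
  have hsum : ∑ d ∈ D.divisors, (moebius d : ℤ) = if D = 1 then 1 else 0 := by
    rw [← coe_mul_zeta_apply, moebius_mul_coe_zeta, one_apply]
  rw [hSD, hsum]
  congr 1
  apply propext
  have hp : ∀ p : ℕ, p ∈ S ↔ (p:ℤ)^4 ∣ a ∧ (p:ℤ)^6 ∣ b := by
    intro p
    rw [hmem, ← Int.natCast_dvd, ← Int.natCast_dvd]; push_cast; rfl
  constructor
  · intro h p hpp h1 h2
    have := (hp p).2 ⟨h1, h2⟩
    rw [hSD, h] at this
    simp at this
    exact hpp.one_lt.ne' this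
  · intro h
    by_contra hne
    obtain ⟨p, hpp, hpD⟩ := Nat.exists_prime_and_dvd hne
    have : p ∈ S := by rw [hSD, Nat.mem_divisors]; exact ⟨hpD, hD0⟩
    have := (hp p).1 this
    exact h p hpp this.1 this.2

lemma SS_zero_of_lt (r : ℤ) (hr : ¬(3 ∣ r)) (X : ℝ) (e : ℕ) (h : X < e) : SS r X e = ∅ := by
  rw [Finset.eq_empty_iff_forall_notMem]
  intro a ha
  simp only [SS, Finset.mem_filter, Finset.mem_Icc] at ha
  obtain ⟨⟨h1, h2⟩, h3, h4⟩ := ha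
  have h5 : a = 0 := by
    apply Int.eq_zero_of_abs_lt_dvd h4
    have : ⌊X⌋ < (e:ℤ) := Int.floor_lt.2 (by exact_mod_cast h)
    rw [abs_lt]; omega
  subst h5
  have := Int.modEq_iff_dvd.1 h3
  omega

open ArithmeticFunction in
lemma card_family (r t : ℤ) (hr : ¬(3 ∣ r)) (ht : ¬(2 ∣ t)) (H : ℝ) (X Y : ℝ)
    (hX : H ^ ((1:ℝ)/3) = X) (hY : H ^ ((1:ℝ)/2) = Y) (hX0 : 0 ≤ X) :
    (Nat.card (Family r t H) : ℝ) =
      ∑ d ∈ Finset.Icc 1 (⌊X⌋.toNat), gMu d * (((SS r X (d^4)).card : ℝ) * (SS t Y (d^6)).card) := by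
  classical
  set B := (SS r X 1) ×ˢ (SS t Y 1) with hB
  set P : ℤ × ℤ → Prop := fun ab => ∀ p : ℕ, p.Prime → (p : ℤ)^4 ∣ ab.1 → ¬((p : ℤ)^6 ∣ ab.2) with hP
  have hin : ∀ (a : ℤ) (Z : ℝ), (|a| : ℝ) ≤ Z ↔ (-⌊Z⌋ ≤ a ∧ a ≤ ⌊Z⌋) := by
    intro a Z
    rw [← abs_le, Int.le_floor]
    push_cast; rfl
  have hF : Family r t H = ((B.filter P : Finset (ℤ × ℤ)) : Set (ℤ × ℤ)) := by
    ext ⟨a, b⟩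
    simp only [Family, Set.mem_ofPred_eq, hX, hY, hin, Finset.coe_filter, hB, hP, Finset.mem_product, SS,
      Finset.mem_filter, Finset.mem_Icc]
    simp
    tauto
  have hcard : (Nat.card (Family r t H) : ℤ) = ∑ ab ∈ B, if P ab then 1 else 0 := by
    rw [hF, Nat.card_coe_set_eq, Set.ncard_coe_finset, Finset.card_filter]
    push_cast
    rfl
  have hcard2 : (Nat.card (Family r t H) : ℤ) = ∑ ab ∈ B, ∑ d ∈ Finset.Icc 1 (⌊X⌋.toNat),
      if (((d^4 : ℕ):ℤ) ∣ ab.1 ∧ ((d^6 : ℕ):ℤ) ∣ ab.2) then (moebius d : ℤ) else 0 := by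
    rw [hcard]
    refine Finset.sum_congr rfl fun ab hab => ?_
    rw [← Finset.sum_filter, moebius_ind]
    · simp only [hB, Finset.mem_product, SS, Finset.mem_filter, Finset.mem_Icc] at hab
      intro h0
      rw [h0] at hab
      have := Int.modEq_iff_dvd.1 hab.1.2.1
      omega
    · simp only [hB, Finset.mem_product, SS, Finset.mem_filter, Finset.mem_Icc] at hab
      omega
  rw [Finset.sum_comm] at hcard2
  have hcard3 : (Nat.card (Family r t H) : ℝ) = ∑ d ∈ Finset.Icc 1 (⌊X⌋.toNat), ∑ ab ∈ B,
      if (((d^4 : ℕ):ℤ) ∣ ab.1 ∧ ((d^6 : ℕ):ℤ) ∣ ab.2) then ((moebius d : ℤ) : ℝ) else 0 := by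
    exact_mod_cast hcard2
  rw [hcard3]
  refine Finset.sum_congr rfl fun d hd => ?_
  rw [← Finset.sum_filter, Finset.sum_const]
  have hfil : B.filter (fun ab => ((d^4 : ℕ):ℤ) ∣ ab.1 ∧ ((d^6 : ℕ):ℤ) ∣ ab.2)
      = (SS r X (d^4)) ×ˢ (SS t Y (d^6)) := by
    ext ⟨a, b⟩
    simp only [hB, Finset.mem_product, SS, Finset.mem_filter, Finset.mem_Icc]
    simp
    tauto
  rw [hfil, Finset.card_product]
  by_cases hc : Nat.Coprime d 6
  · simp [gMu, hc, mul_comm]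
  · have h23 : 2 ∣ d ∨ 3 ∣ d := by
      by_contra hcon
      push Not at hcon
      apply hc
      rw [show 6 = 2 * 3 from rfl, Nat.coprime_mul_iff_right]
      exact ⟨((Nat.Prime.coprime_iff_not_dvd Nat.prime_two).2 hcon.1).symm,
        ((Nat.Prime.coprime_iff_not_dvd Nat.prime_three).2 hcon.2).symm⟩
    rcases h23 with h | h
    · have : SS t Y (d^6) = ∅ := by
        rw [Finset.eq_empty_iff_forall_notMem]
        intro b hb
        simp only [SS, Finset.mem_filter] at hb
        have h1 : (2:ℤ) ∣ b := (Int.natCast_dvd_natCast.2 (h.trans (dvd_pow_self d (by norm_num)))).trans hb.2.2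
        have := Int.modEq_iff_dvd.1 hb.2.1
        omega
      simp [this]
    · have : SS r X (d^4) = ∅ := by
        rw [Finset.eq_empty_iff_forall_notMem]
        intro b hb
        simp only [SS, Finset.mem_filter] at hb
        have h1 : (3:ℤ) ∣ b := (Int.natCast_dvd_natCast.2 (h.trans (dvd_pow_self d (by norm_num)))).trans hb.2.2
        have := Int.modEq_iff_dvd.1 hb.2.1
        omega
      simp [this]

lemma local_bound (r t : ℤ) (hr : ¬(3 ∣ r)) (x : ℝ) (hx : 1 ≤ x) (d : ℕ) (hd : 0 < d)
    (hc : Nat.Coprime d 6) :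
    |((SS r (x^4) (d^4)).card : ℝ) * (SS t (x^6) (d^6)).card - x^10 / (9 * d^10)| ≤ 6 * x^6 * (1 / (d:ℝ)^6) := by
  have hd' : (0:ℝ) < d := by exact_mod_cast hd
  set u := x / d with hu
  have hu0 : 0 < u := by positivity
  have e1 : x^10 / (9 * (d:ℝ)^10) = u^10 / 9 := by rw [hu]; field_simp
  have e2 : 6 * x^6 * (1 / (d:ℝ)^6) = 6 * u^6 := by rw [hu]; field_simp
  rw [e1, e2]
  by_cases h : (d:ℝ) ≤ x
  · have hu1 : 1 ≤ u := by rw [hu, one_le_div hd']; exact h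
    have hA := count_SS r (x^4) (by positivity) (d^4) (by positivity) (hc.pow_left 4)
    have hB := count_SS t (x^6) (by positivity) (d^6) (by positivity) (hc.pow_left 6)
    have e3 : x^4 / (3 * ((d^4 : ℕ) : ℝ)) = u^4 / 3 := by rw [hu]; push_cast; field_simp
    have e4 : x^6 / (3 * ((d^6 : ℕ) : ℝ)) = u^6 / 3 := by rw [hu]; push_cast; field_simp
    rw [e3] at hA
    rw [e4] at hB
    set A := ((SS r (x^4) (d^4)).card : ℝ)
    set B := ((SS t (x^6) (d^6)).card : ℝ)
    have h4 : u^4 ≤ u^6 := pow_le_pow_right₀ hu1 (by norm_num)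
    have h6 : 1 ≤ u^6 := one_le_pow₀ hu1
    have e5 : A * B - u^10/9 = (A - u^4/3) * (B - u^6/3) + (u^4/3) * (B - u^6/3) + (A - u^4/3) * (u^6/3) := by ring
    rw [e5]
    have b1 : |(A - u^4/3) * (B - u^6/3)| ≤ 2 * 2 := by
      rw [abs_mul]; exact mul_le_mul hA hB (abs_nonneg _) (by norm_num)
    have b2 : |(u^4/3) * (B - u^6/3)| ≤ (u^4/3) * 2 := by
      rw [abs_mul, abs_of_pos (by positivity : 0 < u^4/3)]; gcongr
    have b3 : |(A - u^4/3) * (u^6/3)| ≤ 2 * (u^6/3) := by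
      rw [abs_mul, abs_of_pos (by positivity : 0 < u^6/3)]; gcongr
    refine (abs_add_three _ _ _).trans ?_
    linarith
  · push Not at h
    have hlt : x^4 < ((d^4 : ℕ) : ℝ) := by
      push_cast; exact pow_lt_pow_left₀ h (by linarith) (by norm_num)
    rw [SS_zero_of_lt r hr _ _ hlt]
    have hu1 : u ≤ 1 := by rw [hu, div_le_one hd']; exact h.le
    have : u^10 ≤ u^6 := pow_le_pow_of_le_one hu0.le hu1 (by norm_num)
    simp only [Finset.card_empty, Nat.cast_zero, zero_mul, zero_sub, abs_neg]
    rw [abs_of_pos (by positivity)]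
    have : 0 < u^6 := by positivity
    linarith

theorem stmt2 (r t : ℤ) (hr : ¬(3 ∣ r)) (ht : ¬(2 ∣ t)) :
    ∃ C : ℝ, 0 < C ∧ ∀ H : ℝ, 1 < H →
      |(Nat.card (Family r t H) : ℝ) - H ^ ((5:ℝ)/6) / (9 * zetaRemoved 6 10)|
        ≤ C * H ^ ((1:ℝ)/2) := by
  have hs6 : Summable (fun d : ℕ => 1 / (d:ℝ)^6) := Real.summable_one_div_nat_pow.2 (by norm_num)
  have hs10 : Summable (fun d : ℕ => 1 / (d:ℝ)^10) := Real.summable_one_div_nat_pow.2 (by norm_num)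
  have hg : Summable (fun d : ℕ => gMu d / (d:ℝ)^10) := by
    refine Summable.of_norm_bounded hs10 fun d => ?_
    rw [Real.norm_eq_abs, abs_div, abs_of_nonneg (by positivity : (0:ℝ) ≤ (d:ℝ)^10)]
    gcongr
    exact abs_gMu_le d
  refine ⟨6 * (∑' d : ℕ, 1 / (d:ℝ)^6) + 1, ?_, fun H hH => ?_⟩
  · have : 0 ≤ ∑' d : ℕ, 1 / (d:ℝ)^6 := tsum_nonneg fun d => by positivity
    linarith
  have hH0 : 0 ≤ H := by linarith
  set x := H ^ ((1:ℝ)/12) with hx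
  have hx1 : 1 ≤ x := Real.one_le_rpow hH.le (by norm_num)
  have hX : H ^ ((1:ℝ)/3) = x^4 := by
    rw [hx, ← Real.rpow_natCast, ← Real.rpow_mul hH0]; norm_num
  have hY : H ^ ((1:ℝ)/2) = x^6 := by
    rw [hx, ← Real.rpow_natCast, ← Real.rpow_mul hH0]; norm_num
  have hZ : H ^ ((5:ℝ)/6) = x^10 := by
    rw [hx, ← Real.rpow_natCast, ← Real.rpow_mul hH0]; norm_num
  rw [card_family r t hr ht H (x^4) (x^6) hX hY (by positivity), hY, hZ]
  set N : ℕ → ℝ := fun d => ((SS r (x^4) (d^4)).card : ℝ) * (SS t (x^6) (d^6)).card with hN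
  have hzero : ∀ d ∉ Finset.Icc 1 (⌊x^4⌋.toNat), gMu d * N d = 0 := by
    intro d hd
    rcases Nat.eq_zero_or_pos d with rfl | hd0
    · simp [gMu]
    · have hlt : x^4 < ((d^4 : ℕ) : ℝ) := by
        rw [Finset.mem_Icc] at hd
        have h1 : ⌊x^4⌋ < (d:ℤ) := by omega
        have h2 : x^4 < (d:ℝ) := by exact_mod_cast Int.floor_lt.1 h1
        refine h2.trans_le ?_
        exact_mod_cast Nat.le_self_pow (by norm_num) d
      simp [hN, SS_zero_of_lt r hr _ _ hlt]
  have hsumN : Summable (fun d => gMu d * N d) := summable_of_ne_finset_zero hzero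
  have e1 : ∑ d ∈ Finset.Icc 1 (⌊x^4⌋.toNat), gMu d * N d = ∑' d, gMu d * N d :=
    (tsum_eq_sum (fun d hd => hzero d hd)).symm
  have e2 : x^10 / (9 * zetaRemoved 6 10) = ∑' d : ℕ, (x^10 / 9) * (gMu d / (d:ℝ)^10) := by
    rw [tsum_mul_left, tsum_gMu]; ring
  change |∑ d ∈ Finset.Icc 1 (⌊x^4⌋.toNat), gMu d * N d - _| ≤ _
  rw [e1, e2, ← hsumN.tsum_sub (hg.mul_left _)]
  have hb : ∀ d : ℕ, ‖gMu d * N d - (x^10 / 9) * (gMu d / (d:ℝ)^10)‖ ≤ 6 * x^6 * (1 / (d:ℝ)^6) := by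
    intro d
    rw [Real.norm_eq_abs]
    by_cases hc : Nat.Coprime d 6
    · have hd0 : 0 < d := by
        rcases Nat.eq_zero_or_pos d with rfl | h
        · norm_num at hc
        · exact h
      have := local_bound r t hr x hx1 d hd0 hc
      have e : gMu d * N d - (x^10 / 9) * (gMu d / (d:ℝ)^10) = gMu d * (N d - x^10 / (9 * d^10)) := by
        have : (d:ℝ) ≠ 0 := by positivity
        field_simp
      rw [e, abs_mul]
      calc _ ≤ 1 * |N d - x^10 / (9 * d^10)| := by gcongr; exact abs_gMu_le d
        _ ≤ _ := by rw [one_mul]; exact this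
    · have : gMu d = 0 := by simp [gMu, hc]
      rw [this]; simp; positivity
  have := tsum_of_norm_bounded (hs6.mul_left (6 * x^6)).hasSum hb
  rw [Real.norm_eq_abs, tsum_mul_left] at this
  have hx6 : 0 < x^6 := by positivity
  refine this.trans ?_
  nlinarith
end

section
/- Let Q be a positive integer, S ⊆ (ℤ/Qℤ)² an arbitrary subset, and d a positive integer. Then #{(a,b) ∈ (ℤ/Qℤ)² : (a·d⁴, b·d⁶) ∈ S} = gcd(d⁴,Q)·gcd(d⁶,Q)·#{(α,β) ∈ S : gcd(d⁴,Q) ∣ gcd(α,Q) and gcd(d⁶,Q) ∣ gcd(β,Q)}, where gcd(α,Q) denotes the gcd of Q with any lift of α to ℤ. -/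
theorem fiber_card_aux (Q : ℕ) [NeZero Q] (n : ℕ) (α : ZMod Q) :
    (Finset.univ.filter (fun a : ZMod Q => a * (n : ZMod Q) = α)).card
      = if Nat.gcd n Q ∣ Nat.gcd (ZMod.val α) Q then Nat.gcd n Q else 0 := by
  have hmem : (∃ a : ZMod Q, a * (n : ZMod Q) = α) ↔ Nat.gcd n Q ∣ Nat.gcd (ZMod.val α) Q := by
    rw [Nat.dvd_gcd_iff, and_iff_left (Nat.gcd_dvd_right n Q)]
    constructor
    · rintro ⟨a, rfl⟩
      have h : a * (n : ZMod Q) = ((a.val * n : ℕ) : ZMod Q) := by simp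
      rw [h, ZMod.val_natCast, Nat.dvd_mod_iff (Nat.gcd_dvd_right n Q)]
      exact (Nat.gcd_dvd_left n Q).mul_left _
    · intro h
      have h2 : (Int.gcd (n : ℤ) (Q : ℤ)) ∣ α.val := by simpa using h
      have h3 := (Int.gcd_dvd_iff (a := (n : ℤ)) (b := (Q : ℤ)) (n := α.val)).1 h2
      obtain ⟨x, y, hxy⟩ := h3
      refine ⟨(x : ZMod Q), ?_⟩
      have h4 := congrArg (Int.cast : ℤ → ZMod Q) hxy
      push_cast at h4
      simp at h4
      rw [h4, mul_comm]
  split_ifs with h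
  · obtain ⟨b, hb⟩ := hmem.2 h
    have key := IsAddCyclic.card_nsmulAddMonoidHom_ker (G := ZMod Q) n
    have e := AddMonoidHom.card_fiber_eq_of_mem_range
      (nsmulAddMonoidHom n : ZMod Q →+ ZMod Q) (x := α) (y := 0)
      ⟨b, by simp [← hb, mul_comm]⟩ ⟨0, by simp⟩
    rw [Nat.card_zmod, Nat.gcd_comm] at key
    rw [← key, Nat.card_eq_fintype_card, Fintype.card_subtype]
    simp only [nsmulAddMonoidHom_apply, nsmul_eq_mul, mul_comm, AddMonoidHom.mem_ker] at e ⊢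
    exact e
  · rw [Finset.card_eq_zero, Finset.filter_eq_empty_iff]
    intro a _ ha
    exact h (hmem.1 ⟨a, ha⟩)


theorem stmt5 (Q : ℕ) (hQ : 0 < Q) (S : Finset (ZMod Q × ZMod Q)) (d : ℕ) (hd : 0 < d) :
    Nat.card {ab : ZMod Q × ZMod Q |
        (ab.1 * (d : ZMod Q)^4, ab.2 * (d : ZMod Q)^6) ∈ S}
      = Nat.gcd (d^4) Q * Nat.gcd (d^6) Q *
        (S.filter (fun ab => Nat.gcd (d^4) Q ∣ Nat.gcd (ZMod.val ab.1) Q ∧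
                             Nat.gcd (d^6) Q ∣ Nat.gcd (ZMod.val ab.2) Q)).card := by

  classical
  haveI : NeZero Q := ⟨hQ.ne'⟩
  have h1 : Nat.card {ab : ZMod Q × ZMod Q |
        (ab.1 * (d : ZMod Q)^4, ab.2 * (d : ZMod Q)^6) ∈ S} =
      (Finset.univ.filter (fun ab : ZMod Q × ZMod Q =>
        (ab.1 * (d : ZMod Q)^4, ab.2 * (d : ZMod Q)^6) ∈ S)).card := by
    rw [Nat.card_eq_fintype_card]
    exact Fintype.card_subtype _
  rw [h1, Finset.card_eq_sum_card_fiberwise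
    (f := fun ab : ZMod Q × ZMod Q => (ab.1 * (d : ZMod Q)^4, ab.2 * (d : ZMod Q)^6)) (t := S)
    (fun x hx => by simpa using hx), mul_comm (_ * _), ← smul_eq_mul, ← Finset.sum_const,
    Finset.sum_filter]
  refine Finset.sum_congr rfl fun p hp => ?_
  have h2 : (Finset.univ.filter (fun ab : ZMod Q × ZMod Q =>
        (ab.1 * (d : ZMod Q)^4, ab.2 * (d : ZMod Q)^6) ∈ S)).filter
        (fun ab => (ab.1 * (d : ZMod Q)^4, ab.2 * (d : ZMod Q)^6) = p)
      = (Finset.univ.filter (fun a : ZMod Q => a * ((d^4 : ℕ) : ZMod Q) = p.1)) ×ˢ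
        (Finset.univ.filter (fun a : ZMod Q => a * ((d^6 : ℕ) : ZMod Q) = p.2)) := by
    ext ⟨a, b⟩
    obtain ⟨u, v⟩ := p
    simp only [Finset.mem_filter, Finset.mem_univ, true_and, Finset.mem_product, Prod.mk.injEq,
      Nat.cast_pow]
    constructor
    · exact fun h => h.2
    · rintro ⟨rfl, rfl⟩
      exact ⟨hp, rfl, rfl⟩
  rw [h2, Finset.card_product, fiber_card_aux, fiber_card_aux]
  split_ifs <;> simp_all
end

section
/- There is an absolute constant C > 0 such that for every positive integer m, ρ(2,m)·ρ(3,m)·∏_{p ≥ 5 prime, p ∣ m} ρ(p,m)/(1 − p^{−2}) ≤ C·(1/m)·∏_{p ∣ m, p prime} (3/p). -/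
/-- The local density `ρ(p,m)`; `n` is the `p`-adic valuation of `m`. -/
noncomputable def rho (p m : ℕ) : ℝ :=
  let n : ℕ := m.factorization p
  let q : ℝ := (p : ℝ)⁻¹
  if p = 3 then (if n = 0 then 1 else 0)
  else if p = 2 then (if n = 0 then 1/2 else if n ≤ 2 then 1/4 else 0)
  else if n = 0 then 1 - q^2
  else if n = 1 then q^2 * (1 - q)
  else if n = 2 then q^3 * (1 - q)
  else if n = 3 then q^4 * (1 - q)^2
  else if n = 4 then q^5 * (1 - q) * (2 - q)
  else if n = 5 then q^6 * (1 - q) * (2 - 2*q)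
  else if n ≤ 8 then q^(n+1) * (1 - q) * (3 - 2*q)
  else q^(n+1) * (1 - q) * (2 - 2*q)

theorem rho_aux_le {p m : ℕ} (hp : 5 ≤ p) (hn : m.factorization p ≠ 0) :
    0 ≤ rho p m / (1 - ((p : ℝ)⁻¹)^2) ∧
    rho p m / (1 - ((p : ℝ)⁻¹)^2) ≤ ((p : ℝ) ^ m.factorization p)⁻¹ * (3 / (p : ℝ)) := by
  have hp3 : p ≠ 3 := by omega
  have hp2 : p ≠ 2 := by omega
  have hpR : (5 : ℝ) ≤ p := by exact_mod_cast hp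
  have hq0 : (0 : ℝ) < (p : ℝ)⁻¹ := by positivity
  have hq1 : (p : ℝ)⁻¹ ≤ 1 / 5 := by
    rw [inv_le_comm₀ (by linarith) (by norm_num)]; linarith
  have hR : ((p : ℝ) ^ m.factorization p)⁻¹ * (3 / (p : ℝ))
      = 3 * ((p : ℝ)⁻¹) ^ (m.factorization p + 1) := by
    rw [pow_succ, inv_pow, div_eq_mul_inv]; ring
  rw [hR]
  have key : ∃ c : ℝ, 0 ≤ c ∧ c ≤ 3 - 2 * (p : ℝ)⁻¹ ∧
      rho p m = ((p : ℝ)⁻¹) ^ (m.factorization p + 1) * (1 - (p : ℝ)⁻¹) * c := by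
    unfold rho
    simp only [hp3, hp2, hn, if_false]
    generalize m.factorization p = n at *
    generalize (p : ℝ)⁻¹ = q at *
    split_ifs with h1 h2 h3 h4 h5 h6
    · exact ⟨1, by linarith, by linarith, by subst h1; ring⟩
    · exact ⟨1, by linarith, by linarith, by subst h2; ring⟩
    · exact ⟨1 - q, by linarith, by linarith, by subst h3; ring⟩
    · exact ⟨2 - q, by linarith, by linarith, by subst h4; ring⟩
    · exact ⟨2 - 2 * q, by linarith, by linarith, by subst h5; ring⟩
    · exact ⟨3 - 2 * q, by linarith, by linarith, by ring⟩
    · exact ⟨2 - 2 * q, by linarith, by linarith, by ring⟩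
  obtain ⟨c, hc0, hc1, hc⟩ := key
  rw [hc]
  generalize (p : ℝ)⁻¹ = q at *
  have hd : 0 < 1 - q ^ 2 := by nlinarith
  have hQ : 0 < q ^ (m.factorization p + 1) := by positivity
  have h1q : 0 < 1 - q := by linarith
  refine ⟨by positivity, ?_⟩
  rw [div_le_iff₀ hd]
  have : (1 - q) * c ≤ 3 * (1 - q ^ 2) := by nlinarith
  nlinarith

theorem rho_two_bounds {m : ℕ} (hm : 0 < m) :
    0 ≤ rho 2 m ∧ rho 2 m ≤ if 2 ∈ m.primeFactors then
      (((2 : ℕ) : ℝ) ^ m.factorization 2)⁻¹ * (3 / ((2 : ℕ) : ℝ)) else 1 := by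
  simp only [← Nat.support_factorization, Finsupp.mem_support_iff]
  unfold rho
  generalize m.factorization 2 = n
  by_cases h0 : n = 0
  · subst h0; norm_num
  by_cases h2 : n ≤ 2
  · have : n = 1 ∨ n = 2 := by omega
    rcases this with rfl | rfl <;> norm_num
  · simp [h0, h2]; positivity

theorem rho_three_bounds {m : ℕ} (hm : 0 < m) :
    0 ≤ rho 3 m ∧ rho 3 m ≤ if 3 ∈ m.primeFactors then
      (((3 : ℕ) : ℝ) ^ m.factorization 3)⁻¹ * (3 / ((3 : ℕ) : ℝ)) else 1 := by
  simp only [← Nat.support_factorization, Finsupp.mem_support_iff]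
  unfold rho
  generalize m.factorization 3 = n
  by_cases h0 : n = 0
  · subst h0; norm_num
  · simp [h0]

theorem stmt7 :
    ∃ C : ℝ, 0 < C ∧ ∀ m : ℕ, 0 < m →
      rho 2 m * rho 3 m *
          ∏ p ∈ m.primeFactors.filter (fun p => 5 ≤ p), rho p m / (1 - ((p : ℝ)⁻¹)^2)
        ≤ C * (1 / (m : ℝ)) * ∏ p ∈ m.primeFactors, 3 / (p : ℝ) := by
  refine ⟨1, one_pos, fun m hm => ?_⟩
  have hmR : (1 / (m : ℝ)) = ∏ p ∈ m.primeFactors, ((p : ℝ) ^ m.factorization p)⁻¹ := by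
    rw [Finset.prod_inv_distrib, one_div]
    congr 1
    conv_lhs => rw [← Nat.prod_factorization_pow_eq_self hm.ne']
    simp [Finsupp.prod]
  rw [one_mul, hmR, ← Finset.prod_mul_distrib,
    ← Finset.prod_filter_mul_prod_filter_not m.primeFactors (fun p => 5 ≤ p), mul_comm]
  have hs : m.primeFactors.filter (fun p => ¬ 5 ≤ p)
      = ({2, 3} : Finset ℕ).filter (fun p => p ∈ m.primeFactors) := by
    ext p
    simp only [Finset.mem_filter, Finset.mem_insert, Finset.mem_singleton]
    constructor
    · rintro ⟨h, h5⟩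
      have hp := Nat.prime_of_mem_primeFactors h
      refine ⟨?_, h⟩
      have : p < 5 := by omega
      interval_cases p <;> first | omega | (exact absurd hp (by norm_num))
    · rintro ⟨h, h'⟩
      exact ⟨h', by omega⟩
  have hb : ∀ p ∈ m.primeFactors.filter (fun p => 5 ≤ p), _ := fun p hp =>
    rho_aux_le (p := p) (m := m) (Finset.mem_filter.1 hp).2 (by
      have := (Finset.mem_filter.1 hp).1
      rwa [← Nat.support_factorization, Finsupp.mem_support_iff] at this)
  rw [hs, Finset.prod_filter (s := {2, 3}), Finset.prod_pair (by norm_num)]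
  obtain ⟨a0, a1⟩ := rho_two_bounds hm
  obtain ⟨b0, b1⟩ := rho_three_bounds hm
  have hA := Finset.prod_le_prod (fun p hp => (hb p hp).1) (fun p hp => (hb p hp).2)
  have hB := Finset.prod_nonneg (fun p hp => (hb p hp).1)
  exact mul_le_mul hA (mul_le_mul a1 b1 b0 (a0.trans a1)) (mul_nonneg a0 b0) (hB.trans hA)
end

section
/- For every complex number s with Re(s) > 0, the series ∑_{m=1}^∞ m^{−s}·∏_{p ∣ m, p prime} (3/p) converges absolutely and equals the (convergent) infinite product ∏_{p prime} (1 + 3/(p(p^s − 1))). -/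
/-- The arithmetic function whose Dirichlet-type series we sum. -/
noncomputable def auxF (s : ℂ) (n : ℕ) : ℂ :=
  (n : ℂ) ^ (-s) * ∏ p ∈ n.primeFactors, (3 / (p : ℂ))

lemma auxF_zero (s : ℂ) (hs : 0 < s.re) : auxF s 0 = 0 := by
  have : -s ≠ 0 := by
    intro h
    rw [neg_eq_zero] at h
    simp [h] at hs
  simp [auxF, Complex.zero_cpow this]

lemma auxF_one (s : ℂ) : auxF s 1 = 1 := by simp [auxF]

lemma auxF_mul (s : ℂ) {m n : ℕ} (h : m.Coprime n) : auxF s (m * n) = auxF s m * auxF s n := by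
  unfold auxF
  rw [h.primeFactors_mul, Finset.prod_union h.disjoint_primeFactors, Nat.cast_mul,
    Complex.natCast_mul_natCast_cpow]
  ring

lemma auxF_pow (s : ℂ) {p : ℕ} (hp : p.Prime) (e : ℕ) :
    auxF s (p ^ (e + 1)) = ((p : ℂ) ^ (-s)) ^ (e + 1) * (3 / (p : ℂ)) := by
  unfold auxF
  rw [Nat.primeFactors_prime_pow (Nat.succ_ne_zero e) hp, Finset.prod_singleton, Nat.cast_pow,
    ← Complex.natCast_cpow_natCast_mul, Complex.cpow_nat_mul]

lemma aux_hasSum {K : Type*} [NormedField K] (r c : K) (hr : ‖r‖ < 1) (f : ℕ → K)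
    (h0 : f 0 = 1) (h : ∀ e, f (e + 1) = r ^ (e + 1) * c) :
    HasSum f (1 + c * r * (1 - r)⁻¹) := by
  have := (hasSum_geometric_of_norm_lt_one hr).mul_left (c * r)
  rw [← hasSum_nat_add_iff' 1]
  simp only [Finset.range_one, Finset.sum_singleton, h0, add_sub_cancel_left]
  have he : (fun e => f (e + 1)) = fun e => c * r * r ^ e := by
    funext e
    rw [h]
    ring
  rw [he]
  exact this

lemma norm_p (s : ℂ) {p : ℕ} (hp : p.Prime) : ‖(p : ℂ) ^ (-s)‖ = (p : ℝ) ^ (-s.re) := by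
  rw [Complex.norm_natCast_cpow_of_pos hp.pos, Complex.neg_re]

lemma norm_p_le (s : ℂ) (hs : 0 < s.re) {p : ℕ} (hp : p.Prime) :
    ‖(p : ℂ) ^ (-s)‖ ≤ (2 : ℝ) ^ (-s.re) := by
  rw [norm_p s hp]
  exact Real.rpow_le_rpow_of_nonpos (by norm_num) (by exact_mod_cast hp.two_le) (by linarith)

lemma two_lt (s : ℂ) (hs : 0 < s.re) : (2 : ℝ) ^ (-s.re) < 1 :=
  Real.rpow_lt_one_of_one_lt_of_neg (by norm_num) (by linarith)

lemma auxF_hasSum (s : ℂ) (hs : 0 < s.re) {p : ℕ} (hp : p.Prime) :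
    HasSum (fun e => auxF s (p ^ e))
      (1 + 3 / (p : ℂ) * (p : ℂ) ^ (-s) * (1 - (p : ℂ) ^ (-s))⁻¹) :=
  aux_hasSum _ _ ((norm_p_le s hs hp).trans_lt (two_lt s hs)) _ (by simp [auxF_one])
    (fun e => auxF_pow s hp e)

lemma auxF_norm_hasSum (s : ℂ) (hs : 0 < s.re) {p : ℕ} (hp : p.Prime) :
    HasSum (fun e => ‖auxF s (p ^ e)‖)
      (1 + 3 / (p : ℝ) * ‖(p : ℂ) ^ (-s)‖ * (1 - ‖(p : ℂ) ^ (-s)‖)⁻¹) := by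
  refine aux_hasSum _ _ ?_ _ (by simp [auxF_one]) (fun e => ?_)
  · rw [norm_norm]
    exact (norm_p_le s hs hp).trans_lt (two_lt s hs)
  · rw [auxF_pow s hp e]
    simp

lemma auxF_summable (s : ℂ) (hs : 0 < s.re) : Summable (fun n => ‖auxF s n‖) := by
  have key := EulerProduct.summable_and_hasSum_smoothNumbers_prod_primesBelow_tsum
    (f := fun n => ‖auxF s n‖) (by simp [auxF_one])
    (fun {m n} h => by simp only [auxF_mul s h, norm_mul])
    (fun {p} hp => by simpa using (auxF_norm_hasSum s hs hp).summable)
  have hr := two_lt s hs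
  set r := (2 : ℝ) ^ (-s.re) with hrdef
  set C := 3 * (1 - r)⁻¹ with hC
  have hC0 : 0 ≤ C := by
    have : 0 < 1 - r := by linarith
    positivity
  have hsum : Summable (fun n : ℕ => C * (n : ℝ) ^ (-1 - s.re)) :=
    (Real.summable_nat_rpow.2 (by linarith)).mul_left C
  have hnn : ∀ n : ℕ, 0 ≤ C * (n : ℝ) ^ (-1 - s.re) := fun n => by positivity
  have hle : ∀ {p : ℕ}, p.Prime →
      ∑' e, ‖auxF s (p ^ e)‖ ≤ Real.exp (C * (p : ℝ) ^ (-1 - s.re)) := by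
    intro p hp
    rw [(auxF_norm_hasSum s hs hp).tsum_eq]
    have h1 := norm_p_le s hs hp
    have hp0 : (0 : ℝ) < p := by exact_mod_cast hp.pos
    have h2 : (1 - ‖(p : ℂ) ^ (-s)‖)⁻¹ ≤ (1 - r)⁻¹ := by
      apply inv_anti₀ <;> linarith
    have h3 : (p : ℝ) ^ (-1 - s.re) = (p : ℝ)⁻¹ * ‖(p : ℂ) ^ (-s)‖ := by
      rw [norm_p s hp, sub_eq_add_neg, Real.rpow_add hp0, Real.rpow_neg_one]
    calc _ ≤ 1 + 3 / (p : ℝ) * ‖(p : ℂ) ^ (-s)‖ * (1 - r)⁻¹ := by gcongr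
      _ = C * (p : ℝ) ^ (-1 - s.re) + 1 := by rw [h3, hC]; ring
      _ ≤ _ := Real.add_one_le_exp _
  refine summable_of_sum_le (c := Real.exp (∑' n : ℕ, C * (n : ℝ) ^ (-1 - s.re)))
    (fun n => norm_nonneg _) (fun u => ?_)
  set N := u.sup id + 1 with hN
  have hk := (key N).2
  have hk1 := (key N).1
  have hind : Summable ((N.smoothNumbers).indicator (fun n => ‖auxF s n‖)) :=
    summable_subtype_iff_indicator.1 hk.summable
  calc ∑ n ∈ u, ‖auxF s n‖ ≤ ∑ n ∈ u, (N.smoothNumbers).indicator (fun n => ‖auxF s n‖) n := by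
        refine Finset.sum_le_sum fun n hn => ?_
        rcases Nat.eq_zero_or_pos n with rfl | hpos
        · rw [auxF_zero s hs, norm_zero]
          exact Set.indicator_nonneg (fun _ _ => norm_nonneg _) _
        · rw [Set.indicator_of_mem]
          exact Nat.mem_smoothNumbers_of_lt hpos
            (Nat.lt_succ_of_le (Finset.le_sup (f := id) hn))
    _ ≤ ∑' n, (N.smoothNumbers).indicator (fun n => ‖auxF s n‖) n :=
        hind.sum_le_tsum _ (fun n _ => Set.indicator_nonneg (fun _ _ => norm_nonneg _) _)
    _ = ∏ p ∈ N.primesBelow, ∑' e, ‖auxF s (p ^ e)‖ := by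
        rw [← hk.tsum_eq, ← tsum_subtype]
    _ ≤ ∏ p ∈ N.primesBelow, Real.exp (C * (p : ℝ) ^ (-1 - s.re)) :=
        Finset.prod_le_prod (fun p _ => tsum_nonneg fun _ => norm_nonneg _)
          (fun p hp => hle (Nat.prime_of_mem_primesBelow hp))
    _ = Real.exp (∑ p ∈ N.primesBelow, C * (p : ℝ) ^ (-1 - s.re)) := (Real.exp_sum _ _).symm
    _ ≤ _ := Real.exp_le_exp.2 (hsum.sum_le_tsum _ (fun n _ => hnn n))

theorem stmt8 (s : ℂ) (hs : 0 < s.re) :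
    Summable (fun m : ℕ =>
        ‖((m : ℂ) + 1) ^ (-s) * ∏ p ∈ (m + 1).primeFactors, (3 / (p : ℂ))‖) ∧
    Multipliable (fun p : Nat.Primes =>
        1 + 3 / ((p : ℕ) * (((p : ℕ) : ℂ) ^ s - 1))) ∧
    (∑' m : ℕ, ((m : ℂ) + 1) ^ (-s) * ∏ p ∈ (m + 1).primeFactors, (3 / (p : ℂ)))
      = ∏' p : Nat.Primes, (1 + 3 / ((p : ℕ) * (((p : ℕ) : ℂ) ^ s - 1))) := by
  have hsum := auxF_summable s hs
  have hshift : ∀ m : ℕ, ((m : ℂ) + 1) ^ (-s) * ∏ p ∈ (m + 1).primeFactors, (3 / (p : ℂ))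
      = auxF s (m + 1) := fun m => by simp [auxF]
  have hprod := EulerProduct.eulerProduct_hasProd (auxF_one s) (fun {m n} h => auxF_mul s h)
    hsum (auxF_zero s hs)
  have heq : (fun p : Nat.Primes => ∑' e, auxF s ((p : ℕ) ^ e)) =
      fun p : Nat.Primes => 1 + 3 / ((p : ℕ) * (((p : ℕ) : ℂ) ^ s - 1)) := by
    funext p
    have hp := p.2
    rw [(auxF_hasSum s hs hp).tsum_eq]
    have hp0 : ((p : ℕ) : ℂ) ≠ 0 := by exact_mod_cast hp.ne_zero
    have hlt := (norm_p_le s hs hp).trans_lt (two_lt s hs)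
    have hx0 : ((p : ℕ) : ℂ) ^ s ≠ 0 := by simp [Complex.cpow_eq_zero_iff, hp0]
    rw [Complex.cpow_neg] at hlt ⊢
    have hx1 : ((p : ℕ) : ℂ) ^ s - 1 ≠ 0 := by
      intro h
      rw [sub_eq_zero] at h
      simp [h] at hlt
    have hx2 : 1 - (((p : ℕ) : ℂ) ^ s)⁻¹ = (((p : ℕ) : ℂ) ^ s - 1) / ((p : ℕ) : ℂ) ^ s := by
      field_simp
    rw [hx2]
    field_simp
  rw [heq] at hprod
  simp only [hshift]
  refine ⟨(summable_nat_add_iff 1).2 hsum, hprod.multipliable, ?_⟩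
  rw [hprod.tprod_eq, hsum.of_norm.tsum_eq_zero_add, auxF_zero s hs, zero_add]
end

section
/- There is an absolute constant C > 0 such that for every real λ > 0, F_Δ(λ) − F_Δ(−λ) ≤ C·λ^{5/6}. -/
open MeasureTheory

theorem gap_bound (B m : ℝ) (hm : 0 < m) :
    (√(B + m) - √(B - m)) * √(|B| + m) ≤ 2 * m := by
  have hp := Real.sqrt_nonneg (B - m)
  have hq := Real.sqrt_nonneg (B + m)
  have hr := Real.sqrt_nonneg (|B| + m)
  have hr2 : √(|B| + m) ^ 2 = |B| + m := Real.sq_sqrt (by positivity)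
  rcases le_total 0 B with hB | hB
  · rw [abs_of_nonneg hB] at *
    rcases le_total m B with h | h
    · have hp2 : √(B - m) ^ 2 = B - m := Real.sq_sqrt (by linarith)
      have : √(B - m) ≤ √(B + m) := Real.sqrt_le_sqrt (by linarith)
      nlinarith
    · nlinarith
  · rw [abs_of_nonpos hB] at *
    rcases le_total (B + m) 0 with h | h
    · rw [Real.sqrt_eq_zero_of_nonpos h]
      nlinarith
    · have hq2 : √(B + m) ^ 2 = B + m := Real.sq_sqrt h
      have h1 : (√(B + m) - √(B - m)) * √(-B + m) ≤ √(B + m) * √(-B + m) := by nlinarith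
      nlinarith [sq_nonneg (√(B + m) - √(-B + m))]

theorem meas_inner (lam : ℝ) : StronglyMeasurable (fun p : ℝ × ℝ =>
    (if -16 * (4 * p.1^3 + 27 * p.2^2) < lam then (1:ℝ) else 0)) := by
  apply Measurable.stronglyMeasurable
  apply Measurable.ite _ measurable_const measurable_const
  exact measurableSet_lt (by fun_prop) (by fun_prop)

theorem int_beta (lam α : ℝ) : IntervalIntegrable (fun β : ℝ =>
    (if -16 * (4 * α^3 + 27 * β^2) < lam then (1:ℝ) else 0)) volume (-1) 1 := by
  rw [intervalIntegrable_iff]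
  refine Measure.integrableOn_of_bounded (M := 1) (by simp) ?_ ?_
  · exact ((meas_inner lam).comp_measurable
      (measurable_const.prodMk measurable_id : Measurable (fun β : ℝ => (α, β)))).aestronglyMeasurable
  · refine Filter.Eventually.of_forall fun β => ?_
    split_ifs <;> simp

theorem int_alpha (lam : ℝ) : IntervalIntegrable (fun α : ℝ => ∫ β in (-1:ℝ)..1,
    (if -16 * (4 * α^3 + 27 * β^2) < lam then (1:ℝ) else 0)) volume (-1) 1 := by
  rw [intervalIntegrable_iff]
  refine Measure.integrableOn_of_bounded (M := 2) (by simp) ?_ ?_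
  · simp_rw [intervalIntegral.integral_of_le (show (-1:ℝ) ≤ 1 by norm_num)]
    exact ((meas_inner lam).integral_prod_right
      (ν := volume.restrict (Set.Ioc (-1:ℝ) 1))).aestronglyMeasurable
  · refine Filter.Eventually.of_forall fun α => ?_
    refine (intervalIntegral.norm_integral_le_of_norm_le_const (C := 1) ?_).trans ?_
    · intro β _
      split_ifs <;> simp
    · norm_num

theorem ind_int (a b : ℝ) (hab : a ≤ b) :
    IntervalIntegrable ((Set.Icc a b).indicator (fun _ => (1:ℝ))) volume (-1) 1 ∧
    ∫ x in (-1:ℝ)..1, (Set.Icc a b).indicator (fun _ => (1:ℝ)) x ≤ b - a := by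
  have hi : Integrable ((Set.Icc a b).indicator (fun _ => (1:ℝ))) volume := by
    rw [integrable_indicator_iff measurableSet_Icc]
    simp
  refine ⟨hi.intervalIntegrable, ?_⟩
  rw [intervalIntegral.integral_of_le (by norm_num)]
  refine (setIntegral_le_integral hi ?_).trans ?_
  · exact Filter.Eventually.of_forall fun x => Set.indicator_nonneg (by simp) x
  · rw [integral_indicator measurableSet_Icc]
    simp [hab]

theorem inner_bound (t α : ℝ) (ht : 0 < t) :
    (∫ β in (-1:ℝ)..1, (if -16 * (4 * α^3 + 27 * β^2) < t^6 then (1:ℝ) else 0)) -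
    (∫ β in (-1:ℝ)..1, (if -16 * (4 * α^3 + 27 * β^2) < -t^6 then (1:ℝ) else 0))
    ≤ 2 * t^6 * (√(|α| + t^2) ^ 3)⁻¹ := by
  have ht6 : 0 < t^6 := by positivity
  obtain ⟨B, hB⟩ : ∃ B, B = -(4 * α^3 / 27) := ⟨_, rfl⟩
  obtain ⟨m, hm⟩ : ∃ m, m = t^6 / 432 := ⟨_, rfl⟩
  have hm0 : 0 < m := by rw [hm]; positivity
  have hpq : √(B - m) ≤ √(B + m) := Real.sqrt_le_sqrt (by linarith)
  obtain ⟨i1, b1⟩ := ind_int _ _ hpq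
  obtain ⟨i2, b2⟩ := ind_int _ _ (neg_le_neg hpq)
  have hs : 0 < √(|α| + t^2) := by positivity
  have hs2 : √(|α| + t^2) ^ 2 = |α| + t^2 := Real.sq_sqrt (by positivity)
  have hgap : √(B + m) - √(B - m) ≤ t^6 * (√(|α| + t^2) ^ 3)⁻¹ := by
    have h := gap_bound B m hm0
    have habs : |B| = 4 * |α|^3 / 27 := by
      rw [hB, abs_neg, abs_div, abs_mul, abs_pow]; norm_num
    have hr : √(|α| + t^2) ^ 3 / 42 ≤ √(|B| + m) := by
      apply Real.le_sqrt_of_sq_le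
      have e : (√(|α| + t^2) ^ 3 / 42)^2 = (√(|α| + t^2) ^ 2)^3 / 1764 := by ring
      rw [e, hs2, habs, hm]
      have ha := abs_nonneg α
      have : (|α| + t^2)^3 ≤ 4 * (|α|^3 + (t^2)^3) := by
        nlinarith [mul_nonneg (add_nonneg ha (sq_nonneg t)) (sq_nonneg (|α| - t^2))]
      have e2 : (t^2)^3 = t^6 := by ring
      rw [e2] at this
      have : 0 ≤ |α|^3 := by positivity
      linarith
    have hd : 0 ≤ √(B + m) - √(B - m) := by linarith
    have := mul_le_mul_of_nonneg_left hr hd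
    rw [← div_eq_mul_inv, le_div_iff₀ (by positivity)]
    rw [hm] at this h ⊢
    linarith
  have key : (∫ β in (-1:ℝ)..1, (if -16 * (4 * α^3 + 27 * β^2) < t^6 then (1:ℝ) else 0)) -
    (∫ β in (-1:ℝ)..1, (if -16 * (4 * α^3 + 27 * β^2) < -t^6 then (1:ℝ) else 0)) ≤
    (∫ β in (-1:ℝ)..1, (Set.Icc (√(B - m)) (√(B + m))).indicator (fun _ => (1:ℝ)) β) +
    (∫ β in (-1:ℝ)..1, (Set.Icc (-√(B + m)) (-√(B - m))).indicator (fun _ => (1:ℝ)) β) := by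
    rw [← intervalIntegral.integral_sub (int_beta _ _) (int_beta _ _),
      ← intervalIntegral.integral_add i1 i2]
    apply intervalIntegral.integral_mono_on (by norm_num)
      ((int_beta _ _).sub (int_beta _ _)) (i1.add i2)
    intro β _
    have n1 : 0 ≤ (Set.Icc (√(B - m)) (√(B + m))).indicator (fun _ => (1:ℝ)) β :=
      Set.indicator_nonneg (by simp) _
    have n2 : 0 ≤ (Set.Icc (-√(B + m)) (-√(B - m))).indicator (fun _ => (1:ℝ)) β :=
      Set.indicator_nonneg (by simp) _
    by_cases c1 : -16 * (4 * α^3 + 27 * β^2) < t^6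
    · by_cases c2 : -16 * (4 * α^3 + 27 * β^2) < -t^6
      · rw [if_pos c1, if_pos c2]; linarith
      · rw [if_pos c1, if_neg c2]
        have l1 : √(B - m) ≤ |β| := by
          rw [← Real.sqrt_sq_eq_abs]; apply Real.sqrt_le_sqrt; rw [hB, hm]; linarith
        have l2 : |β| ≤ √(B + m) := by
          rw [← Real.sqrt_sq_eq_abs]; apply Real.sqrt_le_sqrt; rw [hB, hm]; linarith
        rcases abs_cases β with ⟨e, _⟩ | ⟨e, _⟩
        · rw [e] at l1 l2
          rw [Set.indicator_of_mem (Set.mem_Icc.2 ⟨l1, l2⟩)]; linarith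
        · rw [e] at l1 l2
          rw [Set.indicator_of_mem (s := Set.Icc (-√(B + m)) (-√(B - m)))
            (Set.mem_Icc.2 ⟨by linarith, by linarith⟩)]; linarith
    · rw [if_neg c1, if_neg (by linarith)]; linarith
  linarith

theorem cont_h (t : ℝ) (ht : 0 < t) : Continuous (fun α : ℝ => (√(|α| + t^2) ^ 3)⁻¹) := by
  apply Continuous.inv₀ (by fun_prop)
  intro x; positivity

theorem outer_bound (t : ℝ) (ht : 0 < t) :
    ∫ α in (-1:ℝ)..1, (√(|α| + t^2) ^ 3)⁻¹ ≤ 4 / t := by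
  have hc := cont_h t ht
  have h1 : ∫ α in (0:ℝ)..1, (√(|α| + t^2) ^ 3)⁻¹ ≤ 2 / t := by
    have : ∫ α in (0:ℝ)..1, (√(|α| + t^2) ^ 3)⁻¹ =
        (-2 * (√(1 + t^2))⁻¹) - (-2 * (√(0 + t^2))⁻¹) := by
      apply intervalIntegral.integral_eq_sub_of_hasDerivAt
        (f := fun x => -2 * (√(x + t^2))⁻¹) _ (hc.intervalIntegrable _ _)
      intro x hx
      rw [Set.uIcc_of_le (by norm_num)] at hx
      have hx0 := hx.1
      have hpos : 0 < x + t^2 := by positivity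
      have hs : √(x + t^2) ≠ 0 := by positivity
      have := (((((hasDerivAt_id x).add_const (t^2)).sqrt hpos.ne').inv hs).const_mul (-2))
      refine HasDerivAt.congr_deriv this ?_
      rw [abs_of_nonneg hx0]
      simp only [id]
      field_simp
    rw [this, zero_add, Real.sqrt_sq ht.le]
    have : 0 ≤ (√(1 + t^2))⁻¹ := by positivity
    rw [div_eq_mul_inv]; linarith
  have h2 : ∫ α in (-1:ℝ)..0, (√(|α| + t^2) ^ 3)⁻¹ = ∫ α in (0:ℝ)..1, (√(|α| + t^2) ^ 3)⁻¹ := by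
    have := intervalIntegral.integral_comp_neg (a := 0) (b := 1)
      (fun α : ℝ => (√(|α| + t^2) ^ 3)⁻¹)
    simp only [abs_neg, neg_zero] at this
    exact this.symm
  rw [← intervalIntegral.integral_add_adjacent_intervals (hc.intervalIntegrable (-1) 0)
    (hc.intervalIntegrable 0 1), h2]
  have : 4 / t = 2 / t + 2 / t := by ring
  linarith

theorem stmt11 :
    ∃ C : ℝ, 0 < C ∧ ∀ lam : ℝ, 0 < lam →
      FDelta lam - FDelta (-lam) ≤ C * lam ^ ((5:ℝ)/6) := by
  refine ⟨2, by norm_num, fun lam hl => ?_⟩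
  obtain ⟨t, ht⟩ : ∃ t, t = lam ^ ((1:ℝ)/6) := ⟨_, rfl⟩
  have ht0 : 0 < t := by rw [ht]; positivity
  have e6 : lam = t^6 := by
    rw [ht, ← Real.rpow_natCast, ← Real.rpow_mul hl.le]; norm_num
  have e5 : lam ^ ((5:ℝ)/6) = t^5 := by
    rw [ht, ← Real.rpow_natCast, ← Real.rpow_mul hl.le]; norm_num
  rw [e5, e6]
  unfold FDelta
  rw [← mul_sub, ← intervalIntegral.integral_sub (int_alpha _) (int_alpha _)]
  have h := intervalIntegral.integral_mono_on (by norm_num)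
    ((int_alpha (t^6)).sub (int_alpha (-t^6)))
    (((cont_h t ht0).const_mul (2 * t^6)).intervalIntegrable (-1) 1)
    (fun α _ => inner_bound t α ht0)
  rw [intervalIntegral.integral_const_mul] at h
  have h2 := mul_le_mul_of_nonneg_left (outer_bound t ht0) (show 0 ≤ 2 * t^6 by positivity)
  have e : 2 * t^6 * (4 / t) = 8 * t^5 := by field_simp; ring
  rw [e] at h2
  linarith
end

section
/- There is an absolute constant C > 0 such that for every real λ > 0, (228811·π⁸/2380855680)·∑_{m=1}^∞ (F_Δ(mλ) − F_Δ(−mλ))·ρ(2,m)·ρ(3,m)·∏_{p ≥ 5 prime, p ∣ m} ρ(p,m)/(1 − p^{−2}) ≤ C·λ^{5/6}; in particular the series converges. -/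
lemma rho_five (p m : ℕ) (hp : 5 ≤ p) (hn : m.factorization p ≠ 0) :
    ∃ c : ℝ, 0 ≤ c ∧ c ≤ 3 ∧
      rho p m = ((p:ℝ)⁻¹)^(m.factorization p + 1) * ((1 - (p:ℝ)⁻¹) * c) := by
  have hp5 : (5:ℝ) ≤ p := by exact_mod_cast hp
  have hq0 : 0 < (p:ℝ)⁻¹ := by positivity
  have hq1 : (p:ℝ)⁻¹ ≤ 1 := inv_le_one_of_one_le₀ (by linarith)
  have h3 : p ≠ 3 := by omega
  have h2 : p ≠ 2 := by omega
  unfold rho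
  simp only [h3, h2, hn, if_false]
  generalize m.factorization p = n at *
  generalize (p:ℝ)⁻¹ = q at *
  split_ifs with h1 h2 h3 h4 h5 h6
  · exact ⟨1, by norm_num, by norm_num, by subst h1; ring⟩
  · exact ⟨1, by norm_num, by norm_num, by subst h2; ring⟩
  · exact ⟨1 - q, by linarith, by linarith, by subst h3; ring⟩
  · exact ⟨2 - q, by linarith, by linarith, by subst h4; ring⟩
  · exact ⟨2 - 2*q, by linarith, by linarith, by subst h5; ring⟩
  · exact ⟨3 - 2*q, by linarith, by linarith, by ring⟩
  · exact ⟨2 - 2*q, by linarith, by linarith, by ring⟩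

lemma rho_five_bd (p m : ℕ) (hp : 5 ≤ p) (hn : m.factorization p ≠ 0) :
    0 ≤ rho p m / (1 - ((p:ℝ)⁻¹)^2) ∧
    rho p m / (1 - ((p:ℝ)⁻¹)^2) ≤ 3 * ((p:ℝ)⁻¹)^(m.factorization p + 1) := by
  obtain ⟨c, hc0, hc3, h⟩ := rho_five p m hp hn
  have hp5 : (5:ℝ) ≤ p := by exact_mod_cast hp
  have hq0 : 0 < (p:ℝ)⁻¹ := by positivity
  have hq1 : (p:ℝ)⁻¹ ≤ 1/5 := by
    rw [one_div]; exact inv_anti₀ (by norm_num) hp5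
  rw [h]
  generalize m.factorization p = n at *
  generalize (p:ℝ)⁻¹ = q at *
  have hd : 0 < 1 - q^2 := by nlinarith
  have hd1 : 0 ≤ 1 - q := by linarith
  refine ⟨by positivity, ?_⟩
  rw [div_le_iff₀ hd]
  have : (1 - q) * c ≤ 3 * (1 - q^2) := by nlinarith
  calc _ ≤ q^(n+1) * (3 * (1 - q^2)) := by gcongr
    _ = _ := by ring

/-- the weight -/
noncomputable def wt (m : ℕ) : ℝ := rho 2 m * rho 3 m *
            ∏ p ∈ m.primeFactors.filter (fun p => 5 ≤ p),
              rho p m / (1 - ((p : ℝ)⁻¹)^2)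

lemma rho2_nonneg (m : ℕ) : 0 ≤ rho 2 m := by
  unfold rho; simp only [show (2:ℕ) ≠ 3 by norm_num, if_false, if_true]
  split_ifs <;> norm_num

lemma rho3_nonneg (m : ℕ) : 0 ≤ rho 3 m := by
  unfold rho; simp only [if_true]
  split_ifs <;> norm_num

lemma fac_ne (m p : ℕ) (hp : p ∈ m.primeFactors) : m.factorization p ≠ 0 := by
  rw [← Finsupp.mem_support_iff, Nat.support_factorization]; exact hp

lemma wt_nonneg (m : ℕ) : 0 ≤ wt m := by
  unfold wt
  refine mul_nonneg (mul_nonneg (rho2_nonneg m) (rho3_nonneg m)) (Finset.prod_nonneg ?_)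
  intro p hp
  rw [Finset.mem_filter] at hp
  exact (rho_five_bd p m hp.2 (fac_ne m p hp.1)).1

lemma wt_le (m : ℕ) (hm : m ≠ 0) :
    wt m ≤ ∏ p ∈ m.primeFactors, 3 * ((p:ℝ)⁻¹)^(m.factorization p + 1) := by
  have h5 : ∏ p ∈ m.primeFactors.filter (fun p => 5 ≤ p), rho p m / (1 - ((p : ℝ)⁻¹)^2)
      ≤ ∏ p ∈ m.primeFactors.filter (fun p => 5 ≤ p), 3 * ((p:ℝ)⁻¹)^(m.factorization p + 1) := by
    refine Finset.prod_le_prod ?_ ?_ <;> intro p hp <;> rw [Finset.mem_filter] at hp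
    · exact (rho_five_bd p m hp.2 (fac_ne m p hp.1)).1
    · exact (rho_five_bd p m hp.2 (fac_ne m p hp.1)).2
  rw [← Finset.prod_filter_mul_prod_filter_not m.primeFactors (fun p => 5 ≤ p), mul_comm]
  have hnn : 0 ≤ ∏ p ∈ m.primeFactors.filter (fun p => ¬ 5 ≤ p),
      3 * ((p:ℝ)⁻¹)^(m.factorization p + 1) := Finset.prod_nonneg (fun p _ => by positivity)
  unfold wt
  refine mul_le_mul ?_ h5 (Finset.prod_nonneg ?_) hnn
  swap
  · intro p hp; rw [Finset.mem_filter] at hp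
    exact (rho_five_bd p m hp.2 (fac_ne m p hp.1)).1
  by_cases h3 : m.factorization 3 = 0
  swap
  · have : rho 3 m = 0 := by unfold rho; simp [h3]
    rw [this, mul_zero]; exact hnn
  have hr3 : rho 3 m = 1 := by unfold rho; simp [h3]
  have h3' : 3 ∉ m.primeFactors := fun h => fac_ne m 3 h h3
  rw [hr3, mul_one]
  have hsub : ∀ p ∈ m.primeFactors.filter (fun p => ¬ 5 ≤ p), p = 2 := by
    intro p hp
    rw [Finset.mem_filter] at hp
    have hpp := Nat.prime_of_mem_primeFactors hp.1
    have h5 : p < 5 := by omega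
    interval_cases p
    · exact absurd hpp (by norm_num)
    · exact absurd hpp (by norm_num)
    · rfl
    · exact absurd hp.1 h3'
    · exact absurd hpp (by norm_num)
  by_cases h2 : m.factorization 2 = 0
  · have h2' : 2 ∉ m.primeFactors := fun h => fac_ne m 2 h h2
    have : m.primeFactors.filter (fun p => ¬ 5 ≤ p) = ∅ := by
      rw [Finset.eq_empty_iff_forall_notMem]
      intro p hp
      have := hsub p hp
      subst this
      exact h2' (Finset.mem_filter.1 hp).1
    rw [this, Finset.prod_empty]
    unfold rho; simp [h2]; norm_num
  · have h2' : 2 ∈ m.primeFactors := by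
      rw [← Nat.support_factorization, Finsupp.mem_support_iff]; exact h2
    have : m.primeFactors.filter (fun p => ¬ 5 ≤ p) = {2} := by
      ext p
      rw [Finset.mem_singleton]
      refine ⟨hsub p, ?_⟩
      rintro rfl
      rw [Finset.mem_filter]; exact ⟨h2', by norm_num⟩
    rw [this, Finset.prod_singleton]
    unfold rho; simp only [show (2:ℕ) ≠ 3 by norm_num, h2, if_false, if_true]
    split_ifs with h
    · have : m.factorization 2 = 1 ∨ m.factorization 2 = 2 := by omega
      rcases this with h | h <;> rw [h] <;> norm_num
    · positivity

/-- multiplicative majorant -/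
noncomputable def maj (m : ℕ) : ℝ := (m:ℝ)^(-(1/6:ℝ)) * ∏ p ∈ m.primeFactors, 3 * (p:ℝ)⁻¹

lemma maj_nonneg (m : ℕ) : 0 ≤ maj m := by
  unfold maj
  exact mul_nonneg (by positivity) (Finset.prod_nonneg fun p _ => by positivity)

lemma wt_maj (m : ℕ) (hm : m ≠ 0) : (m:ℝ)^(5/6:ℝ) * wt m ≤ maj m := by
  have h : ∏ p ∈ m.primeFactors, 3 * ((p:ℝ)⁻¹)^(m.factorization p + 1)
      = (m:ℝ)⁻¹ * ∏ p ∈ m.primeFactors, 3 * (p:ℝ)⁻¹ := by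
    have e : (m:ℝ)⁻¹ = ∏ p ∈ m.primeFactors, ((p:ℝ)⁻¹)^(m.factorization p) := by
      have := Nat.prod_primeFactors_pow_factorization hm
      conv_lhs => rw [this]
      push_cast
      rw [← Finset.prod_inv_distrib]
      simp
    rw [e, ← Finset.prod_mul_distrib]
    exact Finset.prod_congr rfl fun p _ => by ring
  have hm' : (0:ℝ) < m := by positivity
  calc _ ≤ (m:ℝ)^(5/6:ℝ) * ((m:ℝ)⁻¹ * ∏ p ∈ m.primeFactors, 3 * (p:ℝ)⁻¹) := by
        rw [← h]; gcongr; exact wt_le m hm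
    _ = _ := by
        unfold maj
        rw [← mul_assoc, ← Real.rpow_neg_one, ← Real.rpow_add hm']; norm_num

lemma maj_mul {a b : ℕ} (h : Nat.Coprime a b) : maj (a * b) = maj a * maj b := by
  unfold maj
  rw [h.primeFactors_mul, Finset.prod_union h.disjoint_primeFactors]
  push_cast
  rw [Real.mul_rpow (by positivity) (by positivity)]
  ring

lemma maj_pow (p n : ℕ) (hp : p.Prime) :
    maj (p^(n+1)) = 3 * (p:ℝ)⁻¹ * ((p:ℝ)^(-(1/6:ℝ)))^(n+1) := by
  unfold maj
  rw [Nat.primeFactors_prime_pow (by omega) hp, Finset.prod_singleton]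
  push_cast
  rw [← Real.rpow_natCast, ← Real.rpow_natCast, ← Real.rpow_mul (by positivity),
    ← Real.rpow_mul (by positivity), mul_comm (((n+1 : ℕ):ℝ)) _]
  ring

lemma r_lt (p : ℕ) (hp : p.Prime) : (p:ℝ)^(-(1/6:ℝ)) ≤ (2:ℝ)^(-(1/6:ℝ)) := by
  have : (2:ℝ) ≤ p := by exact_mod_cast hp.two_le
  exact Real.rpow_le_rpow_of_nonpos (by norm_num) this (by norm_num)

lemma r2_lt : (2:ℝ)^(-(1/6:ℝ)) < 1 :=
  Real.rpow_lt_one_of_one_lt_of_neg (by norm_num) (by norm_num)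

lemma maj_hasSum (p : ℕ) (hp : p.Prime) : HasSum (fun n => maj (p^n))
    (1 + 3 * (p:ℝ)⁻¹ * (p:ℝ)^(-(1/6:ℝ)) * (1 - (p:ℝ)^(-(1/6:ℝ)))⁻¹) := by
  have h1 : (p:ℝ)^(-(1/6:ℝ)) < 1 := (r_lt p hp).trans_lt r2_lt
  have hg := (hasSum_geometric_of_lt_one (by positivity) h1).mul_left
    (3 * (p:ℝ)⁻¹ * (p:ℝ)^(-(1/6:ℝ)))
  rw [← hasSum_nat_add_iff' 1]
  simp only [Finset.range_one, Finset.sum_singleton, pow_zero]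
  have : maj 1 = 1 := by simp [maj]
  rw [this, add_sub_cancel_left]
  refine hg.congr_fun ?_ |> fun h => h
  intro n
  rw [maj_pow p n hp]; ring

lemma maj_summable : Summable maj := by
  have hS : Summable (fun n : ℕ => (n:ℝ)^(-(7/6:ℝ))) :=
    Real.summable_nat_rpow.2 (by norm_num)
  set D : ℝ := 3 * (1 - (2:ℝ)^(-(1/6:ℝ)))⁻¹ with hD
  have hDpos : 0 ≤ D := by have := r2_lt; rw [hD]; apply mul_nonneg (by norm_num); rw [inv_nonneg]; linarith
  refine summable_of_sum_range_le (c := Real.exp (∑' n : ℕ, D * (n:ℝ)^(-(7/6:ℝ)))) maj_nonneg ?_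
  intro N
  obtain ⟨hs, hh⟩ := EulerProduct.summable_and_hasSum_smoothNumbers_prod_primesBelow_tsum
    (f := maj) (by simp [maj]) (fun {a b} h => maj_mul h) (fun {p} hp => (maj_hasSum p hp).summable.norm) N
  have h1 : ∑ i ∈ Finset.range N, maj i ≤ ∏ p ∈ N.primesBelow, ∑' n, maj (p^n) := by
    rw [← hh.tsum_eq]
    have hs' : Summable (fun x : N.smoothNumbers => maj x) := hh.summable
    rw [tsum_subtype (N.smoothNumbers) maj]
    have hs2 : Summable (Set.indicator N.smoothNumbers maj) := by
      rwa [← summable_subtype_iff_indicator]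
    refine le_trans (le_of_eq ?_) (hs2.sum_le_tsum (Finset.range N) fun i _ =>
      Set.indicator_nonneg (fun _ _ => maj_nonneg _) i)
    refine Finset.sum_congr rfl fun i hi => ?_
    rcases Nat.eq_zero_or_pos i with rfl | h0
    · rw [Set.indicator_apply]; split_ifs <;> simp [maj]
    · rw [Set.indicator_of_mem]
      exact Nat.mem_smoothNumbers_of_lt h0 (Finset.mem_range.1 hi)
  refine h1.trans ?_
  have h2 : ∏ p ∈ N.primesBelow, ∑' n, maj (p^n) ≤
      ∏ p ∈ N.primesBelow, Real.exp (D * (p:ℝ)^(-(7/6:ℝ))) := by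
    refine Finset.prod_le_prod (fun p _ => tsum_nonneg fun n => maj_nonneg _) ?_
    intro p hp
    have hp := Nat.prime_of_mem_primesBelow hp
    rw [(maj_hasSum p hp).tsum_eq]
    have hp0 : (0:ℝ) < p := by exact_mod_cast hp.pos
    have e : (p:ℝ)^(-(7/6:ℝ)) = (p:ℝ)⁻¹ * (p:ℝ)^(-(1/6:ℝ)) := by
      rw [← Real.rpow_neg_one, ← Real.rpow_add hp0]; norm_num
    have hi : (1 - (p:ℝ)^(-(1/6:ℝ)))⁻¹ ≤ (1 - (2:ℝ)^(-(1/6:ℝ)))⁻¹ := by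
      apply inv_anti₀
      · linarith [r2_lt]
      · linarith [r_lt p hp]
    have : 3 * (p:ℝ)⁻¹ * (p:ℝ)^(-(1/6:ℝ)) * (1 - (p:ℝ)^(-(1/6:ℝ)))⁻¹ ≤ D * (p:ℝ)^(-(7/6:ℝ)) := by
      calc _ ≤ 3 * (p:ℝ)⁻¹ * (p:ℝ)^(-(1/6:ℝ)) * (1 - (2:ℝ)^(-(1/6:ℝ)))⁻¹ := by gcongr
        _ = _ := by rw [e, hD]; ring
    linarith [Real.add_one_le_exp (D * (p:ℝ)^(-(7/6:ℝ)))]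
  refine h2.trans ?_
  rw [← Real.exp_sum]
  apply Real.exp_le_exp.2
  exact (hS.mul_left D).sum_le_tsum _ fun i _ => by positivity

open MeasureTheory

noncomputable def ff (x α β : ℝ) : ℝ :=
  if -16 * (4 * α^3 + 27 * β^2) < x then (1:ℝ) else 0

lemma ff_meas (x : ℝ) : StronglyMeasurable (fun z : ℝ × ℝ => ff x z.1 z.2) := by
  apply Measurable.stronglyMeasurable
  unfold ff
  refine Measurable.ite ?_ measurable_const measurable_const
  exact measurableSet_lt (by fun_prop) measurable_const

lemma ff_nonneg (x α β : ℝ) : 0 ≤ ff x α β := by unfold ff; split_ifs <;> norm_num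
lemma ff_le (x α β : ℝ) : ff x α β ≤ 1 := by unfold ff; split_ifs <;> norm_num

lemma ff_int (x α : ℝ) : Integrable (ff x α) (volume.restrict (Set.Ioc (-1) 1)) := by
  refine Integrable.of_bound (C := 1) ?_ ?_
  · exact ((ff_meas x).comp_measurable (measurable_const.prodMk measurable_id)).aestronglyMeasurable
  · exact Filter.Eventually.of_forall fun β => by
      rw [Real.norm_eq_abs, abs_of_nonneg (ff_nonneg _ _ _)]; exact ff_le _ _ _

lemma ff_int2 (x : ℝ) : Integrable (fun α => ∫ β in Set.Ioc (-1) 1, ff x α β)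
    (volume.restrict (Set.Ioc (-1) 1)) := by
  refine Integrable.of_bound (C := 2) ?_ ?_
  · exact ((ff_meas x).integral_prod_right (ν := volume.restrict (Set.Ioc (-1) 1))).aestronglyMeasurable
  · refine Filter.Eventually.of_forall fun α => ?_
    have := norm_integral_le_of_norm_le_const (μ := volume.restrict (Set.Ioc (-1:ℝ) 1)) (f := ff x α) (C := 1)
      (Filter.Eventually.of_forall fun β => by
      rw [Real.norm_eq_abs, abs_of_nonneg (ff_nonneg _ _ _)]; exact ff_le _ _ _)
    refine this.trans ?_
    simp [Measure.real]
    norm_num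

lemma FD_eq (x : ℝ) : FDelta x = (1/4) * ∫ α in Set.Ioc (-1:ℝ) 1, ∫ β in Set.Ioc (-1:ℝ) 1, ff x α β := by
  unfold FDelta ff
  rw [intervalIntegral.integral_of_le (by norm_num)]
  congr 2
  ext α
  rw [intervalIntegral.integral_of_le (by norm_num)]

lemma FD_sub (x : ℝ) : FDelta x - FDelta (-x) = (1/4) * ∫ α in Set.Ioc (-1:ℝ) 1,
    ∫ β in Set.Ioc (-1:ℝ) 1, (ff x α β - ff (-x) α β) := by
  rw [FD_eq, FD_eq, ← mul_sub, ← integral_sub (ff_int2 x) (ff_int2 (-x))]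
  congr 2
  ext α
  rw [integral_sub (ff_int x α) (ff_int (-x) α)]

lemma ff_mono (x : ℝ) (hx : 0 ≤ x) (α β : ℝ) : 0 ≤ ff x α β - ff (-x) α β := by
  unfold ff
  split_ifs <;> linarith

lemma FD_sub_nonneg (x : ℝ) (hx : 0 ≤ x) : 0 ≤ FDelta x - FDelta (-x) := by
  rw [FD_sub]
  refine mul_nonneg (by norm_num) (integral_nonneg fun α => integral_nonneg fun β => ff_mono x hx α β)

lemma inner_bd (y α : ℝ) (hy : 0 < y) :
    ∫ β in Set.Ioc (-1:ℝ) 1, (ff (16*y) α β - ff (-(16*y)) α β) ≤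
      2 * (Real.sqrt ((y - 4*α^3)/27) - Real.sqrt ((-y - 4*α^3)/27)) := by
  set p := Real.sqrt ((-y - 4*α^3)/27) with hp
  set q := Real.sqrt ((y - 4*α^3)/27) with hq
  have hpq : p ≤ q := Real.sqrt_le_sqrt (by linarith)
  have hI : ∀ a b : ℝ, Integrable ((Set.Icc a b).indicator (fun _ => (1:ℝ))) := fun a b =>
    (integrable_indicator_iff measurableSet_Icc).2 (integrableOn_const (by simp) (by simp))
  have hpt : ∀ β, ff (16*y) α β - ff (-(16*y)) α β ≤
      (Set.Icc p q).indicator (fun _ => (1:ℝ)) β + (Set.Icc (-q) (-p)).indicator (fun _ => (1:ℝ)) β := by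
    intro β
    have n1 : 0 ≤ (Set.Icc p q).indicator (fun _ => (1:ℝ)) β :=
      Set.indicator_nonneg (fun _ _ => zero_le_one) _
    have n2 : 0 ≤ (Set.Icc (-q) (-p)).indicator (fun _ => (1:ℝ)) β :=
      Set.indicator_nonneg (fun _ _ => zero_le_one) _
    by_cases h : -16 * (4 * α^3 + 27 * β^2) < 16*y ∧ ¬ (-16 * (4 * α^3 + 27 * β^2) < -(16*y))
    · have h1 : ff (16*y) α β - ff (-(16*y)) α β = 1 := by unfold ff; rw [if_pos h.1, if_neg h.2]; norm_num
      rw [h1]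
      have ha : |β| ≤ q := Real.abs_le_sqrt (by linarith [h.2])
      have hb : p ≤ |β| := by
        rw [← Real.sqrt_sq_eq_abs]; exact Real.sqrt_le_sqrt (by linarith [h.1])
      rcases le_total 0 β with hβ | hβ
      · rw [abs_of_nonneg hβ] at ha hb
        rw [Set.indicator_of_mem (show β ∈ Set.Icc p q from ⟨hb, ha⟩)]; linarith
      · rw [abs_of_nonpos hβ] at ha hb
        rw [Set.indicator_of_mem (show β ∈ Set.Icc (-q) (-p) from ⟨by linarith, by linarith⟩)]; linarith
    · have : ff (16*y) α β - ff (-(16*y)) α β ≤ 0 := by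
        unfold ff
        split_ifs with h1 h2
        · norm_num
        · exact absurd ⟨h1, h2⟩ h
        · norm_num
        · norm_num
      linarith
  calc _ ≤ ∫ β in Set.Ioc (-1:ℝ) 1, ((Set.Icc p q).indicator (fun _ => (1:ℝ)) β + (Set.Icc (-q) (-p)).indicator (fun _ => (1:ℝ)) β) :=
        integral_mono ((ff_int _ α).sub (ff_int _ α)) ((hI _ _).add (hI _ _)).restrict hpt
    _ ≤ ∫ β, ((Set.Icc p q).indicator (fun _ => (1:ℝ)) β + (Set.Icc (-q) (-p)).indicator (fun _ => (1:ℝ)) β) := by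
        refine setIntegral_le_integral ((hI _ _).add (hI _ _)) (Filter.Eventually.of_forall fun β => ?_)
        exact add_nonneg (Set.indicator_nonneg (fun _ _ => zero_le_one) _) (Set.indicator_nonneg (fun _ _ => zero_le_one) _)
    _ = 2 * (q - p) := by
        rw [integral_add (hI _ _) (hI _ _), integral_indicator measurableSet_Icc, integral_indicator measurableSet_Icc]
        simp [Measure.real]
        rw [ENNReal.toReal_ofReal (by linarith), ENNReal.toReal_ofReal (by linarith)]; ring

lemma sqrt_bd (t : ℝ) : Real.sqrt (1 - 4*t^3) - Real.sqrt (-1 - 4*t^3) ≤ 8 * (1 + ‖t‖)^(-(3/2:ℝ)) := by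
  rw [Real.norm_eq_abs]
  have hpos : 0 < 1 + |t| := by positivity
  have hr : 0 ≤ 8 * (1 + |t|)^(-(3/2:ℝ)) := by positivity
  -- value of the power as an inverse square root
  have hpow : (1 + |t|)^(-(3/2:ℝ)) = (Real.sqrt ((1+|t|)^3))⁻¹ := by
    rw [Real.rpow_neg hpos.le, Real.sqrt_eq_rpow, ← Real.rpow_natCast, ← Real.rpow_mul hpos.le]
    norm_num
  rcases le_or_gt t 1 with h1 | h1
  swap
  · have : 1 ≤ t^3 := one_le_pow₀ h1.le
    rw [Real.sqrt_eq_zero_of_nonpos (by linarith), Real.sqrt_eq_zero_of_nonpos (by linarith)]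
    linarith
  rw [hpow, ← div_eq_mul_inv]
  have hs : 0 < Real.sqrt ((1+|t|)^3) := Real.sqrt_pos.2 (by positivity)
  rw [le_div_iff₀ hs]
  rcases le_or_gt (-1) t with h2 | h2
  · have ht : |t| ≤ 1 := abs_le.2 ⟨h2, h1⟩
    have ha : Real.sqrt (1 - 4*t^3) ≤ Real.sqrt 5 := by
      apply Real.sqrt_le_sqrt
      have h3 : |t^3| ≤ 1 := by rw [abs_pow]; exact pow_le_one₀ (abs_nonneg _) ht
      linarith [(abs_le.1 h3).1]
    have hb : Real.sqrt ((1+|t|)^3) ≤ Real.sqrt 8 := by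
      apply Real.sqrt_le_sqrt
      calc (1+|t|)^3 ≤ (1+1)^3 := by gcongr
        _ = 8 := by norm_num
    calc _ ≤ Real.sqrt 5 * Real.sqrt 8 := by
          apply mul_le_mul _ hb hs.le (by positivity)
          linarith [Real.sqrt_nonneg (-1 - 4*t^3)]
      _ = Real.sqrt 40 := by rw [← Real.sqrt_mul (by norm_num)]; norm_num
      _ ≤ 8 := by rw [Real.sqrt_le_left (by norm_num)]; norm_num
  · obtain ⟨u, rfl⟩ : ∃ u, t = -u := ⟨-t, by ring⟩
    have hu : 1 < u := by linarith
    rw [abs_neg, abs_of_pos (by linarith)] at *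
    have hu3 : 1 ≤ u^3 := one_le_pow₀ hu.le
    set P := Real.sqrt (1 - 4 * (-u)^3) with hP
    set Q := Real.sqrt (-1 - 4 * (-u)^3) with hQ
    have hP2 : P^2 = 1 + 4*u^3 := by rw [hP, Real.sq_sqrt] <;> [ring; (ring_nf; positivity)]
    have hQ2 : Q^2 = -1 + 4*u^3 := by rw [hQ, Real.sq_sqrt] <;> [ring; (ring_nf; linarith)]
    have hQ0 : 0 ≤ Q := Real.sqrt_nonneg _
    have hP0 : 0 < P := Real.sqrt_pos.2 (by ring_nf; positivity)
    have hQP : Q ≤ P := by nlinarith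
    -- the root of (1+u)^3 is at most 2 P
    have hR : Real.sqrt ((1+u)^3) ≤ 2 * P := by
      rw [Real.sqrt_le_left (by positivity), mul_pow, hP2]
      calc (1+u)^3 ≤ (u+u)^3 := by gcongr
        _ ≤ _ := by nlinarith
    have : (P - Q) * P ≤ 2 := by nlinarith
    calc _ ≤ (P - Q) * (2*P) := mul_le_mul_of_nonneg_left hR (by linarith)
      _ ≤ 8 := by linarith

lemma FD_bd : ∃ K : ℝ, 0 ≤ K ∧ ∀ x : ℝ, 0 < x → FDelta x - FDelta (-x) ≤ K * x^(5/6:ℝ) := by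
  set h : ℝ → ℝ := fun t => (1 + ‖t‖)^(-(3/2:ℝ)) with hh
  have hIntg : Integrable h := by
    apply integrable_one_add_norm
    simp; norm_num
  have hn : ∀ t, 0 ≤ h t := fun t => by rw [hh]; positivity
  refine ⟨4 * ∫ t, h t, mul_nonneg (by norm_num) (integral_nonneg hn), ?_⟩
  intro x hx
  obtain ⟨y, rfl⟩ : ∃ y, x = 16*y := ⟨x/16, by ring⟩
  have hy : 0 < y := by linarith
  set s : ℝ := y^(1/3:ℝ) with hs
  have hs0 : 0 < s := by positivity
  have hs3 : s^3 = y := by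
    rw [hs, ← Real.rpow_natCast, ← Real.rpow_mul hy.le]; norm_num
  have hpt : ∀ α, ∫ β in Set.Ioc (-1:ℝ) 1, (ff (16*y) α β - ff (-(16*y)) α β) ≤
      16 * Real.sqrt y * h (α / s) := by
    intro α
    refine (inner_bd y α hy).trans ?_
    have e1 : Real.sqrt ((y - 4*α^3)/27) = Real.sqrt (y/27) * Real.sqrt (1 - 4*(α/s)^3) := by
      rw [← Real.sqrt_mul (by positivity)]; congr 1; rw [div_pow, hs3]; field_simp
    have e2 : Real.sqrt ((-y - 4*α^3)/27) = Real.sqrt (y/27) * Real.sqrt (-1 - 4*(α/s)^3) := by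
      rw [← Real.sqrt_mul (by positivity)]; congr 1; rw [div_pow, hs3]; field_simp
    rw [e1, e2, ← mul_sub]
    have l1 : Real.sqrt (y/27) ≤ Real.sqrt y := Real.sqrt_le_sqrt (by linarith)
    have l2 := sqrt_bd (α/s)
    calc _ ≤ 2 * (Real.sqrt (y/27) * (8 * h (α/s))) := by gcongr
      _ ≤ 2 * (Real.sqrt y * (8 * h (α/s))) := by
          have := hn (α/s)
          gcongr
      _ = _ := by ring
  have hi2 : Integrable (fun α => 16 * Real.sqrt y * h (α / s)) :=
    (hIntg.comp_div hs0.ne').const_mul _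
  rw [FD_sub]
  have hI : Integrable (fun α => ∫ β in Set.Ioc (-1:ℝ) 1, (ff (16*y) α β - ff (-(16*y)) α β))
      (volume.restrict (Set.Ioc (-1) 1)) := by
    refine ((ff_int2 (16*y)).sub (ff_int2 (-(16*y)))).congr (Filter.Eventually.of_forall fun α => ?_)
    exact (integral_sub (ff_int _ α) (ff_int _ α)).symm
  have hH : 0 ≤ ∫ t, h t := integral_nonneg hn
  have hfin : ∫ α in Set.Ioc (-1:ℝ) 1, ∫ β in Set.Ioc (-1:ℝ) 1, (ff (16*y) α β - ff (-(16*y)) α β)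
      ≤ 16 * Real.sqrt y * (s * ∫ t, h t) := by
    calc _ ≤ ∫ α in Set.Ioc (-1:ℝ) 1, 16 * Real.sqrt y * h (α / s) :=
          integral_mono hI hi2.restrict hpt
      _ ≤ ∫ α, 16 * Real.sqrt y * h (α / s) :=
          setIntegral_le_integral hi2 (Filter.Eventually.of_forall fun α =>
            mul_nonneg (by positivity) (hn _))
      _ = _ := by
          rw [integral_const_mul, Measure.integral_comp_div h s, abs_of_pos hs0, smul_eq_mul]
  have e : Real.sqrt y * s = y^(5/6:ℝ) := by
    rw [hs, Real.sqrt_eq_rpow, ← Real.rpow_add hy]; norm_num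
  have hle : y^(5/6:ℝ) ≤ (16*y)^(5/6:ℝ) := Real.rpow_le_rpow hy.le (by linarith) (by norm_num)
  calc _ ≤ (1/4) * (16 * Real.sqrt y * (s * ∫ t, h t)) := by gcongr
    _ = 4 * (∫ t, h t) * (Real.sqrt y * s) := by ring
    _ ≤ _ := by rw [e]; gcongr

theorem stmt12 :
    ∃ C : ℝ, 0 < C ∧ ∀ lam : ℝ, 0 < lam →
      Summable (fun m : ℕ =>
        (FDelta (((m : ℝ) + 1) * lam) - FDelta (-(((m : ℝ) + 1) * lam))) *
          (rho 2 (m + 1) * rho 3 (m + 1) *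
            ∏ p ∈ (m + 1).primeFactors.filter (fun p => 5 ≤ p),
              rho p (m + 1) / (1 - ((p : ℝ)⁻¹)^2))) ∧
      (228811 * Real.pi^8 / 2380855680) *
          ∑' m : ℕ,
            (FDelta (((m : ℝ) + 1) * lam) - FDelta (-(((m : ℝ) + 1) * lam))) *
              (rho 2 (m + 1) * rho 3 (m + 1) *
                ∏ p ∈ (m + 1).primeFactors.filter (fun p => 5 ≤ p),
                  rho p (m + 1) / (1 - ((p : ℝ)⁻¹)^2))
        ≤ C * lam ^ ((5:ℝ)/6) := by
  obtain ⟨K, hK0, hK⟩ := FD_bd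
  have hM : Summable (fun m : ℕ => maj (m+1)) := (summable_nat_add_iff 1).2 maj_summable
  set c : ℝ := 228811 * Real.pi^8 / 2380855680 with hc
  have hc0 : 0 < c := by positivity
  have hT : 0 ≤ ∑' m : ℕ, maj (m+1) := tsum_nonneg fun m => maj_nonneg _
  refine ⟨c * (K * ∑' m : ℕ, maj (m+1)) + 1, by positivity, ?_⟩
  intro lam hl
  change Summable (fun m : ℕ => (FDelta (((m : ℝ) + 1) * lam) - FDelta (-(((m : ℝ) + 1) * lam))) * wt (m+1)) ∧
    c * ∑' m : ℕ, (FDelta (((m : ℝ) + 1) * lam) - FDelta (-(((m : ℝ) + 1) * lam))) * wt (m+1) ≤ _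
  have hle : ∀ m : ℕ, (FDelta (((m : ℝ) + 1) * lam) - FDelta (-(((m : ℝ) + 1) * lam))) * wt (m+1)
      ≤ K * lam^(5/6:ℝ) * maj (m+1) := by
    intro m
    have h1 := hK (((m:ℝ)+1)*lam) (by positivity)
    have h2 := wt_maj (m+1) (by omega)
    have h3 := wt_nonneg (m+1)
    push_cast at h2
    rw [Real.mul_rpow (by positivity) hl.le] at h1
    calc _ ≤ (K * (((m:ℝ)+1)^(5/6:ℝ) * lam^(5/6:ℝ))) * wt (m+1) := by gcongr
      _ = K * lam^(5/6:ℝ) * (((m:ℝ)+1)^(5/6:ℝ) * wt (m+1)) := by ring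
      _ ≤ _ := by gcongr
  have hnn : ∀ m : ℕ, 0 ≤ (FDelta (((m : ℝ) + 1) * lam) - FDelta (-(((m : ℝ) + 1) * lam))) * wt (m+1) :=
    fun m => mul_nonneg (FD_sub_nonneg _ (by positivity)) (wt_nonneg _)
  have hR : Summable (fun m : ℕ => K * lam^(5/6:ℝ) * maj (m+1)) := hM.mul_left _
  have hS := Summable.of_nonneg_of_le hnn hle hR
  refine ⟨hS, ?_⟩
  have := hS.tsum_le_tsum hle hR
  rw [tsum_mul_left] at this
  have hl0 : 0 ≤ lam^(5/6:ℝ) := by positivity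
  calc _ ≤ c * (K * lam^(5/6:ℝ) * ∑' m : ℕ, maj (m+1)) := by gcongr
    _ ≤ _ := by linarith
end

section
/- For every positive integer m, the infinite product ∏_{p prime} ρ(p,m) over all primes converges, and ∑_{m=1}^∞ ∏_{p prime} ρ(p,m) = 1/(ζ(10)·(1 − 2^{−10})·(1 − 3^{−10})). -/
open Finset Filter Topology in
lemma aux_zeta_prod (k : ℕ) (hk : 1 < k) :
    HasProd (fun p : Nat.Primes => 1 - ((p : ℝ)⁻¹) ^ k)
      (∑' n : ℕ, 1 / ((n : ℝ) + 1) ^ k)⁻¹ ∧ (∑' n : ℕ, 1 / ((n : ℝ) + 1) ^ k) ≠ 0 := by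
  let f : ℕ →*₀ ℝ :=
    { toFun := fun n => ((n : ℝ)⁻¹) ^ k
      map_zero' := by simp; omega
      map_one' := by simp
      map_mul' := by intro a b; simp [mul_pow, mul_comm] }
  have hf : ∀ n, f n = ((n : ℝ)⁻¹) ^ k := fun _ => rfl
  have hs : Summable f := by
    have := Real.summable_nat_pow_inv.mpr hk
    refine this.congr ?_
    intro n; rw [hf, inv_pow]
  have hs' : Summable (fun n => ‖f n‖) := hs.norm
  have h := EulerProduct.eulerProduct_completely_multiplicative_hasProd hs'
  have hz : ∑' n : ℕ, f n = ∑' n : ℕ, 1 / ((n : ℝ) + 1) ^ k := by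
    rw [hs.tsum_eq_zero_add, map_zero, zero_add]
    congr 1; ext n; rw [hf]; push_cast; rw [inv_pow, one_div]
  have hne : (∑' n : ℕ, 1 / ((n : ℝ) + 1) ^ k) ≠ 0 := by
    rw [← hz]
    have : f 1 ≤ ∑' n, f n := hs.le_tsum 1 (fun j _ => by rw [hf]; positivity)
    rw [map_one] at this
    linarith
  rw [hz] at h
  refine ⟨?_, hne⟩
  have := h.inv₀ hne
  simpa [hf] using this

lemma aux_two_three (a b : ℝ) :
    HasProd (fun p : Nat.Primes => if (p : ℕ) = 3 then b else if (p : ℕ) = 2 then a else 1)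
      (b * a) := by
  have := hasProd_prod_of_ne_finset_one
    (f := fun p : Nat.Primes => if (p : ℕ) = 3 then b else if (p : ℕ) = 2 then a else 1)
    (L := SummationFilter.unconditional _)
    (s := ({⟨3, Nat.prime_three⟩, ⟨2, Nat.prime_two⟩} : Finset Nat.Primes)) (by
      rintro ⟨p, hp⟩ h
      have h3 : p ≠ 3 := by
        rintro rfl; apply h; exact Finset.mem_insert_self _ _
      have h2 : p ≠ 2 := by
        rintro rfl; apply h
        exact Finset.mem_insert_of_mem (Finset.mem_singleton_self _)
      simp [h3, h2])
  have hne : (⟨3, Nat.prime_three⟩ : Nat.Primes) ≠ ⟨2, Nat.prime_two⟩ := by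
    intro h; have := congrArg Subtype.val h; simp at this
  have e := Finset.prod_pair (f := fun p : Nat.Primes =>
    if (p : ℕ) = 3 then b else if (p : ℕ) = 2 then a else 1) hne
  have e2 := this.congr_fun (fun _ => rfl)
  erw [e] at e2
  simpa using e2

/-- local density as a function of the valuation -/
noncomputable def locr (p n : ℕ) : ℝ :=
  let q : ℝ := (p : ℝ)⁻¹
  if p = 3 then (if n = 0 then 1 else 0)
  else if p = 2 then (if n = 0 then 1/2 else if n ≤ 2 then 1/4 else 0)
  else if n = 0 then 1 - q^2
  else if n = 1 then q^2 * (1 - q)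
  else if n = 2 then q^3 * (1 - q)
  else if n = 3 then q^4 * (1 - q)^2
  else if n = 4 then q^5 * (1 - q) * (2 - q)
  else if n = 5 then q^6 * (1 - q) * (2 - 2*q)
  else if n ≤ 8 then q^(n+1) * (1 - q) * (3 - 2*q)
  else q^(n+1) * (1 - q) * (2 - 2*q)

lemma rho_eq (p m : ℕ) : rho p m = locr p (m.factorization p) := rfl

/-- the sum over all valuations -/
noncomputable def locS (p : ℕ) : ℝ :=
  if p = 3 then 1 else if p = 2 then 1 else 1 - ((p : ℝ)⁻¹) ^ 10

lemma q_lt (p : ℕ) (hp : p.Prime) : 0 < (p : ℝ)⁻¹ ∧ (p : ℝ)⁻¹ < 1 := by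
  have : (1 : ℝ) < p := by exact_mod_cast hp.one_lt
  exact ⟨by positivity, inv_lt_one_of_one_lt₀ this⟩

lemma locr_nonneg (p n : ℕ) (hp : p.Prime) : 0 ≤ locr p n := by
  obtain ⟨h0, h1⟩ := q_lt p hp
  unfold locr
  simp only
  generalize (p : ℝ)⁻¹ = q at *
  have a1 : 0 ≤ 1 - q := by linarith
  have a2 : 0 ≤ 2 - q := by linarith
  have a3 : 0 ≤ 2 - 2 * q := by linarith
  have a4 : 0 ≤ 3 - 2 * q := by linarith
  have a5 : 0 ≤ 1 - q ^ 2 := by nlinarith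
  split_ifs <;> positivity

lemma locr_zero_pos (p : ℕ) (hp : p.Prime) : 0 < locr p 0 := by
  obtain ⟨h0, h1⟩ := q_lt p hp
  unfold locr
  simp only [if_true]
  generalize (p : ℝ)⁻¹ = q at *
  have a5 : 0 < 1 - q ^ 2 := by nlinarith
  split_ifs <;> first | exact a5 | norm_num

lemma locr_hasSum (p : ℕ) (hp : p.Prime) : HasSum (locr p) (locS p) := by
  obtain ⟨h0, h1⟩ := q_lt p hp
  rw [← hasSum_nat_add_iff' 9]
  by_cases h3 : p = 3
  · subst h3
    simp [locr, locS, Finset.sum_range_succ]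
  by_cases h2 : p = 2
  · subst h2
    have : ∀ n : ℕ, locr 2 (n + 9) = 0 := by
      intro n; simp [locr]
    simp only [this]
    have : locS 2 - ∑ i ∈ Finset.range 9, locr 2 i = 0 := by
      simp [locr, locS, Finset.sum_range_succ]; norm_num
    rw [this]
    exact hasSum_zero
  have hg := (hasSum_geometric_of_lt_one h0.le h1).mul_left
    (((p : ℝ)⁻¹) ^ 10 * (1 - (p : ℝ)⁻¹) * (2 - 2 * (p : ℝ)⁻¹))
  have e1 : (fun n => locr p (n + 9)) = fun n => ((p : ℝ)⁻¹) ^ 10 * (1 - (p : ℝ)⁻¹) *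
      (2 - 2 * (p : ℝ)⁻¹) * ((p : ℝ)⁻¹) ^ n := by
    ext n
    simp only [locr, h3, h2, if_false]
    rw [if_neg (by omega), if_neg (by omega), if_neg (by omega), if_neg (by omega),
      if_neg (by omega), if_neg (by omega), if_neg (by omega)]
    ring
  have e2 : locS p - ∑ i ∈ Finset.range 9, locr p i = ((p : ℝ)⁻¹) ^ 10 * (1 - (p : ℝ)⁻¹) *
      (2 - 2 * (p : ℝ)⁻¹) * (1 - (p : ℝ)⁻¹)⁻¹ := by
    simp [locr, locS, h3, h2, Finset.sum_range_succ, -inv_pow]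
    generalize (p : ℝ)⁻¹ = q at *
    have : 1 - q ≠ 0 := by linarith
    field_simp
    ring
  rw [e1, e2]
  exact hg

/-- normalized local density -/
noncomputable def locg (p n : ℕ) : ℝ := if p.Prime then locr p n / locr p 0 else 1

lemma locg_zero (p : ℕ) : locg p 0 = 1 := by
  unfold locg
  split_ifs with h
  · exact div_self (locr_zero_pos p h).ne'
  · rfl

/-- the multiplicative function -/
noncomputable def mulF (m : ℕ) : ℝ := if m = 0 then 0 else m.factorization.prod locg

lemma mulF_nonneg (m : ℕ) : 0 ≤ mulF m := by
  unfold mulF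
  split_ifs with h
  · rfl
  · refine Finset.prod_nonneg fun p _ => ?_
    unfold locg
    split_ifs with h
    · exact div_nonneg (locr_nonneg p _ h) (locr_nonneg p _ h)
    · exact zero_le_one

lemma mulF_one : mulF 1 = 1 := by simp [mulF]

lemma mulF_mul {m n : ℕ} (h : Nat.Coprime m n) : mulF (m * n) = mulF m * mulF n := by
  unfold mulF
  by_cases hm : m = 0
  · simp [hm]
  by_cases hn : n = 0
  · simp [hn]
  simp only [hm, hn, mul_eq_zero, or_self, if_false]
  rw [Nat.factorization_mul_of_coprime h, Finsupp.prod_add_index_of_disjoint]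
  exact h.disjoint_primeFactors

lemma mulF_pow (p e : ℕ) (hp : p.Prime) : mulF (p ^ e) = locr p e / locr p 0 := by
  unfold mulF
  rw [if_neg (pow_ne_zero _ hp.ne_zero), hp.factorization_pow,
    Finsupp.prod_single_index (locg_zero p), locg, if_pos hp]

lemma mulF_pow_hasSum (p : ℕ) (hp : p.Prime) :
    HasSum (fun e => mulF (p ^ e)) (locS p / locr p 0) := by
  simp only [mulF_pow p _ hp]
  exact (locr_hasSum p hp).div_const _

lemma prod_locr_zero : ∃ C : ℝ, C ≠ 0 ∧ HasProd (fun p : Nat.Primes => locr p 0) C := by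
  obtain ⟨h, hne⟩ := aux_zeta_prod 2 (by norm_num)
  have h2 := h.mul (aux_two_three (2/3) (9/8))
  refine ⟨_, ?_, h2.congr_fun ?_⟩
  · have := inv_ne_zero hne
    positivity
  · rintro ⟨p, hp⟩
    simp only [locr]
    by_cases h3 : p = 3
    · subst h3; norm_num
    by_cases h2 : p = 2
    · subst h2; norm_num
    simp [h3, h2]

lemma prod_locS : HasProd (fun p : Nat.Primes => locS p)
    (1 / ((∑' n : ℕ, 1 / ((n : ℝ) + 1) ^ (10 : ℕ)) *
          (1 - (2 : ℝ)^(-10 : ℤ)) * (1 - (3 : ℝ)^(-10 : ℤ)))) := by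
  obtain ⟨h, hne⟩ := aux_zeta_prod 10 (by norm_num)
  have h2 := h.mul (aux_two_three (1 - (2 : ℝ)^(-10 : ℤ))⁻¹ (1 - (3 : ℝ)^(-10 : ℤ))⁻¹)
  convert h2 using 1
  · ext ⟨p, hp⟩
    simp only [locS]
    by_cases h3 : p = 3
    · subst h3; norm_num
    by_cases h2 : p = 2
    · subst h2; norm_num
    simp [h3, h2]
  · rw [one_div, mul_inv, mul_inv]; ring

lemma mulF_summable : Summable mulF := by
  obtain ⟨C, hC, hCp⟩ := prod_locr_zero
  have hd := prod_locS.div₀ hCp hC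
  set L := (1 / ((∑' n : ℕ, 1 / ((n : ℝ) + 1) ^ (10 : ℕ)) *
          (1 - (2 : ℝ)^(-10 : ℤ)) * (1 - (3 : ℝ)^(-10 : ℤ)))) / C
  let G : ℕ → ℝ := fun p => locS p / locr p 0
  change HasProd (G ∘ Subtype.val (p := (· ∈ {x | Nat.Prime x}))) _ at hd
  rw [hasProd_subtype_iff_mulIndicator] at hd
  have ht := hd.tendsto_prod_nat
  obtain ⟨B, hB⟩ := ht.bddAbove_range
  have hsumm : ∀ {p : ℕ}, p.Prime → Summable (fun n : ℕ ↦ ‖mulF (p ^ n)‖) :=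
    fun {p} hp => (mulF_pow_hasSum p hp).summable.norm
  refine summable_of_sum_range_le (c := B) mulF_nonneg fun N => ?_
  have key := (EulerProduct.summable_and_hasSum_smoothNumbers_prod_primesBelow_tsum
    mulF_one mulF_mul hsumm N).2
  have hprod : ∏ p ∈ N.primesBelow, ∑' n : ℕ, mulF (p ^ n) ≤ B := by
    have h1 : ∏ i ∈ Finset.range N, Set.mulIndicator {p | Nat.Prime p} G i =
        ∏ p ∈ N.primesBelow, G p :=
      Finset.prod_mulIndicator_eq_prod_filter (Finset.range N) (fun _ ↦ G)
        (fun _ ↦ {p | Nat.Prime p}) id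
    have h2 : ∏ p ∈ N.primesBelow, ∑' n : ℕ, mulF (p ^ n) = ∏ p ∈ N.primesBelow, G p :=
      Finset.prod_congr rfl fun p hp =>
        (mulF_pow_hasSum p (Nat.prime_of_mem_primesBelow hp)).tsum_eq
    rw [h2, ← h1]
    exact hB ⟨N, rfl⟩
  refine le_trans ?_ hprod
  change HasSum (mulF ∘ Subtype.val (p := (· ∈ N.smoothNumbers))) _ at key
  rw [hasSum_subtype_iff_indicator] at key
  refine le_trans (le_of_eq ?_) (sum_le_hasSum (Finset.range N) (fun i _ =>
    Set.indicator_nonneg (fun _ _ => mulF_nonneg _) i) key)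
  refine Finset.sum_congr rfl fun i hi => ?_
  by_cases h0 : i = 0
  · subst h0
    have : mulF 0 = 0 := by simp [mulF]
    simp [Set.indicator_apply, this]
  · rw [Set.indicator_of_mem]
    exact Nat.mem_smoothNumbers_of_lt (Nat.pos_of_ne_zero h0) (Finset.mem_range.mp hi)

lemma rho_hasProd {C : ℝ} (hC : HasProd (fun p : Nat.Primes => locr p 0) C) (m : ℕ)
    (hm : m ≠ 0) : HasProd (fun p : Nat.Primes => rho p m) (C * mulF m) := by
  have h1 : HasProd (fun p : Nat.Primes => locg p (m.factorization p)) (mulF m) := by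
    let G : ℕ → ℝ := fun p => locg p (m.factorization p)
    change HasProd (G ∘ Subtype.val (p := (· ∈ {x | Nat.Prime x}))) _
    have hG : ∀ p ∉ m.primeFactors, G p = 1 := by
      intro p hp
      have : m.factorization p = 0 := by
        rwa [← Nat.support_factorization, Finsupp.notMem_support_iff] at hp
      simp only [G, this, locg_zero]
    rw [hasProd_subtype_iff_mulIndicator, Set.mulIndicator_eq_self.mpr]
    · have := hasProd_prod_of_ne_finset_one (L := SummationFilter.unconditional _) hG
      unfold mulF
      rw [if_neg hm]
      exact this
    · intro p hp
      by_contra hc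
      apply hp
      simp only [G, locg, if_neg (show ¬ p.Prime from hc)]
  refine (hC.mul h1).congr_fun ?_
  rintro ⟨p, hp⟩
  have := (locr_zero_pos p hp).ne'
  simp only [rho_eq, locg, if_pos hp]
  field_simp

theorem stmt13 :
    (∀ m : ℕ, 0 < m → Multipliable (fun p : Nat.Primes => rho (p : ℕ) m)) ∧
    (∑' m : ℕ, ∏' p : Nat.Primes, rho (p : ℕ) (m + 1))
      = 1 / ((∑' n : ℕ, 1 / ((n : ℝ) + 1) ^ (10 : ℕ)) *
          (1 - (2 : ℝ)^(-10 : ℤ)) * (1 - (3 : ℝ)^(-10 : ℤ))) := by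
  obtain ⟨C, hC, hCp⟩ := prod_locr_zero
  refine ⟨fun m hm => (rho_hasProd hCp m hm.ne').multipliable, ?_⟩
  have h0 : mulF 0 = 0 := by simp [mulF]
  have h1 : ∀ m : ℕ, ∏' p : Nat.Primes, rho (p : ℕ) (m + 1) = C * mulF (m + 1) :=
    fun m => (rho_hasProd hCp (m + 1) (Nat.succ_ne_zero m)).tprod_eq
  simp only [h1]
  rw [tsum_mul_left]
  have h2 := mulF_summable.tsum_eq_zero_add
  rw [h0, zero_add] at h2
  rw [← h2]
  have h3 := EulerProduct.eulerProduct_hasProd mulF_one mulF_mul mulF_summable.norm h0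
  have h4 := hCp.mul h3
  refine h4.unique ?_
  convert prod_locS using 1
  ext ⟨p, hp⟩
  have := (locr_zero_pos p hp).ne'
  rw [(mulF_pow_hasSum p hp).tsum_eq]
  field_simp
end

section
/- There is an absolute constant C > 0 such that for all real H > 1 and all real X > 0, the number of pairs (a,b) ∈ F(H) with 16·|4a³ + 27b²| < X is at most C·(X^{5/6} + H^{1/2}). -/
lemma aux_card (A : Finset ℤ) (D : ℝ) (hD : 0 ≤ D)
    (h : ∀ u ∈ A, ∀ v ∈ A, u ≤ v → ((v - u : ℤ) : ℝ) ≤ D) : (A.card : ℝ) ≤ D + 1 := by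
  rcases A.eq_empty_or_nonempty with rfl | hne
  · simp; linarith
  · have h1 := h _ (A.min'_mem hne) _ (A.max'_mem hne) (A.min'_le _ (A.max'_mem hne))
    have hsub : A ⊆ Finset.Icc (A.min' hne) (A.max' hne) := fun x hx =>
      Finset.mem_Icc.2 ⟨A.min'_le _ hx, A.le_max' _ hx⟩
    have h2 := Finset.card_le_card hsub
    rw [Int.card_Icc] at h2
    have h3 := A.min'_le _ (A.max'_mem hne)
    have h4 : (A.card : ℤ) ≤ A.max' hne - A.min' hne + 1 := by omega
    have h5 : (A.card : ℝ) ≤ ((A.max' hne - A.min' hne : ℤ) : ℝ) + 1 := by exact_mod_cast h4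
    linarith

lemma aux_diff (u v x y : ℝ) (hx : 0 < x) (hy : 0 < y) (huv : u ≤ v)
    (hu : |4 * u ^ 3 + 27 * x ^ 6| < y ^ 6) (hv : |4 * v ^ 3 + 27 * x ^ 6| < y ^ 6) :
    v - u ≤ 8 * (y ^ 6 / (x ^ 2 * (x + y) ^ 2)) := by
  rw [abs_lt] at hu hv
  have hd : 0 ≤ v - u := by linarith
  have h3 : (v - u) * (u ^ 2 + u * v + v ^ 2) ≤ y ^ 6 / 2 := by nlinarith
  have hpos : 0 < x ^ 2 * (x + y) ^ 2 := by positivity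
  rw [← mul_div_assoc, le_div_iff₀ hpos]
  rcases le_total x y with hxy | hxy
  · have hq : (v - u) ^ 3 ≤ (2 * y ^ 2) ^ 3 := by
      have : (v - u) * (v - u) ^ 2 ≤ (v - u) * (4 * (u ^ 2 + u * v + v ^ 2)) := by
        apply mul_le_mul_of_nonneg_left _ hd
        nlinarith [sq_nonneg (u + v)]
      have : 0 < y ^ 6 := by positivity
      nlinarith
    have hq2 : v - u ≤ 2 * y ^ 2 := le_of_pow_le_pow_left₀ (by norm_num) (by positivity) hq
    have hb : x ^ 2 * (x + y) ^ 2 ≤ y ^ 2 * (2 * y) ^ 2 := by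
      gcongr; linarith
    calc (v - u) * (x ^ 2 * (x + y) ^ 2) ≤ (2 * y ^ 2) * (y ^ 2 * (2 * y) ^ 2) := by gcongr
      _ = 8 * y ^ 6 := by ring
  · have hyx : y ^ 6 ≤ x ^ 6 := by gcongr
    have hx6 : 0 < x ^ 6 := by positivity
    have key : ∀ w : ℝ, 4 * w ^ 3 + 27 * x ^ 6 < y ^ 6 → 3 / 2 * x ^ 2 ≤ -w := by
      intro w hw
      by_contra hc
      push Not at hc
      have h1 : (-w) ^ 3 < (3 / 2 * x ^ 2) ^ 3 := Odd.strictMono_pow (by decide) hc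
      nlinarith
    have ku := key u hu.2
    have kv := key v hv.2
    have hx2 : 0 < x ^ 2 := by positivity
    have hs : 2 * x ^ 4 ≤ u ^ 2 + u * v + v ^ 2 := by
      nlinarith [mul_le_mul ku kv (by positivity) (by linarith),
        mul_le_mul ku ku (by positivity) (by linarith),
        mul_le_mul kv kv (by positivity) (by linarith)]
    have hb : x ^ 2 * (x + y) ^ 2 ≤ x ^ 2 * (2 * x) ^ 2 := by
      gcongr; linarith
    have h4 : (v - u) * (2 * x ^ 4) ≤ y ^ 6 / 2 :=
      (mul_le_mul_of_nonneg_left hs hd).trans h3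
    have h5 := mul_le_mul_of_nonneg_left hb hd
    have : 0 < y ^ 6 := by positivity
    nlinarith

lemma aux_tel (x x' y : ℝ) (hx : 0 < x) (hx' : 0 ≤ x') (hy : 0 < y) (h : x ^ 3 = x' ^ 3 + 1) :
    y ^ 6 / (x ^ 2 * (x + y) ^ 2) ≤ 3 * y ^ 5 * (y / (y + x') - y / (y + x)) := by
  have hle : x' ≤ x := by
    apply le_of_pow_le_pow_left₀ (n := 3) (by norm_num) hx.le; linarith
  have h1 : 1 ≤ (x - x') * (3 * x ^ 2) := by
    have : (x - x') * (x ^ 2 + x * x' + x' ^ 2) = 1 := by linarith [h]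
    have : (x - x') * (x ^ 2 + x * x' + x' ^ 2) ≤ (x - x') * (3 * x ^ 2) := by
      apply mul_le_mul_of_nonneg_left _ (by linarith)
      nlinarith
    linarith
  have e : 3 * y ^ 5 * (y / (y + x') - y / (y + x))
      = y ^ 6 * ((x - x') * (3 * x ^ 2)) / (x ^ 2 * ((x + y) * (x' + y))) := by
    field_simp
    ring
  rw [e]
  have : y ^ 6 ≤ y ^ 6 * ((x - x') * (3 * x ^ 2)) := by
    have : 0 < y ^ 6 := by positivity
    nlinarith
  have : (x + y) * (x' + y) ≤ (x + y) ^ 2 := by nlinarith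
  gcongr

theorem stmt14 (r t : ℤ) (hr : ¬(3 ∣ r)) (ht : ¬(2 ∣ t)) :
    ∃ C : ℝ, 0 < C ∧ ∀ H X : ℝ, 1 < H → 0 < X →
      (Nat.card {ab : ℤ × ℤ | ab ∈ Family r t H ∧
          (16 * |4 * (ab.1 : ℝ)^3 + 27 * (ab.2 : ℝ)^2|) < X} : ℝ)
        ≤ C * (X ^ ((5:ℝ)/6) + H ^ ((1:ℝ)/2)) := by
  refine ⟨48, by norm_num, fun H X hH hX => ?_⟩
  set S : Set (ℤ × ℤ) := {ab : ℤ × ℤ | ab ∈ Family r t H ∧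
          (16 * |4 * (ab.1 : ℝ)^3 + 27 * (ab.2 : ℝ)^2|) < X} with hS
  set B := H ^ ((1:ℝ)/2) with hB
  have hB0 : 0 ≤ B := by positivity
  have hfin : S.Finite := by
    apply Set.Finite.subset ((Set.finite_Icc (-⌊H ^ ((1:ℝ)/3)⌋) ⌊H ^ ((1:ℝ)/3)⌋).prod
      (Set.finite_Icc (-⌊B⌋) ⌊B⌋))
    rintro ⟨a, b⟩ ⟨⟨-, -, h1, h2, -⟩, -⟩
    simp only [Set.mem_prod, Set.mem_Icc, ← abs_le]
    constructor
    · rw [Int.le_floor]; push_cast; exact h1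
    · rw [Int.le_floor]; push_cast; exact h2
  obtain ⟨y, hy, hy6, hy5⟩ : ∃ y : ℝ, 0 < y ∧ 16 * y ^ 6 = X ∧ y ^ 5 ≤ X ^ ((5:ℝ)/6) := by
    refine ⟨(X / 16) ^ ((1:ℝ)/6), by positivity, ?_, ?_⟩
    · rw [← Real.rpow_natCast, ← Real.rpow_mul (by positivity)]
      norm_num
      ring
    · rw [← Real.rpow_natCast, ← Real.rpow_mul (by positivity)]
      norm_num
      apply Real.rpow_le_rpow <;> linarith
  let ψ : ℕ → ℝ := fun n => y / (y + (n : ℝ) ^ ((1:ℝ)/3))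
  let M := ⌊B⌋₊
  let T := hfin.toFinset
  have hcard : Nat.card S = T.card := by
    rw [Nat.card_coe_set_eq, Set.ncard_eq_toFinset_card _ hfin]
  rw [hcard]
  have hmap : ∀ p ∈ T, p.2.natAbs - 1 ∈ Finset.range M := by
    intro p hp
    obtain ⟨⟨-, h0, h1, h2, -⟩, -⟩ := (hfin.mem_toFinset).1 hp
    have hb : p.2 ≠ 0 := by
      intro h; rw [h] at h0
      apply ht
      have := (Int.modEq_iff_dvd.1 h0)
      omega
    have : p.2.natAbs ≤ M := by
      apply Nat.le_floor
      rw [Nat.cast_natAbs]; push_cast; exact h2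
    rw [Finset.mem_range]
    have := Int.natAbs_pos.2 hb
    omega
  have hne : ∀ p ∈ T, p.2 ≠ 0 := by
    intro p hp
    obtain ⟨⟨-, h0, h1, h2, -⟩, -⟩ := (hfin.mem_toFinset).1 hp
    intro h; rw [h] at h0
    apply ht
    have := (Int.modEq_iff_dvd.1 h0)
    omega
  rw [Finset.card_eq_sum_card_fiberwise hmap]
  have hfib : ∀ n ∈ Finset.range M,
      ((T.filter (fun p => p.2.natAbs - 1 = n)).card : ℝ)
        ≤ 2 + 48 * y ^ 5 * (ψ n - ψ (n + 1)) := by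
    intro n _
    set U := T.filter (fun p => p.2.natAbs - 1 = n) with hU
    set A := U.image Prod.fst with hA
    have hUb : ∀ p ∈ U, p.2 = (n + 1 : ℤ) ∨ p.2 = -(n + 1 : ℤ) := by
      intro p hp
      obtain ⟨h1, h2⟩ := Finset.mem_filter.1 hp
      have := hne p h1
      omega
    have hsub : U ⊆ A ×ˢ ({(n + 1 : ℤ), -(n + 1 : ℤ)} : Finset ℤ) := by
      intro p hp
      rw [Finset.mem_product]
      refine ⟨Finset.mem_image_of_mem _ hp, ?_⟩
      simpa using hUb p hp
    have hc : U.card ≤ A.card * 2 := by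
      refine (Finset.card_le_card hsub).trans ?_
      rw [Finset.card_product]
      exact Nat.mul_le_mul_left _ Finset.card_le_two
    set x : ℝ := ((n + 1 : ℕ) : ℝ) ^ ((1:ℝ)/3) with hx
    set x' : ℝ := (n : ℝ) ^ ((1:ℝ)/3) with hx'
    have hx0 : 0 < x := by positivity
    have hx0' : 0 ≤ x' := by positivity
    have hx3 : x ^ 3 = n + 1 := by
      rw [hx, ← Real.rpow_natCast, ← Real.rpow_mul (by positivity)]
      norm_num
    have hx3' : x' ^ 3 = n := by
      rw [hx', ← Real.rpow_natCast, ← Real.rpow_mul (by positivity)]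
      norm_num
    have hAm : ∀ u ∈ A, |4 * (u : ℝ) ^ 3 + 27 * x ^ 6| < y ^ 6 := by
      intro u hu
      obtain ⟨p, hp, rfl⟩ := Finset.mem_image.1 hu
      have h1 := (hfin.mem_toFinset.1 (Finset.mem_filter.1 hp).1).2
      have h2 : (p.2 : ℝ) ^ 2 = x ^ 6 := by
        have : x ^ 6 = (x ^ 3) ^ 2 := by ring
        rw [this, hx3]
        rcases hUb p hp with h | h <;> rw [h] <;> push_cast <;> ring
      rw [h2] at h1
      linarith
    have hAc := aux_card A (8 * (y ^ 6 / (x ^ 2 * (x + y) ^ 2))) (by positivity) (by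
      intro u hu v hv huv
      push_cast
      exact aux_diff u v x y hx0 hy (by exact_mod_cast huv) (hAm u hu) (hAm v hv))
    have htel := aux_tel x x' y hx0 hx0' hy (by rw [hx3, hx3'])
    have hc' : (U.card : ℝ) ≤ A.card * 2 := by exact_mod_cast hc
    have e : ψ n - ψ (n + 1) = y / (y + x') - y / (y + x) := rfl
    rw [e]
    linarith
  push_cast
  refine (Finset.sum_le_sum hfib).trans ?_
  rw [Finset.sum_add_distrib, ← Finset.mul_sum, Finset.sum_range_sub']
  have h0 : ψ 0 ≤ 1 := by
    simp only [ψ]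
    apply div_le_one_of_le₀ <;> norm_num <;> positivity
  have h1 : 0 ≤ ψ M := by simp only [ψ]; positivity
  have hM : (M : ℝ) ≤ B := Nat.floor_le hB0
  have : 48 * y ^ 5 * (ψ 0 - ψ M) ≤ 48 * y ^ 5 * 1 := by
    gcongr; linarith
  simp
  linarith
end
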